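/- Under the bounded-support assumption on q_0, the step-size assumption, and the score-estimation assumption stated in the context, the joint law Q^dis of the time-reversed forward chain at the discretization times and the joint law Q̂^dis of the sampler chain initialized at q_T satisfy KL(Q^dis ‖ Q̂^dis) ≤ C · ( d³ κ² T + d⁷ κ³ (δ^{-1} + T) + Σ_{k=0}^{K-1} ε_k^{1/2} κ^{1/2} σ_{T−t_k} d λ_{T−t_k}^{-1/2} ) for a universal constant C > 0, where δ = T − t_K. -/

import Mathlib

/- Stochastic Runge–Kutta diffusion sampler: main convergence theorem (Theorem 3.1).

   Setup: `stdGaussian d` is the standard Gaussian N(0, I_d) on ℝ^d,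
   `forwardLaw q0 u` is the law q_u of e^{-u} θ + √(1-e^{-2u}) g with θ ~ q0, g ~ N(0,I_d),
   `klDiv'` is the Kullback–Leibler divergence,
   `samplerLaw init step k` is the law of the k-th iterate of the Markov chain
   Ŷ_{k+1} = step k Ŷ_k (g_{k,1}, g_{k,2}) with fresh independent standard Gaussians,
   and `rkStep` is the stochastic Runge–Kutta update. -/

open MeasureTheory ProbabilityTheory Real

noncomputable section

abbrev Vec (d : ℕ) := EuclideanSpace ℝ (Fin d)

def stdGaussian (d : ℕ) : Measure (Vec d) :=
  Measure.map (⇑(EuclideanSpace.equiv (Fin d) ℝ).symm)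
    (Measure.pi fun _ : Fin d => gaussianReal 0 1)

def forwardLaw {d : ℕ} (q0 : Measure (Vec d)) (u : ℝ) : Measure (Vec d) :=
  Measure.map (fun p : Vec d × Vec d =>
      Real.exp (-u) • p.1 + Real.sqrt (1 - Real.exp (-2*u)) • p.2)
    (q0.prod (stdGaussian d))

def klDiv' {α : Type*} [MeasurableSpace α] (μ ν : Measure α) : ℝ :=
  ∫ x, Real.log ((μ.rnDeriv ν x).toReal) ∂μ

def f1 (Δ : ℝ) : ℝ := Real.exp (2*Δ)/2 - 2*Real.exp Δ + Δ + 3/2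
def f2 (Δ : ℝ) : ℝ := Real.exp (2*Δ)/2 - 1/2
def f3 (Δ : ℝ) : ℝ := Real.exp (2*Δ)/2 - Real.exp Δ + 1/2
def zeta1 (Δ : ℝ) : ℝ := 2 * Real.sqrt 2 * Real.sqrt (f1 Δ) / (Real.exp Δ - Real.exp (-Δ))
def zeta2 (Δ : ℝ) : ℝ := Real.sqrt 2 * f3 Δ / Real.sqrt (f1 Δ)
def zeta3 (Δ : ℝ) : ℝ := Real.sqrt (2 * f2 Δ - 2 * (f3 Δ)^2 / f1 Δ)

/-- One step of the stochastic Runge–Kutta sampler with step size `Δ` and score estimate `shat`. -/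
def rkStep {d : ℕ} (Δ : ℝ) (shat : Vec d → Vec d) (y : Vec d) (g : Vec d × Vec d) : Vec d :=
  Real.exp Δ • y + (Real.exp Δ - Real.exp (-Δ)) • shat (y + zeta1 Δ • g.1)
    + zeta2 Δ • g.1 + zeta3 Δ • g.2

/-- Law of the `k`-th iterate of the sampler Markov chain driven by two fresh independent
standard Gaussians per step. -/
def samplerLaw {d : ℕ} (init : Measure (Vec d))
    (step : ℕ → Vec d → Vec d × Vec d → Vec d) : ℕ → Measure (Vec d)
  | 0 => init
  | k + 1 => Measure.map (fun p : Vec d × (Vec d × Vec d) => step k p.1 p.2)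
      ((samplerLaw init step k).prod ((stdGaussian d).prod (stdGaussian d)))

/-- The true score `s(u, x) = ∇_x log q_{T-u}(x)`, expressed through the density `ρ` of the
forward process. -/
def score {d : ℕ} (ρ : ℝ → Vec d → ℝ) (T u : ℝ) (x : Vec d) : Vec d :=
  gradient (fun y => Real.log (ρ (T - u) y)) x

/-- One step of the forward Ornstein–Uhlenbeck chain over a time span `a`:
`x ↦ e^{-a} x + √(1 - e^{-2a}) g`. -/
def ouStep {d : ℕ} (a : ℝ) (x g : Vec d) : Vec d :=
  Real.exp (-a) • x + Real.sqrt (1 - Real.exp (-2*a)) • g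

/-- Joint law of a Markov chain `(Z_0, …, Z_n)` with initial law `init`, driven by i.i.d.
noise with law `ν`: `Z_{j+1} = step j Z_j ξ_j` with `ξ_j ~ ν` independent of the past. -/
def jointChain {d : ℕ} {N : Type*} [MeasurableSpace N] (ν : Measure N)
    (init : Measure (Vec d)) (step : ℕ → Vec d → N → Vec d) :
    (n : ℕ) → Measure (Fin (n+1) → Vec d)
  | 0 => Measure.map (fun x => fun _ : Fin 1 => x) init
  | n + 1 => Measure.map
      (fun p : (Fin (n+1) → Vec d) × N => Fin.snoc p.1 (step n (p.1 (Fin.last n)) p.2))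
      ((jointChain ν init step n).prod ν)

/-- The joint law `Q^dis` of `(X_{T-t_0}, X_{T-t_1}, …, X_{T-t_K})`, where `(X_u)` is the
forward Ornstein–Uhlenbeck chain with `X_0 ~ q0` (so `X_u ~ q_u`).  It is obtained by running
the forward chain from `X_{T-t_K} ~ q_{T-t_K}` through the times `T - t_K < ⋯ < T - t_0` and
then reversing the order of the coordinates. -/
def Qdis {d : ℕ} (q0 : Measure (Vec d)) (T : ℝ) (K : ℕ) (t : ℕ → ℝ) :
    Measure (Fin (K+1) → Vec d) :=
  Measure.map (fun v => fun k : Fin (K+1) => v (Fin.rev k))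
    (jointChain (stdGaussian d) (forwardLaw q0 (T - t K))
      (fun j x g => ouStep (t (K - j) - t (K - j - 1)) x g) K)

/-- The joint law `Q̂^dis` of the sampler chain `(Ŷ_{t_0}, …, Ŷ_{t_K})` initialized at
`Ŷ_{t_0} ~ q_T`. -/
def QhatDis {d : ℕ} (q0 : Measure (Vec d)) (T : ℝ) (K : ℕ) (t : ℕ → ℝ)
    (sHat : ℕ → Vec d → Vec d) : Measure (Fin (K+1) → Vec d) :=
  jointChain ((stdGaussian d).prod (stdGaussian d)) (forwardLaw q0 T)
    (fun k y g => rkStep (t (k+1) - t k) (sHat k) y g) K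

open scoped ENNReal NNReal InnerProductSpace

set_option linter.unusedSectionVars false

section Gaussian

variable {E : Type*} [NormedAddCommGroup E] [InnerProductSpace ℝ E] [FiniteDimensional ℝ E]
  [MeasurableSpace E] [BorelSpace E]

/-- The standard Gaussian measure of a finite-dimensional inner product space. -/
abbrev gaussOn (E : Type*) [NormedAddCommGroup E] [InnerProductSpace ℝ E] [FiniteDimensional ℝ E]
    [MeasurableSpace E] : Measure E :=
  ProbabilityTheory.stdGaussian E

theorem stdGaussian_eq_gaussOn (d : ℕ) : _root_.stdGaussian d = gaussOn (Vec d) :=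
  map_pi_eq_stdGaussian

/-- The standard Gaussian density. -/
def gaussDensity (x : E) : ℝ := (2 * π) ^ (-(Module.finrank ℝ E / 2 : ℝ)) * exp (-‖x‖ ^ 2 / 2)

theorem gaussDensity_pos (x : E) : 0 < gaussDensity x := by unfold gaussDensity; positivity

@[fun_prop]
theorem continuous_gaussDensity : Continuous (gaussDensity (E := E)) := by
  unfold gaussDensity; fun_prop

@[fun_prop]
theorem measurable_gaussDensity : Measurable (gaussDensity (E := E)) :=
  continuous_gaussDensity.measurable

theorem integral_gaussDensity : ∫ x : E, gaussDensity x = 1 := by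
  unfold gaussDensity
  rw [integral_const_mul]
  have := GaussianFourier.integral_rexp_neg_mul_sq_norm (V := E) (b := 1 / 2) (by norm_num)
  have h2 : (fun v : E => rexp (-‖v‖ ^ 2 / 2)) = fun v => rexp (-(1/2) * ‖v‖ ^ 2) := by
    ext v; congr 1; ring
  rw [h2, this, rpow_neg (by positivity)]
  have : π / (1/2) = 2 * π := by ring
  rw [this]
  exact inv_mul_cancel₀ (by positivity)

theorem integrable_gaussDensity : Integrable (gaussDensity (E := E)) := by
  by_contra h
  have := integral_gaussDensity (E := E)
  rw [integral_undef h] at this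
  norm_num at this

theorem lintegral_gaussDensity : ∫⁻ x : E, ENNReal.ofReal (gaussDensity x) = 1 := by
  rw [← ofReal_integral_eq_lintegral_ofReal integrable_gaussDensity
    (.of_forall fun x => (gaussDensity_pos x).le), integral_gaussDensity, ENNReal.ofReal_one]

theorem gaussOn_eq_withDensity :
    gaussOn E = volume.withDensity fun x => ENNReal.ofReal (gaussDensity x) := by
  have : IsProbabilityMeasure (volume.withDensity fun x : E => ENNReal.ofReal (gaussDensity x)) :=
    ⟨by rw [withDensity_apply _ .univ, Measure.restrict_univ, lintegral_gaussDensity]⟩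
  refine Measure.ext_of_charFun ?_
  ext t
  rw [charFun_stdGaussian, charFun_apply]
  rw [integral_withDensity_eq_integral_toReal_smul (by fun_prop) (by simp)]
  simp_rw [ENNReal.toReal_ofReal (gaussDensity_pos _).le]
  have h := GaussianFourier.integral_cexp_neg_mul_sq_norm_add (V := E) (b := 1 / 2) (by norm_num)
    Complex.I t
  have h2 : ∀ x : E, gaussDensity x • Complex.exp (↑⟪x, t⟫_ℝ * Complex.I)
      = ((2 * π) ^ (-(Module.finrank ℝ E / 2 : ℝ)) : ℝ) *
        Complex.exp (-(1/2) * ‖x‖ ^ 2 + Complex.I * ⟪t, x⟫_ℝ) := by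
    intro x
    rw [gaussDensity, Complex.real_smul, Complex.exp_add, real_inner_comm]
    push_cast
    rw [mul_assoc, mul_comm Complex.I]
    congr 4
    ring
  simp_rw [h2]
  rw [integral_const_mul, h]
  have h3 : ((π : ℂ) / (1/2)) ^ ((Module.finrank ℝ E : ℂ) / 2)
      = (((2 * π) ^ (Module.finrank ℝ E / 2 : ℝ) : ℝ) : ℂ) := by
    rw [Complex.ofReal_cpow (by positivity)]
    push_cast
    congr 1
    ring
  rw [h3, ← mul_assoc, ← Complex.ofReal_mul, rpow_neg (by positivity),
    inv_mul_cancel₀ (by positivity)]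
  simp only [Complex.ofReal_one, one_mul, Complex.I_sq]
  congr 1
  ring

theorem lintegral_gaussOn {F : E → ℝ≥0∞} (hF : Measurable F) :
    ∫⁻ x, F x ∂(gaussOn E) = ∫⁻ x, ENNReal.ofReal (gaussDensity x) * F x := by
  rw [gaussOn_eq_withDensity, lintegral_withDensity_eq_lintegral_mul _ (by fun_prop) hF]
  rfl

theorem gaussDensity_sub (x a : E) :
    gaussDensity (x - a) = gaussDensity x * exp (⟪x, a⟫_ℝ - ‖a‖ ^ 2 / 2) := by
  unfold gaussDensity
  rw [mul_assoc, ← exp_add, norm_sub_sq_real]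
  congr 2
  ring

/-- Cameron–Martin formula for the standard Gaussian measure. -/
theorem lintegral_gaussOn_add {F : E → ℝ≥0∞} (hF : Measurable F) (a : E) :
    ∫⁻ x, F (x + a) ∂(gaussOn E)
      = ∫⁻ x, ENNReal.ofReal (exp (⟪x, a⟫_ℝ - ‖a‖ ^ 2 / 2)) * F x ∂(gaussOn E) := by
  rw [lintegral_gaussOn (by fun_prop), lintegral_gaussOn (by fun_prop)]
  rw [← lintegral_sub_right_eq_self _ a]
  refine lintegral_congr fun x => ?_
  rw [sub_add_cancel, gaussDensity_sub, ENNReal.ofReal_mul (gaussDensity_pos x).le, mul_assoc]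

theorem map_inner_gaussOn (x : E) :
    (gaussOn E).map (fun g => ⟪x, g⟫_ℝ) = (gaussianReal 0 1).map (fun s => ‖x‖ * s) := by
  have : IsFiniteMeasure ((gaussOn E).map (fun g => ⟪x, g⟫_ℝ)) :=
    Measure.isFiniteMeasure_map _ _
  refine Measure.ext_of_charFun ?_
  ext t
  rw [gaussianReal_map_const_mul, charFun_gaussianReal, charFun_apply_real,
    integral_map (by fun_prop) (by fun_prop)]
  have := charFun_stdGaussian (E := E) (t • x)
  rw [charFun_apply] at this
  have h2 : ∀ g : E, Complex.exp (↑t * ↑⟪x, g⟫_ℝ * Complex.I)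
      = Complex.exp (↑⟪g, t • x⟫_ℝ * Complex.I) := by
    intro g
    rw [inner_smul_right, real_inner_comm]
    push_cast; rfl
  simp_rw [h2]
  rw [this, norm_smul]
  congr 1
  simp
  ring_nf
  rw [← Complex.ofReal_pow, sq_abs]
  push_cast
  ring

theorem lintegral_inner_gaussOn {F : ℝ → ℝ≥0∞} (hF : Measurable F) (x : E) :
    ∫⁻ g, F ⟪x, g⟫_ℝ ∂(gaussOn E) = ∫⁻ s, F (‖x‖ * s) ∂(gaussianReal 0 1) := by
  have h1 := lintegral_map (μ := gaussOn E) hF (g := fun g => ⟪x, g⟫_ℝ) (by fun_prop)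
  have h2 := lintegral_map (μ := gaussianReal 0 1) hF (g := fun s => ‖x‖ * s) (by fun_prop)
  rw [← h1, ← h2, map_inner_gaussOn]

/-- The product of two standard Gaussians is invariant under reflections of the plane. -/
theorem map_reflect_gaussOn_prod {c s : ℝ} (h : c ^ 2 + s ^ 2 = 1) :
    ((gaussOn E).prod (gaussOn E)).map (fun p => (c • p.1 + s • p.2, s • p.1 - c • p.2))
      = (gaussOn E).prod (gaussOn E) := by
  let L : E × E →L[ℝ] E × E :=
    (c • ContinuousLinearMap.fst ℝ E E + s • ContinuousLinearMap.snd ℝ E E).prod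
      (s • ContinuousLinearMap.fst ℝ E E - c • ContinuousLinearMap.snd ℝ E E)
  have hL : (fun p : E × E => (c • p.1 + s • p.2, s • p.1 - c • p.2)) = L := by
    ext p <;> simp [L]
  rw [hL]
  have : IsFiniteMeasure (((gaussOn E).prod (gaussOn E)).map L) := Measure.isFiniteMeasure_map _ _
  refine Measure.ext_of_charFunDual ?_
  ext f
  rw [charFunDual_map, charFunDual_prod, charFunDual_prod]
  simp only [← charFun_toDual_symm_eq_charFunDual]
  set A := (InnerProductSpace.toDual ℝ E).symm (f.comp (.inl ℝ E E)) with hA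
  set B := (InnerProductSpace.toDual ℝ E).symm (f.comp (.inr ℝ E E)) with hB
  have h1 : (f.comp L).comp (.inl ℝ E E) = c • f.comp (.inl ℝ E E) + s • f.comp (.inr ℝ E E) := by
    ext x
    simp only [L, ContinuousLinearMap.comp_apply, _root_.add_apply,
      _root_.smul_apply, ← map_smul, ← map_add]
    congr 1; simp
  have h2 : (f.comp L).comp (.inr ℝ E E) = s • f.comp (.inl ℝ E E) - c • f.comp (.inr ℝ E E) := by
    ext x
    simp only [L, ContinuousLinearMap.comp_apply, _root_.sub_apply,
      _root_.smul_apply, ← map_smul, ← map_sub]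
    congr 1; simp
  rw [h1, h2]
  simp only [map_add, map_sub, map_smulₛₗ, ← hA, ← hB, charFun_stdGaussian, ← Complex.exp_add]
  congr 1
  simp only [conj_trivial]
  have h3 : ‖c • A + s • B‖ ^ 2 + ‖s • A - c • B‖ ^ 2 = ‖A‖ ^ 2 + ‖B‖ ^ 2 := by
    rw [norm_add_sq_real, norm_sub_sq_real]
    simp only [norm_smul, inner_smul_left, inner_smul_right, mul_pow, norm_eq_abs, sq_abs,
      conj_trivial]
    linear_combination (‖A‖ ^ 2 + ‖B‖ ^ 2) * h
  have h4 : ((‖c • A + s • B‖ ^ 2 + ‖s • A - c • B‖ ^ 2 : ℝ) : ℂ) = ((‖A‖ ^ 2 + ‖B‖ ^ 2 : ℝ) : ℂ) := by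
    rw [h3]
  push_cast at h4
  linear_combination (-1/2) * h4

theorem lintegral_reflect_gaussOn {c s : ℝ} (h : c ^ 2 + s ^ 2 = 1) {F : E × E → ℝ≥0∞}
    (hF : Measurable F) :
    ∫⁻ p, F (c • p.1 + s • p.2, s • p.1 - c • p.2) ∂((gaussOn E).prod (gaussOn E))
      = ∫⁻ p, F p ∂((gaussOn E).prod (gaussOn E)) := by
  conv_rhs => rw [← map_reflect_gaussOn_prod h, lintegral_map hF (by fun_prop)]

theorem lintegral_smul_add_smul_gaussOn (a b : ℝ) {F : E → ℝ≥0∞} (hF : Measurable F) :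
    ∫⁻ g, ∫⁻ h, F (a • g + b • h) ∂(gaussOn E) ∂(gaussOn E)
      = ∫⁻ g, F (√(a ^ 2 + b ^ 2) • g) ∂(gaussOn E) := by
  rcases eq_or_ne (a ^ 2 + b ^ 2) 0 with h0 | h0
  · have ha : a = 0 := by nlinarith [sq_nonneg a, sq_nonneg b]
    have hb : b = 0 := by nlinarith [sq_nonneg a, sq_nonneg b]
    simp [ha, hb]
  set r := √(a ^ 2 + b ^ 2)
  have hr : r ^ 2 = a ^ 2 + b ^ 2 := sq_sqrt (by positivity)
  have hr0 : r ≠ 0 := by intro h; rw [h] at hr; exact h0 (by simpa using hr.symm)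
  have h1 : (a / r) ^ 2 + (b / r) ^ 2 = 1 := by
    rw [div_pow, div_pow, ← add_div, ← hr, div_self (by positivity)]
  have h2 := lintegral_reflect_gaussOn h1 (E := E) (F := fun p => F (r • p.1)) (by fun_prop)
  rw [lintegral_prod _ (by fun_prop), lintegral_prod _ (by fun_prop)] at h2
  simp only [smul_add, smul_smul, mul_div_cancel₀ _ hr0] at h2
  rw [h2]
  simp

end Gaussian

section OneDim

/-- The exponential square moment of the standard Gaussian used to dominate all
one-dimensional Gaussian integrals. -/
def gaussExpMoment : ℝ≥0∞ := ∫⁻ s, ENNReal.ofReal (exp (s ^ 2 / 4)) ∂(gaussianReal 0 1)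

theorem gaussExpMoment_ne_top : gaussExpMoment ≠ ∞ := by
  unfold gaussExpMoment
  rw [gaussianReal_of_var_ne_zero _ one_ne_zero,
    lintegral_withDensity_eq_lintegral_mul _ (measurable_gaussianPDF _ _) (by fun_prop)]
  have h1 := integrable_exp_neg_mul_sq (b := 1 / 4) (by norm_num)
  have h2 : ∀ s : ℝ, (gaussianPDF 0 1 * fun s => ENNReal.ofReal (exp (s ^ 2 / 4))) s
      = ENNReal.ofReal ((√(2 * π))⁻¹ * exp (-(1/4) * s ^ 2)) := by
    intro s
    simp only [Pi.mul_apply, gaussianPDF, gaussianPDFReal]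
    rw [← ENNReal.ofReal_mul (by positivity)]
    simp only [NNReal.coe_one, mul_one, sub_zero]
    rw [mul_assoc, ← exp_add]
    congr 3
    ring
  simp_rw [h2]
  exact (h1.const_mul _).lintegral_lt_top.ne

theorem one_le_gaussExpMoment : 1 ≤ gaussExpMoment := by
  have : (1 : ℝ≥0∞) = ∫⁻ _, 1 ∂(gaussianReal 0 1) := by simp
  rw [this]
  refine lintegral_mono fun s => ?_
  rw [← ENNReal.ofReal_one]
  exact ENNReal.ofReal_le_ofReal (by simp; positivity)

/-- Integrating a one-dimensional Gaussian functional that is dominated by `exp (s² / 4)`. -/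
theorem lintegral_gaussianReal_le {F : ℝ → ℝ} {A : ℝ} (hA : 0 ≤ A)
    (h : ∀ s, F s ≤ A * exp (s ^ 2 / 4)) :
    ∫⁻ s, ENNReal.ofReal (F s) ∂(gaussianReal 0 1) ≤ ENNReal.ofReal A * gaussExpMoment := by
  unfold gaussExpMoment
  rw [← lintegral_const_mul _ (by fun_prop)]
  refine lintegral_mono fun s => ?_
  rw [← ENNReal.ofReal_mul hA]
  exact ENNReal.ofReal_le_ofReal (h s)

end OneDim

section KL
open InformationTheory

/-- A pointwise upper bound on conditional divergences bounds the divergence of the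
compositions. -/
theorem klDiv_compProd_right_le {α β : Type*} [MeasurableSpace α] [MeasurableSpace β]
    [MeasurableSpace.CountableOrCountablyGenerated α β]
    {μ : Measure α} [IsFiniteMeasure μ] {κ η : Kernel α β} [IsFiniteKernel κ] [IsFiniteKernel η]
    {B : α → ℝ≥0∞} (hB : Measurable B) (h : ∀ x, klDiv (κ x) (η x) ≤ B x) :
    klDiv (μ ⊗ₘ κ) (μ ⊗ₘ η) ≤ ∫⁻ x, B x ∂μ := by
  rcases eq_or_ne (∫⁻ x, B x ∂μ) ∞ with htop | htop
  · simp [htop]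
  have hac : ∀ᵐ x ∂μ, κ x ≪ η x := by
    filter_upwards [ae_lt_top hB htop] with x hx
    exact (klDiv_ne_top_iff.1 ((h x).trans_lt hx).ne).1
  have hac' : μ ⊗ₘ κ ≪ μ ⊗ₘ η := Measure.AbsolutelyContinuous.compProd_right hac
  have hmeas := Kernel.measurable_rnDeriv κ η
  have hκ : μ ⊗ₘ κ = (μ ⊗ₘ η).withDensity (fun p => Kernel.rnDeriv κ η p.1 p.2) := by
    have : (∀ᵐ x ∂μ, κ x = (η.withDensity (Kernel.rnDeriv κ η)) x) := by
      filter_upwards [hac] with x hx using (Kernel.withDensity_rnDeriv_eq hx).symm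
    rw [Measure.compProd_congr this, Measure.compProd_withDensity hmeas]
  have hrn : (μ ⊗ₘ κ).rnDeriv (μ ⊗ₘ η) =ᵐ[μ ⊗ₘ η] fun p => Kernel.rnDeriv κ η p.1 p.2 := by
    conv_lhs => rw [hκ]
    exact Measure.rnDeriv_withDensity _ hmeas
  rw [klDiv_eq_lintegral_klFun_of_ac hac']
  have h1 : ∫⁻ p, ENNReal.ofReal (klFun ((μ ⊗ₘ κ).rnDeriv (μ ⊗ₘ η) p).toReal) ∂(μ ⊗ₘ η)
      = ∫⁻ p, ENNReal.ofReal (klFun (Kernel.rnDeriv κ η p.1 p.2).toReal) ∂(μ ⊗ₘ η) := by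
    refine lintegral_congr_ae ?_
    filter_upwards [hrn] with p hp
    rw [hp]
  rw [h1, Measure.lintegral_compProd]
  · refine lintegral_mono_ae ?_
    filter_upwards [hac] with x hx
    refine le_trans (le_of_eq ?_) (h x)
    rw [klDiv_eq_lintegral_klFun_of_ac hx]
    refine lintegral_congr_ae ?_
    filter_upwards [Kernel.rnDeriv_eq_rnDeriv_measure (κ := κ) (η := η) (a := x)] with y hy
    rw [hy]
  · exact (measurable_klFun.comp hmeas.ennreal_toReal).ennreal_ofReal

/-- Divergence between two measures given by densities with respect to a common measure. -/
theorem klDiv_withDensity_eq {α : Type*} [MeasurableSpace α] {Λ : Measure α} [SFinite Λ]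
    {p r : α → ℝ} (hp : Measurable p) (hr : Measurable r) (hp0 : ∀ x, 0 ≤ p x)
    (hr0 : ∀ x, 0 < r x) [IsFiniteMeasure (Λ.withDensity fun x => ENNReal.ofReal (p x))]
    [IsFiniteMeasure (Λ.withDensity fun x => ENNReal.ofReal (r x))] :
    klDiv (Λ.withDensity fun x => ENNReal.ofReal (p x))
      (Λ.withDensity fun x => ENNReal.ofReal (r x))
      = ∫⁻ x, ENNReal.ofReal (p x * log (p x) - p x * log (r x) + r x - p x) ∂Λ := by
  set ν := Λ.withDensity fun x => ENNReal.ofReal (r x) with hν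
  have h1 : (Λ.withDensity fun x => ENNReal.ofReal (p x))
      = ν.withDensity fun x => ENNReal.ofReal (p x / r x) := by
    rw [hν, ← withDensity_mul _ (by fun_prop) (by fun_prop)]
    congr 1
    ext x
    rw [Pi.mul_apply, ← ENNReal.ofReal_mul (hr0 x).le, mul_div_cancel₀ _ (hr0 x).ne']
  have hac : (Λ.withDensity fun x => ENNReal.ofReal (p x)) ≪ ν := by
    rw [h1]; exact withDensity_absolutelyContinuous _ _
  rw [klDiv_eq_lintegral_klFun_of_ac hac]
  have hrn : (Λ.withDensity fun x => ENNReal.ofReal (p x)).rnDeriv ν =ᵐ[ν]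
      fun x => ENNReal.ofReal (p x / r x) := by
    rw [h1]
    exact Measure.rnDeriv_withDensity _ (by fun_prop)
  have h2 : ∫⁻ x, ENNReal.ofReal (klFun ((Λ.withDensity fun x => ENNReal.ofReal (p x)).rnDeriv ν x).toReal) ∂ν
      = ∫⁻ x, ENNReal.ofReal (klFun (p x / r x)) ∂ν := by
    refine lintegral_congr_ae ?_
    filter_upwards [hrn] with x hx
    rw [hx, ENNReal.toReal_ofReal (div_nonneg (hp0 x) (hr0 x).le)]
  have h3 : Measurable fun x => ENNReal.ofReal (klFun (p x / r x)) :=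
    (measurable_klFun.comp (hp.div hr)).ennreal_ofReal
  rw [h2, hν, lintegral_withDensity_eq_lintegral_mul _ (by fun_prop) h3]
  refine lintegral_congr fun x => ?_
  rw [Pi.mul_apply, ← ENNReal.ofReal_mul (hr0 x).le, klFun_apply]
  congr 1
  have hr := (hr0 x).ne'
  rcases (hp0 x).eq_or_lt with h0 | h0
  · rw [← h0]; simp
  · rw [log_div h0.ne' hr]
    field_simp

theorem pow_lintegral_le_lintegral_pow {α : Type*} [MeasurableSpace α] {μ : Measure α}
    [IsProbabilityMeasure μ] {f : α → ℝ≥0∞} (hf : AEMeasurable f μ) (n : ℕ) :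
    (∫⁻ x, f x ∂μ) ^ (n + 1) ≤ ∫⁻ x, f x ^ (n + 1) ∂μ := by
  have h := eLpNorm'_le_eLpNorm'_of_exponent_le (p := 1) (q := n + 1) one_pos
    (by simp) μ hf.aestronglyMeasurable
  simp only [eLpNorm', enorm_eq_self, ENNReal.rpow_one, div_one] at h
  have h1 := ENNReal.rpow_le_rpow h (z := (n : ℝ) + 1) (by positivity)
  rw [← ENNReal.rpow_mul, one_div, inv_mul_cancel₀ (by positivity), ENNReal.rpow_one] at h1
  exact_mod_cast h1

end KL

section OneDimBounds

theorem abs_exp_sub_one_sub_id_le_mul_exp (a : ℝ) : |exp a - 1 - a| ≤ a ^ 2 * exp |a| := by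
  have h := Complex.norm_exp_sub_sum_le_norm_mul_exp (a : ℂ) 2
  simp only [Finset.sum_range_succ, Finset.sum_range_zero] at h
  norm_num at h
  rw [← Complex.ofReal_exp, ← Complex.ofReal_one, ← Complex.ofReal_add, ← Complex.ofReal_sub,
    Complex.norm_real, norm_eq_abs] at h
  rwa [show exp a - 1 - a = exp a - (1 + a) by ring]

theorem abs_exp_sub_quadratic_le_mul_exp (a : ℝ) :
    |exp a - 1 - a - a ^ 2 / 2| ≤ |a| ^ 3 * exp |a| := by
  have h := Complex.norm_exp_sub_sum_le_norm_mul_exp (a : ℂ) 3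
  simp only [Finset.sum_range_succ, Finset.sum_range_zero] at h
  norm_num [Nat.factorial] at h
  have h2 : Complex.exp (a : ℂ) - (1 + (a : ℂ) + (a : ℂ) ^ 2 / 2)
      = ((exp a - 1 - a - a ^ 2 / 2 : ℝ) : ℂ) := by push_cast; ring
  rwa [h2, Complex.norm_real, norm_eq_abs] at h

theorem sq_le_two_mul_exp {x : ℝ} (hx : 0 ≤ x) : x ^ 2 ≤ 2 * exp x := by
  have := pow_div_factorial_le_exp x hx 2
  norm_num [Nat.factorial] at this
  linarith

theorem cube_le_six_mul_exp {x : ℝ} (hx : 0 ≤ x) : x ^ 3 ≤ 6 * exp x := by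
  have := pow_div_factorial_le_exp x hx 3
  norm_num [Nat.factorial] at this
  linarith

theorem sq_exp_sub_hermite_two_le {s : ℝ} (hs : 0 ≤ s) (hs1 : s ≤ 1) (G : ℝ) :
    (exp (s * G - s ^ 2 / 2) - 1 - s * G - ((s * G) ^ 2 - s ^ 2) / 2) ^ 2
      ≤ (144 * exp 20 * s ^ 6) * exp (G ^ 2 / 4) := by
  set a := s * G - s ^ 2 / 2 with ha
  set t := |G| + 1 with ht
  have ht1 : 1 ≤ t := by rw [ht]; linarith [abs_nonneg G]
  have h0 := abs_exp_sub_quadratic_le_mul_exp a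
  have ha' : |a| ≤ s * t := by
    have : |a| ≤ s * |G| + s ^ 2 / 2 := by
      rw [ha]
      refine (abs_sub _ _).trans ?_
      rw [abs_mul, abs_of_nonneg hs, abs_of_nonneg (by positivity : 0 ≤ s ^ 2 / 2)]
    nlinarith
  have ha1 : |a| ≤ t := by nlinarith
  have h1 : |a| ^ 3 * exp |a| ≤ (s * t) ^ 3 * exp t := by gcongr
  have h2 : |exp a - 1 - s * G - ((s * G) ^ 2 - s ^ 2) / 2| ≤ 12 * s ^ 3 * exp (2 * t) := by
    have e1 : exp a - 1 - s * G - ((s * G) ^ 2 - s ^ 2) / 2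
        = (exp a - 1 - a - a ^ 2 / 2) + (-(s ^ 3 * G) / 2 + s ^ 4 / 8) := by rw [ha]; ring
    have e2 : |-(s ^ 3 * G) / 2 + s ^ 4 / 8| ≤ s ^ 3 * t := by
      refine (abs_add_le _ _).trans ?_
      rw [abs_div, abs_neg, abs_mul, abs_of_nonneg (by positivity : 0 ≤ s ^ 3),
        abs_of_nonneg (by positivity : 0 ≤ s ^ 4 / 8), abs_two]
      have : s ^ 4 ≤ s ^ 3 := by
        have := pow_nonneg hs 3
        nlinarith
      have : 0 ≤ s ^ 3 * |G| := by positivity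
      rw [ht]; nlinarith
    have e3 : s ^ 3 * t ≤ s ^ 3 * (t ^ 3 * exp t) := by
      have : 1 ≤ exp t := one_le_exp (by linarith)
      have : t ≤ t ^ 3 := by nlinarith [sq_nonneg t]
      gcongr
      nlinarith [pow_pos (by linarith : 0 < t) 3]
    rw [e1]
    refine (abs_add_le _ _).trans ?_
    have e4 : t ^ 3 * exp t ≤ 6 * exp (2 * t) := by
      have h2 : exp (2 * t) = exp t * exp t := by rw [two_mul, exp_add]
      have hc := cube_le_six_mul_exp (x := t) (by linarith)
      rw [h2, ← mul_assoc]
      exact mul_le_mul_of_nonneg_right hc (exp_pos t).le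
    have : s ^ 3 * (t ^ 3 * exp t) ≤ s ^ 3 * (6 * exp (2 * t)) := by gcongr
    have e5 : (s * t) ^ 3 * exp t = s ^ 3 * (t ^ 3 * exp t) := by ring
    linarith
  rw [← sq_abs]
  calc _ ≤ (12 * s ^ 3 * exp (2 * t)) ^ 2 := by gcongr
    _ = 144 * s ^ 6 * exp (4 * t) := by
      rw [mul_pow, ← exp_nat_mul]; push_cast; ring_nf
    _ ≤ 144 * s ^ 6 * exp (20 + G ^ 2 / 4) := by
      gcongr
      rw [ht]; nlinarith [sq_nonneg (|G| - 8), sq_abs G]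
    _ = _ := by rw [exp_add]; ring

theorem sq_exp_sub_hermite_one_le {s : ℝ} (hs : 0 ≤ s) (G : ℝ) :
    (exp (s * G - s ^ 2 / 2) - 1 - s * G) ^ 2
      ≤ (9 * exp 9 * (s ^ 4 * exp (11 * s ^ 2))) * exp (G ^ 2 / 4) := by
  set a := s * G - s ^ 2 / 2 with ha
  set m := |G| + s with hm
  have hm0 : 0 ≤ m := by positivity
  have h0 := abs_exp_sub_one_sub_id_le_mul_exp a
  have ha1 : |a| ≤ s * |G| + s ^ 2 := by
    rw [ha]
    refine (abs_sub _ _).trans ?_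
    rw [abs_mul, abs_of_nonneg hs, abs_of_nonneg (by positivity : 0 ≤ s ^ 2 / 2)]
    nlinarith [sq_nonneg s]
  have ha2 : a ^ 2 ≤ s ^ 2 * m ^ 2 := by
    rw [← sq_abs a, ← mul_pow]
    have : s * |G| + s ^ 2 = s * m := by rw [hm]; ring
    rw [← this]
    gcongr
  have h2 : |exp a - 1 - s * G| ≤ 3 * s ^ 2 * exp (m + s * |G| + s ^ 2) := by
    have e1 : exp a - 1 - s * G = (exp a - 1 - a) + (-(s ^ 2 / 2)) := by rw [ha]; ring
    rw [e1]
    refine (abs_add_le _ _).trans ?_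
    rw [abs_neg, abs_of_nonneg (by positivity : 0 ≤ s ^ 2 / 2)]
    have e2 : a ^ 2 * exp |a| ≤ s ^ 2 * (2 * exp m) * exp (s * |G| + s ^ 2) := by
      have := sq_le_two_mul_exp hm0
      calc a ^ 2 * exp |a| ≤ (s ^ 2 * m ^ 2) * exp (s * |G| + s ^ 2) := by gcongr
        _ ≤ _ := by gcongr
    have e3 : s ^ 2 * (2 * exp m) * exp (s * |G| + s ^ 2)
        = 2 * s ^ 2 * exp (m + s * |G| + s ^ 2) := by
      rw [add_assoc, exp_add m]; ring
    have e4 : 1 ≤ exp (m + s * |G| + s ^ 2) := one_le_exp (by positivity)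
    nlinarith [sq_nonneg s]
  rw [← sq_abs]
  calc _ ≤ (3 * s ^ 2 * exp (m + s * |G| + s ^ 2)) ^ 2 := by gcongr
    _ = 9 * s ^ 4 * exp (2 * (m + s * |G| + s ^ 2)) := by
      rw [mul_pow, ← exp_nat_mul]; push_cast; ring
    _ ≤ 9 * s ^ 4 * exp (9 + 11 * s ^ 2 + G ^ 2 / 4) := by
      gcongr
      rw [hm]
      nlinarith [sq_nonneg (|G| - 8), sq_abs G, sq_nonneg (s - 1), sq_nonneg (|G| - 8 * s)]
    _ = _ := by rw [exp_add, exp_add]; ring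

theorem sq_mul_exp_quartic_le {k s : ℝ} (hk : 0 ≤ k) (hk4 : k ≤ 4) (hs : 0 ≤ s) (hs1 : s ≤ 1 / 10)
    (G : ℝ) : (k ^ 2 * (s ^ 2 * (s * G) ^ 2)) ^ 2 * exp (11 * (k ^ 2 * (s ^ 2 * (s * G) ^ 2)))
      ≤ (32768 * s ^ 6) * exp (G ^ 2 / 4) := by
  have hk2 : k ^ 2 ≤ 16 := by nlinarith
  have hs2 : s ^ 2 ≤ 1 / 100 := by nlinarith
  have e1 : k ^ 2 * (s ^ 2 * (s * G) ^ 2) = (k ^ 2 * (s ^ 2) ^ 2) * G ^ 2 := by ring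
  have e2 : k ^ 2 * (s ^ 2) ^ 2 ≤ 16 * s ^ 4 := by
    have : (s ^ 2) ^ 2 = s ^ 4 := by ring
    rw [this]; gcongr
  have e3 : k ^ 2 * (s ^ 2) ^ 2 ≤ 16 * (1 / 100) ^ 2 := by gcongr
  have h1 : exp (11 * (k ^ 2 * (s ^ 2 * (s * G) ^ 2))) ≤ exp (G ^ 2 / 8) := by
    rw [e1]
    apply exp_le_exp.2
    nlinarith [sq_nonneg G]
  have h2 := sq_le_two_mul_exp (x := G ^ 2 / 8) (by positivity)
  have h3 : (k ^ 2 * (s ^ 2 * (s * G) ^ 2)) ^ 2 ≤ 256 * s ^ 6 * (G ^ 2) ^ 2 := by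
    rw [e1, mul_pow]
    gcongr
    calc (k ^ 2 * (s ^ 2) ^ 2) ^ 2 ≤ (16 * s ^ 4) ^ 2 := by gcongr
      _ = 256 * s ^ 6 * s ^ 2 := by ring
      _ ≤ 256 * s ^ 6 * 1 := by gcongr; linarith
      _ = _ := by ring
  have h4 : (G ^ 2) ^ 2 ≤ 128 * exp (G ^ 2 / 8) := by nlinarith
  calc _ ≤ (256 * s ^ 6 * (128 * exp (G ^ 2 / 8))) * exp (G ^ 2 / 8) := by
        gcongr
        exact h3.trans (by gcongr)
    _ = (32768 * s ^ 6) * (exp (G ^ 2 / 8) * exp (G ^ 2 / 8)) := by ring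
    _ = _ := by rw [← exp_add]; ring_nf

end OneDimBounds

section Moments

theorem enorm_real_pow (a : ℝ) (n : ℕ) : ‖a‖ₑ ^ n = ENNReal.ofReal (|a| ^ n) := by
  rw [enorm_eq_ofReal_abs, ENNReal.ofReal_pow (abs_nonneg a)]

theorem enorm_real_sq (a : ℝ) : ‖a‖ₑ ^ 2 = ENNReal.ofReal (a ^ 2) := by
  rw [enorm_real_pow, sq_abs]

theorem enorm_norm_pow {F : Type*} [NormedAddCommGroup F] (x : F) (n : ℕ) :
    ‖x‖ₑ ^ n = ENNReal.ofReal (‖x‖ ^ n) := by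
  rw [ENNReal.ofReal_pow (norm_nonneg x), ofReal_norm]

/-- Jensen's inequality for powers of norms of Bochner integrals. -/
theorem enorm_integral_pow_le {α F : Type*} [MeasurableSpace α] {μ : Measure α}
    [IsProbabilityMeasure μ] [NormedAddCommGroup F] [NormedSpace ℝ F] {f : α → F}
    (hf : AEStronglyMeasurable f μ) (n : ℕ) :
    ‖∫ x, f x ∂μ‖ₑ ^ (n + 1) ≤ ∫⁻ x, ‖f x‖ₑ ^ (n + 1) ∂μ :=
  (pow_le_pow_left' (enorm_integral_le_lintegral_enorm f) _).trans
    (pow_lintegral_le_lintegral_pow hf.enorm n)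

theorem integrable_of_continuous_of_ae_norm_le {E F : Type*} [NormedAddCommGroup E]
    [InnerProductSpace ℝ E] [FiniteDimensional ℝ E] [MeasurableSpace E] [BorelSpace E]
    [NormedAddCommGroup F] {μ : Measure E} [IsFiniteMeasure μ] {r : ℝ}
    (hμ : ∀ᵐ x ∂μ, ‖x‖ ≤ r) {f : E → F} (hf : Continuous f) : Integrable f μ := by
  have : ProperSpace E := FiniteDimensional.proper_real E
  obtain ⟨C, hC⟩ := (isCompact_closedBall (0 : E) r).exists_bound_of_continuousOn hf.continuousOn
  refine Integrable.of_bound hf.aestronglyMeasurable C ?_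
  filter_upwards [hμ] with x hx using hC x (by simpa using hx)

end Moments

section Mixture

variable {E : Type*} [NormedAddCommGroup E] [InnerProductSpace ℝ E] [FiniteDimensional ℝ E]
  [MeasurableSpace E] [BorelSpace E]

/-- Density of the law of `x + g` with respect to the standard Gaussian, for `x ∼ ν`. -/
def tiltDensity (ν : Measure E) (z : E) : ℝ := ∫ x, exp (⟪x, z⟫_ℝ - ‖x‖ ^ 2 / 2) ∂ν

/-- Second order Hermite expansion of `tiltDensity` for a centred measure. -/
def tiltQuad (ν : Measure E) (z : E) : ℝ := 1 + (∫ x, (⟪x, z⟫_ℝ ^ 2 - ‖x‖ ^ 2) ∂ν) / 2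

/-- A multiple of the second moment operator of `ν`. -/
def covMap (k : ℝ) (ν : Measure E) (g : E) : E := k • ∫ x, ⟪x, g⟫_ℝ • x ∂ν

variable {ν : Measure E} [IsProbabilityMeasure ν]

@[fun_prop]
theorem measurable_tiltDensity : Measurable (tiltDensity ν) := by
  unfold tiltDensity
  refine StronglyMeasurable.measurable ?_
  refine StronglyMeasurable.integral_prod_right (f := fun z x => exp (⟪x, z⟫_ℝ - ‖x‖ ^ 2 / 2)) ?_
  exact (by fun_prop : Continuous _).stronglyMeasurable

@[fun_prop]
theorem measurable_tiltQuad : Measurable (tiltQuad ν) := by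
  unfold tiltQuad
  refine ((StronglyMeasurable.measurable ?_).div_const 2).const_add 1
  refine StronglyMeasurable.integral_prod_right (f := fun z x => ⟪x, z⟫_ℝ ^ 2 - ‖x‖ ^ 2) ?_
  exact (by fun_prop : Continuous _).stronglyMeasurable

@[fun_prop]
theorem measurable_covMap (k : ℝ) : Measurable (covMap k ν) := by
  unfold covMap
  refine (StronglyMeasurable.measurable ?_).const_smul k
  refine StronglyMeasurable.integral_prod_right (f := fun z x => ⟪x, z⟫_ℝ • x) ?_
  exact (by fun_prop : Continuous _).stronglyMeasurable

variable {r : ℝ} (hν : ∀ᵐ x ∂ν, ‖x‖ ≤ r)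

theorem tiltDensity_pos (hν : ∀ᵐ x ∂ν, ‖x‖ ≤ r) (z : E) : 0 < tiltDensity ν z := by
  unfold tiltDensity
  refine integral_exp_pos ?_
  exact integrable_of_continuous_of_ae_norm_le hν (by fun_prop)

theorem covMap_add (hν : ∀ᵐ x ∂ν, ‖x‖ ≤ r) (k : ℝ) (g h : E) :
    covMap k ν (g + h) = covMap k ν g + covMap k ν h := by
  unfold covMap
  rw [← smul_add, ← integral_add (integrable_of_continuous_of_ae_norm_le hν (by fun_prop))
    (integrable_of_continuous_of_ae_norm_le hν (by fun_prop))]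
  simp_rw [inner_add_right, add_smul]

theorem covMap_smul (k a : ℝ) (g : E) : covMap k ν (a • g) = a • covMap k ν g := by
  unfold covMap
  simp_rw [inner_smul_right, mul_smul]
  rw [integral_smul, smul_comm]

theorem inner_covMap (hν : ∀ᵐ x ∂ν, ‖x‖ ≤ r) (k : ℝ) (y g : E) :
    ⟪y, covMap k ν g⟫_ℝ = k * ∫ x, ⟪x, g⟫_ℝ * ⟪x, y⟫_ℝ ∂ν := by
  unfold covMap
  rw [inner_smul_right, ← integral_inner
    (integrable_of_continuous_of_ae_norm_le hν (by fun_prop))]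
  simp_rw [inner_smul_right, real_inner_comm y]

theorem inner_covMap_comm (hν : ∀ᵐ x ∂ν, ‖x‖ ≤ r) (k : ℝ) (y g : E) :
    ⟪y, covMap k ν g⟫_ℝ = ⟪covMap k ν y, g⟫_ℝ := by
  rw [real_inner_comm g, inner_covMap hν, inner_covMap hν]
  simp_rw [mul_comm]

theorem norm_covMap_sq_le (hν : ∀ᵐ x ∂ν, ‖x‖ ≤ r) (k : ℝ) (g : E) :
    ‖covMap k ν g‖ ^ 2 ≤ ∫ x, k ^ 2 * (‖x‖ ^ 2 * ⟪x, g⟫_ℝ ^ 2) ∂ν := by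
  unfold covMap
  have h1 := enorm_integral_pow_le (μ := ν) (f := fun x => ⟪x, g⟫_ℝ • x)
    (by fun_prop : Continuous _).aestronglyMeasurable 1
  simp only [enorm_norm_pow, Nat.reduceAdd] at h1
  rw [← ofReal_integral_eq_lintegral_ofReal
    (integrable_of_continuous_of_ae_norm_le hν (by fun_prop))
    (.of_forall fun x => by positivity)] at h1
  have h2 := (ENNReal.ofReal_le_ofReal_iff (integral_nonneg fun x => by positivity)).1 h1
  rw [norm_smul, mul_pow, integral_const_mul, norm_eq_abs, sq_abs]
  refine mul_le_mul_of_nonneg_left (h2.trans (le_of_eq ?_)) (sq_nonneg k)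
  refine integral_congr_ae (.of_forall fun x => ?_)
  simp only [norm_smul, norm_eq_abs, mul_pow, sq_abs]
  ring

theorem norm_covMap_sq_le_inner (hν : ∀ᵐ x ∂ν, ‖x‖ ≤ r) (k : ℝ) (g : E) :
    ‖covMap k ν g‖ ^ 2 ≤ k * r ^ 2 * ⟪g, covMap k ν g⟫_ℝ := by
  refine (norm_covMap_sq_le hν k g).trans ?_
  rw [inner_covMap hν, ← mul_assoc, ← integral_const_mul]
  refine integral_mono_ae (integrable_of_continuous_of_ae_norm_le hν (by fun_prop))
    (integrable_of_continuous_of_ae_norm_le hν (by fun_prop)) ?_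
  filter_upwards [hν] with x hx
  have : ‖x‖ ^ 2 ≤ r ^ 2 := by gcongr
  calc k ^ 2 * (‖x‖ ^ 2 * ⟪x, g⟫_ℝ ^ 2) ≤ k ^ 2 * (r ^ 2 * ⟪x, g⟫_ℝ ^ 2) := by gcongr
    _ = _ := by ring

theorem integrable_inner_gaussOn (y : E) : Integrable (fun h => ⟪y, h⟫_ℝ) (gaussOn E) :=
  IsGaussian.integrable_id.const_inner y

theorem integral_inner_gaussOn (y : E) : ∫ h, ⟪y, h⟫_ℝ ∂(gaussOn E) = 0 := by
  rw [integral_inner (f := fun h : E => h) IsGaussian.integrable_id]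
  simp [integral_id_stdGaussian]

theorem lintegral_sq_gaussianReal :
    ∫⁻ s, ENNReal.ofReal (s ^ 2) ∂(gaussianReal 0 1) = 1 := by
  have h : MemLp (fun s : ℝ => s) 2 (gaussianReal 0 1) := memLp_id_gaussianReal 2
  rw [← ofReal_integral_eq_lintegral_ofReal h.integrable_sq (.of_forall fun x => by positivity)]
  have := variance_id_gaussianReal (μ := 0) (v := 1)
  rw [variance_eq_integral (by fun_prop)] at this
  simp at this
  simp [this]

theorem lintegral_inner_sq_gaussOn (y : E) :
    ∫⁻ h, ENNReal.ofReal (⟪y, h⟫_ℝ ^ 2) ∂(gaussOn E) = ENNReal.ofReal (‖y‖ ^ 2) := by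
  rw [lintegral_inner_gaussOn (F := fun a => ENNReal.ofReal (a ^ 2)) (by fun_prop)]
  simp_rw [mul_pow, ENNReal.ofReal_mul (sq_nonneg ‖y‖)]
  rw [lintegral_const_mul _ (by fun_prop), lintegral_sq_gaussianReal, mul_one]

theorem lintegral_inner_covMap (hν : ∀ᵐ x ∂ν, ‖x‖ ≤ r) {k : ℝ} (hk : 0 ≤ k) :
    ∫⁻ h, ENNReal.ofReal ⟪h, covMap k ν h⟫_ℝ ∂(gaussOn E)
      = ENNReal.ofReal (k * ∫ x, ‖x‖ ^ 2 ∂ν) := by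
  have h1 : ∀ h : E, ENNReal.ofReal ⟪h, covMap k ν h⟫_ℝ
      = ∫⁻ x, ENNReal.ofReal k * ENNReal.ofReal (⟪x, h⟫_ℝ ^ 2) ∂ν := by
    intro h
    rw [inner_covMap hν, ENNReal.ofReal_mul hk, lintegral_const_mul _ (by fun_prop)]
    simp_rw [← sq]
    rw [ofReal_integral_eq_lintegral_ofReal
      (integrable_of_continuous_of_ae_norm_le hν (by fun_prop)) (.of_forall fun x => by positivity)]
  simp_rw [h1]
  rw [lintegral_lintegral_swap (by fun_prop)]
  have h2 : ∀ x : E, ∫⁻ h, ENNReal.ofReal k * ENNReal.ofReal (⟪x, h⟫_ℝ ^ 2) ∂(gaussOn E)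
      = ENNReal.ofReal k * ENNReal.ofReal (‖x‖ ^ 2) := fun x => by
    rw [lintegral_const_mul _ (by fun_prop), lintegral_inner_sq_gaussOn]
  simp_rw [h2]
  rw [lintegral_const_mul _ (by fun_prop), ENNReal.ofReal_mul hk,
    ofReal_integral_eq_lintegral_ofReal
      (integrable_of_continuous_of_ae_norm_le hν (by fun_prop)) (.of_forall fun x => by positivity)]

theorem inner_covMap_self_nonneg (hν : ∀ᵐ x ∂ν, ‖x‖ ≤ r) {k : ℝ} (hk : 0 ≤ k) (h : E) :
    0 ≤ ⟪h, covMap k ν h⟫_ℝ := by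
  rw [inner_covMap hν]
  exact mul_nonneg hk (integral_nonneg fun x => mul_self_nonneg _)

theorem integrable_inner_covMap (hν : ∀ᵐ x ∂ν, ‖x‖ ≤ r) {k : ℝ} (hk : 0 ≤ k) :
    Integrable (fun h => ⟪h, covMap k ν h⟫_ℝ) (gaussOn E) := by
  refine ⟨by fun_prop, ?_⟩
  rw [hasFiniteIntegral_iff_ofReal (.of_forall fun h => inner_covMap_self_nonneg hν hk h),
    lintegral_inner_covMap hν hk]
  exact ENNReal.ofReal_lt_top

theorem integral_inner_covMap (hν : ∀ᵐ x ∂ν, ‖x‖ ≤ r) {k : ℝ} (hk : 0 ≤ k) :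
    ∫ h, ⟪h, covMap k ν h⟫_ℝ ∂(gaussOn E) = k * ∫ x, ‖x‖ ^ 2 ∂ν := by
  rw [integral_eq_lintegral_of_nonneg_ae (.of_forall fun h => inner_covMap_self_nonneg hν hk h)
    (by fun_prop), lintegral_inner_covMap hν hk, ENNReal.toReal_ofReal]
  exact mul_nonneg hk (integral_nonneg fun x => by positivity)

/-- `tiltDensity` is close to `tiltQuad` for a centred measure with small support. -/
theorem lintegral_tiltDensity_sub_tiltQuad_le (hν : ∀ᵐ x ∂ν, ‖x‖ ≤ r) (hr : r ≤ 1)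
    (hmean : ∫ x, x ∂ν = 0) :
    ∫⁻ z, ‖tiltDensity ν z - tiltQuad ν z‖ₑ ^ 2 ∂(gaussOn E)
      ≤ ENNReal.ofReal (144 * exp 20) * gaussExpMoment * ∫⁻ x, ‖x‖ₑ ^ 6 ∂ν := by
  set F : E → E → ℝ := fun z x =>
    exp (⟪x, z⟫_ℝ - ‖x‖ ^ 2 / 2) - 1 - ⟪x, z⟫_ℝ - (⟪x, z⟫_ℝ ^ 2 - ‖x‖ ^ 2) / 2 with hF
  have hI : ∀ f : E → ℝ, Continuous f → Integrable f ν := fun f hf =>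
    integrable_of_continuous_of_ae_norm_le hν hf
  have h1 : ∀ z, tiltDensity ν z - tiltQuad ν z = ∫ x, F z x ∂ν := by
    intro z
    have hm : ∫ x, ⟪x, z⟫_ℝ ∂ν = 0 := by
      simp_rw [real_inner_comm z]
      rw [integral_inner (f := fun x : E => x)
        (integrable_of_continuous_of_ae_norm_le hν continuous_id), hmean,
        inner_zero_right]
    rw [hF]
    rw [integral_sub (hI _ (by fun_prop)) (hI _ (by fun_prop)),
      integral_sub (hI _ (by fun_prop)) (hI _ (by fun_prop)),
      integral_sub (hI _ (by fun_prop)) (hI _ (by fun_prop)), hm, integral_div]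
    simp only [tiltDensity, tiltQuad, integral_const, probReal_univ, smul_eq_mul]
    ring
  calc _ ≤ ∫⁻ z, ∫⁻ x, ‖F z x‖ₑ ^ 2 ∂ν ∂(gaussOn E) := by
        refine lintegral_mono fun z => ?_
        rw [h1]
        exact enorm_integral_pow_le (by fun_prop : Continuous _).aestronglyMeasurable 1
    _ = ∫⁻ x, ∫⁻ z, ‖F z x‖ₑ ^ 2 ∂(gaussOn E) ∂ν := by
        refine lintegral_lintegral_swap ?_
        simp only [hF]
        fun_prop
    _ ≤ ∫⁻ x, (ENNReal.ofReal (144 * exp 20) * gaussExpMoment) * ‖x‖ₑ ^ 6 ∂ν := by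
        refine lintegral_mono_ae ?_
        filter_upwards [hν] with x hx
        simp only [hF, enorm_real_sq]
        rw [lintegral_inner_gaussOn (F := fun a => ENNReal.ofReal
          ((exp (a - ‖x‖ ^ 2 / 2) - 1 - a - (a ^ 2 - ‖x‖ ^ 2) / 2) ^ 2)) (by fun_prop)]
        refine (lintegral_gaussianReal_le (by positivity) fun s =>
          sq_exp_sub_hermite_two_le (norm_nonneg x) (hx.trans hr) s).trans (le_of_eq ?_)
        rw [ENNReal.ofReal_mul (by positivity), enorm_norm_pow]
        ring
    _ = _ := lintegral_const_mul _ (by fun_prop)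

end Mixture

theorem ofReal_integral_le_lintegral_ofReal {α : Type*} [MeasurableSpace α] {μ : Measure α}
    (f : α → ℝ) : ENNReal.ofReal (∫ x, f x ∂μ) ≤ ∫⁻ x, ENNReal.ofReal (f x) ∂μ := by
  by_cases hf : Integrable f μ
  · rw [integral_eq_lintegral_pos_part_sub_lintegral_neg_part hf]
    refine (ENNReal.ofReal_le_ofReal (sub_le_self _ ENNReal.toReal_nonneg)).trans ?_
    exact ENNReal.ofReal_toReal_le
  · simp [integral_undef hf]

theorem convexOn_sq_mul_exp : ConvexOn ℝ (Set.Ici 0) fun t : ℝ => t ^ 2 * exp (11 * t) := by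
  refine ConvexOn.mul (convexOn_pow 2) ?_ (fun t _ => sq_nonneg t)
    (fun t _ => (exp_pos _).le) ?_
  · have := (convexOn_exp.comp_linearMap (LinearMap.mulLeft ℝ (11 : ℝ))).subset
      (Set.subset_univ (Set.Ici 0)) (convex_Ici 0)
    exact this
  · refine MonotoneOn.monovaryOn (fun a ha b _ hab => pow_le_pow_left₀ ha hab 2) ?_
    intro a _ b _ hab
    exact exp_le_exp.2 (by linarith)

section Mixture

variable {E : Type*} [NormedAddCommGroup E] [InnerProductSpace ℝ E] [FiniteDimensional ℝ E]
  [MeasurableSpace E] [BorelSpace E]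

/-- Exponent of the Cameron–Martin density of the shift `g₂ ↦ g₂ + covMap k ν g₁`. -/
def shiftExponent (k : ℝ) (ν : Measure E) (p : E × E) : ℝ :=
  ⟪p.2, covMap k ν p.1⟫_ℝ - ‖covMap k ν p.1‖ ^ 2 / 2

/-- Density with respect to the standard Gaussian of the law of
`c • g₁ + s • (g₂ + covMap k ν g₁)`. -/
def mixDensity (c s k : ℝ) (ν : Measure E) (z : E) : ℝ≥0∞ :=
  ∫⁻ h, ENNReal.ofReal (exp (shiftExponent k ν (c • z + s • h, s • z - c • h))) ∂(gaussOn E)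

variable {ν : Measure E} [IsProbabilityMeasure ν] {r c s k : ℝ}

@[fun_prop]
theorem measurable_shiftExponent : Measurable (shiftExponent k ν) := by
  unfold shiftExponent
  fun_prop

@[fun_prop]
theorem measurable_mixDensity : Measurable (mixDensity c s k ν) := by
  unfold mixDensity
  refine Measurable.lintegral_prod_right'
    (f := fun q : E × E => ENNReal.ofReal
      (exp (shiftExponent k ν (c • q.1 + s • q.2, s • q.1 - c • q.2)))) ?_
  fun_prop

theorem lintegral_mixDensity (hcs : c ^ 2 + s ^ 2 = 1) {F : E → ℝ≥0∞} (hF : Measurable F) :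
    ∫⁻ p, F (c • p.1 + s • (p.2 + covMap k ν p.1)) ∂((gaussOn E).prod (gaussOn E))
      = ∫⁻ z, mixDensity c s k ν z * F z ∂(gaussOn E) := by
  have hG : Measurable fun p : E × E =>
      ENNReal.ofReal (exp (shiftExponent k ν p)) * F (c • p.1 + s • p.2) := by fun_prop
  rw [lintegral_prod _ (by fun_prop)]
  have h1 : ∀ g : E, ∫⁻ h, F (c • g + s • (h + covMap k ν g)) ∂(gaussOn E)
      = ∫⁻ h, ENNReal.ofReal (exp (shiftExponent k ν (g, h))) * F (c • g + s • h)
        ∂(gaussOn E) := fun g =>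
    lintegral_gaussOn_add (F := fun h => F (c • g + s • h)) (by fun_prop) (covMap k ν g)
  simp_rw [h1]
  rw [← lintegral_prod (fun p : E × E =>
    ENNReal.ofReal (exp (shiftExponent k ν p)) * F (c • p.1 + s • p.2)) hG.aemeasurable,
    ← lintegral_reflect_gaussOn hcs hG]
  have h2 : ∀ p : E × E, c • (c • p.1 + s • p.2) + s • (s • p.1 - c • p.2) = p.1 := by
    intro p
    have : c • (c • p.1 + s • p.2) + s • (s • p.1 - c • p.2) = (c ^ 2 + s ^ 2) • p.1 := by
      module
    rw [this, hcs, one_smul]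
  simp_rw [h2]
  rw [lintegral_prod _ (by fun_prop)]
  refine lintegral_congr fun z => ?_
  simp only
  rw [mixDensity, lintegral_mul_const _ (by fun_prop)]

theorem inner_reflect_covMap (hν : ∀ᵐ x ∂ν, ‖x‖ ≤ r) (z h : E) :
    ⟪s • z - c • h, covMap k ν (c • z + s • h)⟫_ℝ
      = c * s * (⟪z, covMap k ν z⟫_ℝ - ⟪h, covMap k ν h⟫_ℝ)
        + (s ^ 2 - c ^ 2) * ⟪covMap k ν z, h⟫_ℝ := by
  rw [covMap_add hν, covMap_smul, covMap_smul]
  simp only [inner_add_right, inner_sub_left, inner_smul_left, inner_smul_right,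
    inner_covMap_comm hν k z h, real_inner_comm (covMap k ν z) h, RCLike.conj_to_real]
  ring

theorem inner_rotate_covMap (hν : ∀ᵐ x ∂ν, ‖x‖ ≤ r) (z h : E) :
    ⟪c • z + s • h, covMap k ν (c • z + s • h)⟫_ℝ
      = c ^ 2 * ⟪z, covMap k ν z⟫_ℝ + s ^ 2 * ⟪h, covMap k ν h⟫_ℝ
        + 2 * c * s * ⟪covMap k ν z, h⟫_ℝ := by
  rw [covMap_add hν, covMap_smul, covMap_smul]
  simp only [inner_add_right, inner_add_left, inner_smul_left, inner_smul_right,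
    inner_covMap_comm hν k z h, real_inner_comm (covMap k ν z) h, RCLike.conj_to_real]
  ring

theorem integral_affine_covMap (hν : ∀ᵐ x ∂ν, ‖x‖ ≤ r) (hk : 0 ≤ k) (A B C : ℝ) (y : E) :
    ∫ h, (A + B * ⟪h, covMap k ν h⟫_ℝ + C * ⟪y, h⟫_ℝ) ∂(gaussOn E)
      = A + B * (k * ∫ x, ‖x‖ ^ 2 ∂ν) := by
  rw [integral_add, integral_add (integrable_const _), integral_const_mul, integral_const_mul,
    integral_inner_gaussOn, integral_inner_covMap hν hk]
  · simp
  · exact (integrable_inner_covMap hν hk).const_mul _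
  · exact (integrable_const _).add ((integrable_inner_covMap hν hk).const_mul _)
  · exact (integrable_inner_gaussOn y).const_mul _

theorem half_le_mixDensity (hν : ∀ᵐ x ∂ν, ‖x‖ ≤ 1 / 10) (hcs : c ^ 2 + s ^ 2 = 1)
    (hk4 : k ≤ 4) (hk0 : 0 ≤ k) (hk : k * (c * s) = 1 / 2) (z : E) :
    ENNReal.ofReal (1 / 2) ≤ mixDensity c s k ν z := by
  set A := c * s - k * (1 / 10) ^ 2 * c ^ 2 / 2 with hA
  set B := -(c * s + k * (1 / 10) ^ 2 * s ^ 2 / 2) with hB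
  set C := (s ^ 2 - c ^ 2) - k * (1 / 10) ^ 2 * c * s with hC
  set q := ⟪z, covMap k ν z⟫_ℝ with hq
  have hq0 : 0 ≤ q := inner_covMap_self_nonneg hν hk0 z
  have hkpos : 0 < k := hk0.lt_of_ne (by rintro rfl; norm_num at hk)
  have hcs0 : 1 / 8 ≤ c * s := le_of_mul_le_mul_left (by linarith) hkpos
  have hcs1 : c * s ≤ 1 / 2 := by nlinarith [sq_nonneg (c - s)]
  have hm : ∫ x, ‖x‖ ^ 2 ∂ν ≤ (1 / 10) ^ 2 := by
    refine (integral_mono_ae (integrable_of_continuous_of_ae_norm_le hν (by fun_prop))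
      (integrable_const ((1 / 10 : ℝ) ^ 2)) ?_).trans (by simp)
    filter_upwards [hν] with x hx
    gcongr
  have hm0 : 0 ≤ ∫ x, ‖x‖ ^ 2 ∂ν := integral_nonneg fun x => by positivity
  calc ENNReal.ofReal (1 / 2)
      ≤ ENNReal.ofReal (∫ h, ((1 + A * q) + B * ⟪h, covMap k ν h⟫_ℝ
          + C * ⟪covMap k ν z, h⟫_ℝ) ∂(gaussOn E)) := by
        refine ENNReal.ofReal_le_ofReal ?_
        rw [integral_affine_covMap hν hk0]
        have h1 : 0 ≤ A * q := by
          refine mul_nonneg ?_ hq0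
          rw [hA]; nlinarith [sq_nonneg c, sq_nonneg s]
        have h2 : k * ∫ x, ‖x‖ ^ 2 ∂ν ≤ 4 / 100 := by nlinarith
        have h3 : 0 ≤ k * ∫ x, ‖x‖ ^ 2 ∂ν := by positivity
        have h4 : -1 ≤ B := by
          rw [hB]; nlinarith [sq_nonneg c, sq_nonneg s]
        nlinarith
    _ ≤ ∫⁻ h, ENNReal.ofReal ((1 + A * q) + B * ⟪h, covMap k ν h⟫_ℝ
          + C * ⟪covMap k ν z, h⟫_ℝ) ∂(gaussOn E) := ofReal_integral_le_lintegral_ofReal _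
    _ ≤ _ := by
        refine lintegral_mono fun h => ENNReal.ofReal_le_ofReal ?_
        refine le_trans ?_ (add_one_le_exp _)
        simp only [shiftExponent]
        have h1 := norm_covMap_sq_le_inner hν k (c • z + s • h)
        rw [inner_rotate_covMap hν] at h1
        rw [inner_reflect_covMap hν]
        rw [hA, hB, hC]
        linarith

theorem lintegral_mixDensity_eq_one (hcs : c ^ 2 + s ^ 2 = 1) :
    ∫⁻ z, mixDensity c s k ν z ∂(gaussOn E) = 1 := by
  have := lintegral_mixDensity (k := k) (ν := ν) hcs (F := fun _ : E => 1) measurable_const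
  simpa using this.symm

theorem mixDensity_sub_tiltQuad_eq (hν : ∀ᵐ x ∂ν, ‖x‖ ≤ r) (hk0 : 0 ≤ k)
    (hk : k * (c * s) = 1 / 2) {z : E} (hz : mixDensity c s k ν z ≠ ⊤) :
    (mixDensity c s k ν z).toReal - tiltQuad ν z
      = ∫ h, (exp (shiftExponent k ν (c • z + s • h, s • z - c • h)) - 1
          - ⟪s • z - c • h, covMap k ν (c • z + s • h)⟫_ℝ) ∂(gaussOn E) := by
  have hm : AEStronglyMeasurable
      (fun h => exp (shiftExponent k ν (c • z + s • h, s • z - c • h))) (gaussOn E) :=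
    Measurable.aestronglyMeasurable (by fun_prop)
  have hI : Integrable (fun h => exp (shiftExponent k ν (c • z + s • h, s • z - c • h)))
      (gaussOn E) := by
    refine ⟨hm, ?_⟩
    rw [hasFiniteIntegral_iff_ofReal (.of_forall fun h => (exp_pos _).le)]
    exact hz.lt_top
  have hL : (mixDensity c s k ν z).toReal
      = ∫ h, exp (shiftExponent k ν (c • z + s • h, s • z - c • h)) ∂(gaussOn E) := by
    rw [integral_eq_lintegral_of_nonneg_ae (.of_forall fun h => (exp_pos _).le) hm,
      mixDensity]
  have h_int := integral_affine_covMap hν hk0 (c * s * ⟪z, covMap k ν z⟫_ℝ) (-(c * s))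
    (s ^ 2 - c ^ 2) (covMap k ν z)
  have hIl : Integrable (fun h => ⟪s • z - c • h, covMap k ν (c • z + s • h)⟫_ℝ)
      (gaussOn E) := by
    simp_rw [inner_reflect_covMap hν]
    exact (((integrable_const _).sub (integrable_inner_covMap hν hk0)).const_mul _).add
      ((integrable_inner_gaussOn _).const_mul _)
  rw [integral_sub (f := fun h => exp (shiftExponent k ν (c • z + s • h, s • z - c • h)) - 1)
    (hI.sub (integrable_const _)) hIl, integral_sub hI (integrable_const _), ← hL]
  have h2 : ∫ h, ⟪s • z - c • h, covMap k ν (c • z + s • h)⟫_ℝ ∂(gaussOn E)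
      = tiltQuad ν z - 1 := by
    simp_rw [inner_reflect_covMap hν]
    rw [inner_covMap hν] at h_int
    rw [tiltQuad, integral_sub (integrable_of_continuous_of_ae_norm_le hν (by fun_prop))
      (integrable_of_continuous_of_ae_norm_le hν (by fun_prop))]
    simp_rw [← sq] at h_int
    rw [inner_covMap hν]
    simp_rw [← sq]
    calc _ = _ := integral_congr_ae (.of_forall fun h => by ring)
      _ = _ := h_int
      _ = _ := by linear_combination ((∫ x, ⟪x, z⟫_ℝ ^ 2 ∂ν) - ∫ x, ‖x‖ ^ 2 ∂ν) * hk
  rw [h2]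
  simp

theorem ofReal_norm_covMap_le (hν : ∀ᵐ x ∂ν, ‖x‖ ≤ r) (g : E) :
    ENNReal.ofReal (‖covMap k ν g‖ ^ 4 * exp (11 * ‖covMap k ν g‖ ^ 2))
      ≤ ∫⁻ x, ENNReal.ofReal ((k ^ 2 * (‖x‖ ^ 2 * ⟪x, g⟫_ℝ ^ 2)) ^ 2
          * exp (11 * (k ^ 2 * (‖x‖ ^ 2 * ⟪x, g⟫_ℝ ^ 2)))) ∂ν := by
  have h1 := norm_covMap_sq_le hν k g
  have h2 := ConvexOn.map_integral_le (μ := ν)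
    (f := fun x => k ^ 2 * (‖x‖ ^ 2 * ⟪x, g⟫_ℝ ^ 2)) convexOn_sq_mul_exp
    (by fun_prop) isClosed_Ici (.of_forall fun x => by simp only [Set.mem_Ici]; positivity)
    (integrable_of_continuous_of_ae_norm_le hν (by fun_prop))
    (integrable_of_continuous_of_ae_norm_le hν (by fun_prop))
  refine le_trans (ENNReal.ofReal_le_ofReal (le_trans ?_ h2))
    (ofReal_integral_le_lintegral_ofReal _)
  have h3 : ‖covMap k ν g‖ ^ 4 = (‖covMap k ν g‖ ^ 2) ^ 2 := by ring
  rw [h3]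
  gcongr

theorem lintegral_mixDensity_sub_tiltQuad_le (hν : ∀ᵐ x ∂ν, ‖x‖ ≤ 1 / 10)
    (hcs : c ^ 2 + s ^ 2 = 1) (hk4 : k ≤ 4) (hk0 : 0 ≤ k) (hk : k * (c * s) = 1 / 2) :
    ∫⁻ z, ‖(mixDensity c s k ν z).toReal - tiltQuad ν z‖ₑ ^ 2 ∂(gaussOn E)
      ≤ ENNReal.ofReal (9 * exp 9 * 32768) * gaussExpMoment ^ 2 * ∫⁻ x, ‖x‖ₑ ^ 6 ∂ν := by
  set W : E × E → ℝ≥0∞ := fun p =>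
    ‖exp (shiftExponent k ν p) - 1 - ⟪p.2, covMap k ν p.1⟫_ℝ‖ₑ ^ 2 with hW
  have hWm : Measurable W := by simp only [hW]; fun_prop
  calc _ ≤ ∫⁻ z, ∫⁻ h, W (c • z + s • h, s • z - c • h) ∂(gaussOn E) ∂(gaussOn E) := by
        refine lintegral_mono_ae ?_
        have hfin := ae_lt_top (μ := gaussOn E) (measurable_mixDensity (c := c) (s := s) (k := k)
          (ν := ν)) (by rw [lintegral_mixDensity_eq_one hcs]; exact ENNReal.one_ne_top)
        filter_upwards [hfin] with z hz
        rw [mixDensity_sub_tiltQuad_eq hν hk0 hk hz.ne]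
        exact enorm_integral_pow_le (Measurable.aestronglyMeasurable (by fun_prop)) 1
    _ = ∫⁻ g, ∫⁻ h, W (g, h) ∂(gaussOn E) ∂(gaussOn E) := by
        have := lintegral_reflect_gaussOn hcs hWm
        rw [lintegral_prod _ (by fun_prop), lintegral_prod _ (by fun_prop)] at this
        exact this
    _ ≤ ∫⁻ g, ENNReal.ofReal (9 * exp 9) * gaussExpMoment *
          ENNReal.ofReal (‖covMap k ν g‖ ^ 4 * exp (11 * ‖covMap k ν g‖ ^ 2)) ∂(gaussOn E) := by
        refine lintegral_mono fun g => ?_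
        simp only [hW, enorm_real_sq, shiftExponent, real_inner_comm (covMap k ν g)]
        rw [lintegral_inner_gaussOn (F := fun a => ENNReal.ofReal
          ((exp (a - ‖covMap k ν g‖ ^ 2 / 2) - 1 - a) ^ 2)) (by fun_prop)]
        refine (lintegral_gaussianReal_le (by positivity) fun t =>
          sq_exp_sub_hermite_one_le (norm_nonneg (covMap k ν g)) t).trans (le_of_eq ?_)
        rw [ENNReal.ofReal_mul (by positivity)]
        ring
    _ ≤ ENNReal.ofReal (9 * exp 9) * gaussExpMoment * ∫⁻ g, ∫⁻ x,
          ENNReal.ofReal ((k ^ 2 * (‖x‖ ^ 2 * ⟪x, g⟫_ℝ ^ 2)) ^ 2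
          * exp (11 * (k ^ 2 * (‖x‖ ^ 2 * ⟪x, g⟫_ℝ ^ 2)))) ∂ν ∂(gaussOn E) := by
        rw [lintegral_const_mul _ (by fun_prop)]
        gcongr with g
        exact ofReal_norm_covMap_le hν g
    _ ≤ ENNReal.ofReal (9 * exp 9) * gaussExpMoment *
          ∫⁻ x, ENNReal.ofReal 32768 * gaussExpMoment * ‖x‖ₑ ^ 6 ∂ν := by
        refine mul_le_mul' le_rfl ?_
        rw [lintegral_lintegral_swap (by fun_prop)]
        refine lintegral_mono_ae ?_
        filter_upwards [hν] with x hx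
        rw [lintegral_inner_gaussOn (F := fun a => ENNReal.ofReal
          ((k ^ 2 * (‖x‖ ^ 2 * a ^ 2)) ^ 2 * exp (11 * (k ^ 2 * (‖x‖ ^ 2 * a ^ 2)))))
          (by fun_prop)]
        refine (lintegral_gaussianReal_le (by positivity) fun t =>
          sq_mul_exp_quartic_le hk0 hk4 (norm_nonneg x) hx t).trans (le_of_eq ?_)
        rw [ENNReal.ofReal_mul (by positivity), enorm_norm_pow]
        ring
    _ = _ := by
        rw [lintegral_const_mul _ (by fun_prop), ENNReal.ofReal_mul (p := 9 * exp 9)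
          (by positivity)]
        ring

end Mixture

section Mixture

variable {E : Type*} [NormedAddCommGroup E] [InnerProductSpace ℝ E] [FiniteDimensional ℝ E]
  [MeasurableSpace E] [BorelSpace E] {ν : Measure E} [IsProbabilityMeasure ν] {r c s k : ℝ}

theorem lintegral_tiltDensity (hν : ∀ᵐ x ∂ν, ‖x‖ ≤ r) {F : E → ℝ≥0∞} (hF : Measurable F) :
    ∫⁻ p, F (p.1 + p.2) ∂(ν.prod (gaussOn E))
      = ∫⁻ z, ENNReal.ofReal (tiltDensity ν z) * F z ∂(gaussOn E) := by
  rw [lintegral_prod _ (by fun_prop)]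
  have h1 : ∀ x : E, ∫⁻ g, F (x + g) ∂(gaussOn E)
      = ∫⁻ g, ENNReal.ofReal (exp (⟪g, x⟫_ℝ - ‖x‖ ^ 2 / 2)) * F g ∂(gaussOn E) := fun x => by
    simp_rw [add_comm x, lintegral_gaussOn_add hF]
  simp_rw [h1]
  rw [lintegral_lintegral_swap (by fun_prop)]
  refine lintegral_congr fun z => ?_
  rw [lintegral_mul_const _ (by fun_prop), tiltDensity, ofReal_integral_eq_lintegral_ofReal
    (integrable_of_continuous_of_ae_norm_le hν (by fun_prop)) (.of_forall fun x => (exp_pos _).le)]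
  simp_rw [real_inner_comm]

theorem lintegral_exp_inner_gaussOn (a : E) :
    ∫⁻ x, ENNReal.ofReal (exp (⟪x, a⟫_ℝ - ‖a‖ ^ 2 / 2)) ∂(gaussOn E) = 1 := by
  have := lintegral_gaussOn_add (F := fun _ : E => 1) measurable_const a
  simpa using this.symm

theorem lintegral_exp_sub_one_sub_inner (a : E) :
    ∫⁻ x, ENNReal.ofReal (exp (⟪x, a⟫_ℝ - ‖a‖ ^ 2 / 2) - 1 - (⟪x, a⟫_ℝ - ‖a‖ ^ 2 / 2))
      ∂(gaussOn E) = ENNReal.ofReal (‖a‖ ^ 2 / 2) := by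
  have hm : AEStronglyMeasurable (fun x => exp (⟪x, a⟫_ℝ - ‖a‖ ^ 2 / 2)) (gaussOn E) :=
    Measurable.aestronglyMeasurable (by fun_prop)
  have hI : Integrable (fun x => exp (⟪x, a⟫_ℝ - ‖a‖ ^ 2 / 2)) (gaussOn E) := by
    refine ⟨hm, ?_⟩
    rw [hasFiniteIntegral_iff_ofReal (.of_forall fun h => (exp_pos _).le),
      lintegral_exp_inner_gaussOn]
    exact ENNReal.one_lt_top
  have hi : Integrable (fun x => ⟪x, a⟫_ℝ) (gaussOn E) := by
    simp_rw [real_inner_comm a]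
    exact integrable_inner_gaussOn a
  have hi0 : ∫ x, ⟪x, a⟫_ℝ ∂(gaussOn E) = 0 := by
    simp_rw [real_inner_comm a]
    exact integral_inner_gaussOn a
  rw [← ofReal_integral_eq_lintegral_ofReal
    (f := fun x => exp (⟪x, a⟫_ℝ - ‖a‖ ^ 2 / 2) - 1 - (⟪x, a⟫_ℝ - ‖a‖ ^ 2 / 2))
    ((hI.sub (integrable_const 1)).sub (hi.sub (integrable_const (‖a‖ ^ 2 / 2))))
    (.of_forall fun x => by
      simp only [Pi.zero_apply]
      linarith [add_one_le_exp (⟪x, a⟫_ℝ - ‖a‖ ^ 2 / 2)])]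
  rw [integral_sub (f := fun x => exp (⟪x, a⟫_ℝ - ‖a‖ ^ 2 / 2) - 1)
      (g := fun x => ⟪x, a⟫_ℝ - ‖a‖ ^ 2 / 2)
      (hI.sub (integrable_const 1)) (hi.sub (integrable_const _)),
    integral_sub hI (integrable_const _), integral_sub hi (integrable_const _), hi0,
    integral_eq_lintegral_of_nonneg_ae (.of_forall fun h => (exp_pos _).le) hm,
    lintegral_exp_inner_gaussOn]
  simp

theorem mul_log_sub_le {p ρ a b : ℝ} (hp : 0 ≤ p) (hρ : ρ = exp (a - b)) :
    p * log p - p * log ρ + ρ - p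
      ≤ 3 / 2 * (p - 1) ^ 2 + a ^ 2 + b ^ 2 + (ρ - 1 - (a - b)) := by
  have h1 : p * log p ≤ p * (p - 1) := by
    rcases hp.eq_or_lt with rfl | hp
    · simp
    · exact mul_le_mul_of_nonneg_left (log_le_sub_one_of_pos hp) hp.le
  have h2 : log ρ = a - b := by rw [hρ, log_exp]
  rw [h2]
  nlinarith [sq_nonneg (p - 1 + (a - b)), sq_nonneg (a + b)]

/-- Pointwise control of the chi-square type integrand. -/
theorem sq_div_sub_one_mul_le {L M Q : ℝ} (hM : 1 / 2 ≤ M) :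
    M * (L / M - 1) ^ 2 ≤ 4 * (L - Q) ^ 2 + 4 * (M - Q) ^ 2 := by
  have hM0 : 0 < M := by linarith
  have h1 : M * (L / M - 1) ^ 2 = (L - M) ^ 2 / M := by field_simp
  rw [h1, div_le_iff₀ hM0]
  nlinarith [sq_nonneg (L - Q + (M - Q)), sq_nonneg (L - Q), sq_nonneg (M - Q),
    mul_nonneg (sub_nonneg.2 hM) (sq_nonneg (L - Q)), mul_nonneg (sub_nonneg.2 hM) (sq_nonneg (M - Q))]

/-- Constant in `klDiv_add_gaussOn_le`. -/
def mixtureConst : ℝ≥0∞ :=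
  6 * (ENNReal.ofReal (144 * exp 20) * gaussExpMoment
    + ENNReal.ofReal (9 * exp 9 * 32768) * gaussExpMoment ^ 2)

theorem mixtureConst_ne_top : mixtureConst ≠ ⊤ := by
  unfold mixtureConst
  have := gaussExpMoment_ne_top
  finiteness

theorem lintegral_ratio_le (hν : ∀ᵐ x ∂ν, ‖x‖ ≤ 1 / 10) (hmean : ∫ x, x ∂ν = 0)
    (hcs : c ^ 2 + s ^ 2 = 1) (hk4 : k ≤ 4) (hk0 : 0 ≤ k) (hk : k * (c * s) = 1 / 2) :
    ∫⁻ z, mixDensity c s k ν z * ENNReal.ofReal (3 / 2 *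
      (tiltDensity ν z / (mixDensity c s k ν z).toReal - 1) ^ 2) ∂(gaussOn E)
      ≤ mixtureConst * ∫⁻ x, ‖x‖ₑ ^ 6 ∂ν := by
  have hfin := ae_lt_top (μ := gaussOn E) (measurable_mixDensity (c := c) (s := s) (k := k)
    (ν := ν)) (by rw [lintegral_mixDensity_eq_one hcs]; exact ENNReal.one_ne_top)
  calc _ ≤ ∫⁻ z, (6 * ‖tiltDensity ν z - tiltQuad ν z‖ₑ ^ 2 +
        6 * ‖(mixDensity c s k ν z).toReal - tiltQuad ν z‖ₑ ^ 2) ∂(gaussOn E) := by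
        refine lintegral_mono_ae ?_
        filter_upwards [hfin] with z hz
        have hM : 1 / 2 ≤ (mixDensity c s k ν z).toReal :=
          (ENNReal.ofReal_le_iff_le_toReal hz.ne).1 (half_le_mixDensity hν hcs hk4 hk0 hk z)
        rw [enorm_real_sq, enorm_real_sq]
        nth_rewrite 1 [← ENNReal.ofReal_toReal hz.ne]
        rw [← ENNReal.ofReal_mul ENNReal.toReal_nonneg,
          show (6 : ℝ≥0∞) = ENNReal.ofReal 6 by simp, ← ENNReal.ofReal_mul (by norm_num),
          ← ENNReal.ofReal_mul (by norm_num), ← ENNReal.ofReal_add (by positivity) (by positivity)]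
        refine ENNReal.ofReal_le_ofReal ?_
        have := sq_div_sub_one_mul_le (L := tiltDensity ν z) (Q := tiltQuad ν z) hM
        linarith
    _ ≤ _ := by
        rw [lintegral_add_left (by fun_prop), lintegral_const_mul _ (by fun_prop),
          lintegral_const_mul _ (by fun_prop), mixtureConst]
        have h1 := lintegral_tiltDensity_sub_tiltQuad_le hν (by norm_num) hmean
        have h2 := lintegral_mixDensity_sub_tiltQuad_le hν hcs hk4 hk0 hk
        refine (add_le_add (mul_le_mul' le_rfl h1) (mul_le_mul' le_rfl h2)).trans (le_of_eq ?_)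
        ring

/-- Comparison of a centred Gaussian mixture with a two-stage Gaussian scheme. -/
theorem klDiv_add_gaussOn_le (hν : ∀ᵐ x ∂ν, ‖x‖ ≤ 1 / 10) (hmean : ∫ x, x ∂ν = 0)
    (hcs : c ^ 2 + s ^ 2 = 1) (hk4 : k ≤ 4) (hk0 : 0 ≤ k) (hk : k * (c * s) = 1 / 2)
    {w : E → E} (hw : Measurable w) :
    InformationTheory.klDiv ((ν.prod (gaussOn E)).map fun p => p.1 + p.2)
      (((gaussOn E).prod (gaussOn E)).map
        fun p => c • p.1 + s • (p.2 + w p.1 + covMap k ν p.1))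
      ≤ mixtureConst * (∫⁻ x, ‖x‖ₑ ^ 6 ∂ν) +
        2 * ∫⁻ g, (‖w g‖ₑ ^ 2 + ‖w g‖ₑ ^ 4) ∂(gaussOn E) := by
  set Λ := (gaussOn E).prod (gaussOn E) with hΛ
  set Z : E × E → E := fun p => c • p.1 + s • (p.2 + covMap k ν p.1) with hZ
  have hZm : Measurable Z := by fun_prop
  set D : E → ℝ := fun z => tiltDensity ν z / (mixDensity c s k ν z).toReal with hD
  have hDm : Measurable D := by fun_prop
  have hD0 : ∀ z, 0 ≤ D z := fun z =>
    div_nonneg (tiltDensity_pos hν z).le ENNReal.toReal_nonneg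
  set R : E × E → ℝ := fun p => exp (⟪p.2, w p.1⟫_ℝ - ‖w p.1‖ ^ 2 / 2) with hR
  have hRm : Measurable R := by fun_prop
  have hfin := ae_lt_top (μ := gaussOn E) (measurable_mixDensity (c := c) (s := s) (k := k)
    (ν := ν)) (by rw [lintegral_mixDensity_eq_one hcs]; exact ENNReal.one_ne_top)
  set P' := Λ.withDensity fun p => ENNReal.ofReal (D (Z p)) with hP'
  set R' := Λ.withDensity fun p => ENNReal.ofReal (R p) with hR'
  have hmapP : P'.map Z = (ν.prod (gaussOn E)).map fun p => p.1 + p.2 := by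
    refine Measure.ext_of_lintegral _ fun F hF => ?_
    rw [lintegral_map hF hZm, lintegral_map hF (by fun_prop), lintegral_tiltDensity hν hF,
      hP', lintegral_withDensity_eq_lintegral_mul _ (by fun_prop) (by fun_prop)]
    refine (lintegral_mixDensity (k := k) (ν := ν) hcs
      (F := fun z => ENNReal.ofReal (D z) * F z) (by fun_prop)).trans ?_
    refine lintegral_congr_ae ?_
    filter_upwards [hfin] with z hz
    have hM : 1 / 2 ≤ (mixDensity c s k ν z).toReal :=
      (ENNReal.ofReal_le_iff_le_toReal hz.ne).1 (half_le_mixDensity hν hcs hk4 hk0 hk z)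
    rw [← mul_assoc]
    congr 1
    nth_rewrite 1 [← ENNReal.ofReal_toReal hz.ne]
    rw [← ENNReal.ofReal_mul ENNReal.toReal_nonneg, hD]
    congr 1
    field_simp
  have hmapR : R'.map Z = Λ.map fun p => c • p.1 + s • (p.2 + w p.1 + covMap k ν p.1) := by
    refine Measure.ext_of_lintegral _ fun F hF => ?_
    rw [lintegral_map hF hZm, lintegral_map hF (by fun_prop),
      hR', lintegral_withDensity_eq_lintegral_mul _ (by fun_prop) (by fun_prop), hΛ,
      lintegral_prod _ (by fun_prop), lintegral_prod _ (by fun_prop)]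
    refine lintegral_congr fun g => ?_
    exact (lintegral_gaussOn_add (F := fun h => F (c • g + s • (h + covMap k ν g)))
      (by fun_prop) (w g)).symm
  have : IsProbabilityMeasure P' := by
    refine ⟨?_⟩
    have h : P'.map Z Set.univ = 1 := by
      rw [hmapP, Measure.map_apply (by fun_prop) MeasurableSet.univ]; simp
    rwa [Measure.map_apply hZm MeasurableSet.univ] at h
  have : IsProbabilityMeasure R' := by
    refine ⟨?_⟩
    have h : R'.map Z Set.univ = 1 := by
      rw [hmapR, Measure.map_apply (by fun_prop) MeasurableSet.univ]; simp [hΛ]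
    rwa [Measure.map_apply hZm MeasurableSet.univ] at h
  rw [← hmapP, ← hmapR]
  refine (InformationTheory.klDiv_map_le P' R' hZm).trans ?_
  rw [hP', hR', klDiv_withDensity_eq (by fun_prop) hRm (fun p => hD0 _) (fun p => exp_pos _)]
  calc _ ≤ ∫⁻ p, (ENNReal.ofReal (3 / 2 * (D (Z p) - 1) ^ 2)
          + (ENNReal.ofReal (⟪w p.1, p.2⟫_ℝ ^ 2) + ENNReal.ofReal ((‖w p.1‖ ^ 2 / 2) ^ 2)
          + ENNReal.ofReal (exp (⟪p.2, w p.1⟫_ℝ - ‖w p.1‖ ^ 2 / 2) - 1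
              - (⟪p.2, w p.1⟫_ℝ - ‖w p.1‖ ^ 2 / 2)))) ∂Λ := by
        refine lintegral_mono fun p => ?_
        have h0 := add_one_le_exp (⟪p.2, w p.1⟫_ℝ - ‖w p.1‖ ^ 2 / 2)
        rw [← ENNReal.ofReal_add (by positivity) (by positivity),
          ← ENNReal.ofReal_add (by positivity) (by linarith),
          ← ENNReal.ofReal_add (by positivity) (add_nonneg (by positivity) (by linarith))]
        refine ENNReal.ofReal_le_ofReal ?_
        refine (mul_log_sub_le (hD0 (Z p)) rfl).trans (le_of_eq ?_)
        rw [real_inner_comm]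
        ring
    _ ≤ _ := by
        rw [lintegral_add_left (by fun_prop)]
        refine add_le_add ?_ ?_
        · rw [hΛ, lintegral_mixDensity (k := k) (ν := ν) hcs
            (F := fun z => ENNReal.ofReal (3 / 2 * (D z - 1) ^ 2)) (by fun_prop)]
          exact lintegral_ratio_le hν hmean hcs hk4 hk0 hk
        · rw [hΛ, lintegral_prod _ (by fun_prop), ← lintegral_const_mul _ (by fun_prop)]
          refine lintegral_mono fun g => ?_
          simp only
          rw [lintegral_add_right _ (by fun_prop), lintegral_add_right _ (by fun_prop),
            lintegral_inner_sq_gaussOn, lintegral_exp_sub_one_sub_inner, lintegral_const,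
            measure_univ, mul_one, enorm_norm_pow, enorm_norm_pow,
            ← ENNReal.ofReal_add (by positivity) (by positivity),
            ← ENNReal.ofReal_add (by positivity) (by positivity),
            ← ENNReal.ofReal_add (by positivity) (by positivity),
            show (2 : ℝ≥0∞) = ENNReal.ofReal 2 by simp, ← ENNReal.ofReal_mul (by norm_num)]
          refine ENNReal.ofReal_le_ofReal ?_
          nlinarith [sq_nonneg (‖w g‖ ^ 2), sq_nonneg ‖w g‖]

end Mixture

theorem pow_le_factorial_mul_exp {x : ℝ} (hx : 0 ≤ x) (n : ℕ) :
    x ^ n ≤ n.factorial * exp x := by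
  have := pow_div_factorial_le_exp x hx n
  rwa [div_le_iff₀ (by positivity), mul_comm] at this

theorem abs_pow_mul_exp_le {ω s : ℝ} (hω0 : 0 ≤ ω) (hω : ω ≤ 1) (hs0 : 0 ≤ s) (hs : s ≤ 1 / 10)
    (m : ℕ) {j : ℕ} (hj : j ≤ 8) (G : ℝ) :
    |ω * (s * G)| ^ m * exp (j * |ω * (s * G)|)
      ≤ (m.factorial * exp 4 * s ^ m) * exp (G ^ 2 / 4) := by
  have h1 : |ω * (s * G)| ≤ s * |G| := by
    rw [abs_mul, abs_mul, abs_of_nonneg hω0, abs_of_nonneg hs0]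
    exact mul_le_of_le_one_left (by positivity) hω
  have h2 : (j : ℝ) ≤ 8 := by exact_mod_cast hj
  have h3 : j * |ω * (s * G)| ≤ 4 / 5 * |G| := by
    calc j * |ω * (s * G)| ≤ 8 * (1 / 10 * |G|) := by gcongr; exact h1.trans (by gcongr)
      _ = _ := by ring
  calc |ω * (s * G)| ^ m * exp (j * |ω * (s * G)|)
      ≤ (s * |G|) ^ m * exp (4 / 5 * |G|) := by gcongr
    _ = s ^ m * (|G| ^ m * exp (4 / 5 * |G|)) := by ring
    _ ≤ s ^ m * ((m.factorial * exp |G|) * exp (4 / 5 * |G|)) := by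
        gcongr
        exact pow_le_factorial_mul_exp (abs_nonneg G) m
    _ = s ^ m * m.factorial * exp (9 / 5 * |G|) := by
        rw [mul_assoc (m.factorial : ℝ), ← exp_add]; ring_nf
    _ ≤ s ^ m * m.factorial * exp (4 + G ^ 2 / 4) := by
        gcongr
        nlinarith [sq_nonneg (|G| - 18 / 5), sq_abs G]
    _ = _ := by rw [exp_add]; ring

theorem mul_le_sq_add_sq (a b : ℝ≥0∞) : a * b ≤ a ^ 2 + b ^ 2 := by
  rcases le_total a b with h | h
  · exact (mul_le_mul' h le_rfl).trans (by rw [← sq]; exact le_add_self)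
  · exact (mul_le_mul' le_rfl h).trans (by rw [← sq]; exact le_self_add)

section Moments

variable {E : Type*} [NormedAddCommGroup E] [InnerProductSpace ℝ E] [FiniteDimensional ℝ E]
  [MeasurableSpace E] [BorelSpace E]

theorem lintegral_norm_pow_gaussOn_le (n : ℕ) :
    ∫⁻ g, ‖g‖ₑ ^ (2 * (n + 1)) ∂(gaussOn E)
      ≤ ENNReal.ofReal (4 ^ (n + 1) * (n + 1).factorial) * gaussExpMoment
        * (Module.finrank ℝ E : ℝ≥0∞) ^ (n + 1) := by
  set b := stdOrthonormalBasis ℝ E with hb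
  set D := Module.finrank ℝ E with hD
  have h1 : ∀ g : E, ‖g‖ₑ ^ (2 * (n + 1))
      ≤ (D : ℝ≥0∞) ^ n * ∑ i, ENNReal.ofReal (⟪b i, g⟫_ℝ ^ (2 * (n + 1))) := by
    intro g
    rw [enorm_norm_pow, pow_mul, ← b.sum_sq_norm_inner_right g,
      ← ENNReal.ofReal_sum_of_nonneg (fun i _ => by rw [pow_mul]; positivity),
      ← ENNReal.ofReal_natCast, ← ENNReal.ofReal_pow (by positivity),
      ← ENNReal.ofReal_mul (by positivity)]
    refine ENNReal.ofReal_le_ofReal ?_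
    have := pow_sum_div_card_le_sum_pow (s := Finset.univ)
      (f := fun i => ‖⟪b i, g⟫_ℝ‖ ^ 2) (fun i _ => by positivity) n
    simp only [Finset.card_univ, Fintype.card_fin, norm_eq_abs, sq_abs] at this ⊢
    rcases Nat.eq_zero_or_pos D with h0 | h0
    · have : IsEmpty (Fin D) := by rw [h0]; infer_instance
      simp
    · rw [div_le_iff₀ (by positivity), mul_comm] at this
      simpa only [pow_mul] using this
  have h2 : ∀ i, ∫⁻ g, ENNReal.ofReal (⟪b i, g⟫_ℝ ^ (2 * (n + 1))) ∂(gaussOn E)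
      ≤ ENNReal.ofReal (4 ^ (n + 1) * (n + 1).factorial) * gaussExpMoment := by
    intro i
    rw [lintegral_inner_gaussOn (F := fun a => ENNReal.ofReal (a ^ (2 * (n + 1)))) (by fun_prop)]
    refine lintegral_gaussianReal_le (by positivity) fun s => ?_
    rw [b.norm_eq_one, one_mul]
    have := pow_le_factorial_mul_exp (x := s ^ 2 / 4) (by positivity) (n + 1)
    calc s ^ (2 * (n + 1)) = 4 ^ (n + 1) * (s ^ 2 / 4) ^ (n + 1) := by
          rw [← mul_pow, pow_mul]; congr 1; ring
      _ ≤ 4 ^ (n + 1) * ((n + 1).factorial * exp (s ^ 2 / 4)) := by gcongr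
      _ = _ := by ring
  calc _ ≤ ∫⁻ g, (D : ℝ≥0∞) ^ n * ∑ i, ENNReal.ofReal (⟪b i, g⟫_ℝ ^ (2 * (n + 1)))
        ∂(gaussOn E) := lintegral_mono h1
    _ = (D : ℝ≥0∞) ^ n * ∑ i, ∫⁻ g, ENNReal.ofReal (⟪b i, g⟫_ℝ ^ (2 * (n + 1)))
        ∂(gaussOn E) := by
        rw [lintegral_const_mul _ (by fun_prop), lintegral_finsetSum _ (fun i _ => by fun_prop)]
    _ ≤ (D : ℝ≥0∞) ^ n * ∑ _i : Fin D,
        ENNReal.ofReal (4 ^ (n + 1) * (n + 1).factorial) * gaussExpMoment := by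
        gcongr with i
        exact h2 i
    _ = _ := by
        rw [Finset.sum_const, Finset.card_univ, Fintype.card_fin, nsmul_eq_mul, pow_succ]
        ring

variable {ν : Measure E} [IsProbabilityMeasure ν] {r ω : ℝ}

/-- Barycentre of the exponential tilt of `ν` in the direction `ω • g`. -/
def tiltMean (ω : ℝ) (ν : Measure E) (g : E) : E :=
  (∫ x, exp (ω * ⟪x, g⟫_ℝ) ∂ν)⁻¹ • ∫ x, exp (ω * ⟪x, g⟫_ℝ) • x ∂ν

@[fun_prop]
theorem measurable_tiltMean : Measurable (tiltMean ω ν) := by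
  unfold tiltMean
  refine Measurable.smul (Measurable.inv (StronglyMeasurable.measurable ?_))
    (StronglyMeasurable.measurable ?_)
  · refine StronglyMeasurable.integral_prod_right (f := fun z x => exp (ω * ⟪x, z⟫_ℝ)) ?_
    exact (by fun_prop : Continuous _).stronglyMeasurable
  · refine StronglyMeasurable.integral_prod_right (f := fun z x => exp (ω * ⟪x, z⟫_ℝ) • x) ?_
    exact (by fun_prop : Continuous _).stronglyMeasurable

/-- Mixed absolute moments of the tilt exponent. -/
def tiltMoment (ω : ℝ) (ν : Measure E) (i m j : ℕ) (g : E) : ℝ≥0∞ :=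
  ∫⁻ x, ENNReal.ofReal (‖x‖ ^ i * (|ω * ⟪x, g⟫_ℝ| ^ m * exp (j * |ω * ⟪x, g⟫_ℝ|))) ∂ν

@[fun_prop]
theorem measurable_tiltMoment (i m j : ℕ) : Measurable (tiltMoment ω ν i m j) := by
  unfold tiltMoment
  refine Measurable.lintegral_prod_right' (f := fun q : E × E =>
    ENNReal.ofReal (‖q.2‖ ^ i * (|ω * ⟪q.2, q.1⟫_ℝ| ^ m * exp (j * |ω * ⟪q.2, q.1⟫_ℝ|)))) ?_
  have : Continuous fun q : E × E =>
    ‖q.2‖ ^ i * (|ω * ⟪q.2, q.1⟫_ℝ| ^ m * exp (j * |ω * ⟪q.2, q.1⟫_ℝ|)) := by fun_prop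
  exact this.measurable.ennreal_ofReal

theorem lintegral_tiltMoment_pow_le (hν : ∀ᵐ x ∂ν, ‖x‖ ≤ 1 / 10) (hω0 : 0 ≤ ω) (hω : ω ≤ 1)
    (i m j N : ℕ) (hj : j * (N + 1) ≤ 8) :
    ∫⁻ g, tiltMoment ω ν i m j g ^ (N + 1) ∂(gaussOn E)
      ≤ ENNReal.ofReal ((m * (N + 1)).factorial * exp 4) * gaussExpMoment
        * ∫⁻ x, ‖x‖ₑ ^ ((i + m) * (N + 1)) ∂ν := by
  have hcont : Continuous fun q : E × E => ‖q.2‖ ^ (i * (N + 1))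
      * (|ω * ⟪q.2, q.1⟫_ℝ| ^ (m * (N + 1)) * exp ((j * (N + 1) : ℕ) * |ω * ⟪q.2, q.1⟫_ℝ|)) := by
    fun_prop
  calc _ ≤ ∫⁻ g, ∫⁻ x, ENNReal.ofReal (‖x‖ ^ (i * (N + 1)) * (|ω * ⟪x, g⟫_ℝ| ^ (m * (N + 1))
          * exp ((j * (N + 1) : ℕ) * |ω * ⟪x, g⟫_ℝ|))) ∂ν ∂(gaussOn E) := by
        refine lintegral_mono fun g => ?_
        refine (pow_lintegral_le_lintegral_pow (by fun_prop) N).trans (le_of_eq ?_)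
        refine lintegral_congr fun x => ?_
        rw [← ENNReal.ofReal_pow (by positivity), mul_pow, mul_pow, ← pow_mul, ← pow_mul,
          ← exp_nat_mul]
        push_cast
        ring_nf
    _ = ∫⁻ x, ∫⁻ g, ENNReal.ofReal (‖x‖ ^ (i * (N + 1)) * (|ω * ⟪x, g⟫_ℝ| ^ (m * (N + 1))
          * exp ((j * (N + 1) : ℕ) * |ω * ⟪x, g⟫_ℝ|))) ∂(gaussOn E) ∂ν :=
        lintegral_lintegral_swap hcont.measurable.ennreal_ofReal.aemeasurable
    _ ≤ ∫⁻ x, ENNReal.ofReal ((m * (N + 1)).factorial * exp 4) * gaussExpMoment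
        * ‖x‖ₑ ^ ((i + m) * (N + 1)) ∂ν := by
        refine lintegral_mono_ae ?_
        filter_upwards [hν] with x hx
        rw [lintegral_inner_gaussOn (F := fun a => ENNReal.ofReal (‖x‖ ^ (i * (N + 1))
          * (|ω * a| ^ (m * (N + 1)) * exp ((j * (N + 1) : ℕ) * |ω * a|)))) (by fun_prop)]
        refine (lintegral_gaussianReal_le
          (A := (m * (N + 1)).factorial * exp 4 * ‖x‖ ^ ((i + m) * (N + 1)))
          (by positivity) fun t => ?_).trans (le_of_eq ?_)
        · have := abs_pow_mul_exp_le hω0 hω (norm_nonneg x) hx (m * (N + 1)) hj t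
          refine (mul_le_mul_of_nonneg_left this (by positivity)).trans (le_of_eq ?_)
          ring
        · rw [ENNReal.ofReal_mul (by positivity), enorm_norm_pow]
          ring
    _ = _ := lintegral_const_mul _ (by fun_prop)

/-- Constant in the moment bounds below. -/
def momentConst : ℝ≥0∞ := ENNReal.ofReal ((16 : ℕ).factorial * exp 4) * gaussExpMoment

theorem momentConst_ne_top : momentConst ≠ ⊤ := by
  unfold momentConst
  have := gaussExpMoment_ne_top
  finiteness

theorem one_le_momentConst : 1 ≤ momentConst := by
  unfold momentConst
  refine one_le_mul_of_one_le_of_one_le ?_ one_le_gaussExpMoment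
  rw [← ENNReal.ofReal_one]
  refine ENNReal.ofReal_le_ofReal ?_
  refine one_le_mul_of_one_le_of_one_le ?_ (one_le_exp (by norm_num))
  exact_mod_cast Nat.one_le_iff_ne_zero.2 (Nat.factorial_ne_zero 16)

theorem lintegral_tiltMoment_pow_le_six (hν : ∀ᵐ x ∂ν, ‖x‖ ≤ 1 / 10) (hω0 : 0 ≤ ω) (hω : ω ≤ 1)
    (i m j N : ℕ) (hj : j * (N + 1) ≤ 8) (hm : m * (N + 1) ≤ 16) (h6 : 6 ≤ (i + m) * (N + 1)) :
    ∫⁻ g, tiltMoment ω ν i m j g ^ (N + 1) ∂(gaussOn E)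
      ≤ momentConst * ∫⁻ x, ‖x‖ₑ ^ 6 ∂ν := by
  refine (lintegral_tiltMoment_pow_le hν hω0 hω i m j N hj).trans ?_
  unfold momentConst
  gcongr ENNReal.ofReal ?_ * gaussExpMoment * ?_
  · gcongr
  · refine lintegral_mono_ae ?_
    filter_upwards [hν] with x hx
    rw [enorm_norm_pow, enorm_norm_pow]
    exact ENNReal.ofReal_le_ofReal
      (pow_le_pow_of_le_one (norm_nonneg x) (hx.trans (by norm_num)) h6)

theorem enorm_tiltMean_sub_le (hν : ∀ᵐ x ∂ν, ‖x‖ ≤ r) (hmean : ∫ x, x ∂ν = 0) (g : E) :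
    ‖tiltMean ω ν g - ω • ∫ x, ⟪x, g⟫_ℝ • x ∂ν‖ₑ
      ≤ tiltMoment ω ν 1 2 1 g + tiltMoment ω ν 1 1 0 g * tiltMoment ω ν 0 2 1 g := by
  set Z := ∫ x, exp (ω * ⟪x, g⟫_ℝ) ∂ν with hZ
  have hI : ∀ {f : E → E}, Continuous f → Integrable f ν :=
    fun hf => integrable_of_continuous_of_ae_norm_le hν hf
  have hIr : ∀ {f : E → ℝ}, Continuous f → Integrable f ν :=
    fun hf => integrable_of_continuous_of_ae_norm_le hν hf
  have hIx : Integrable (fun x : E => x) ν := hI continuous_id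
  have hmi : ∫ x, ω * ⟪x, g⟫_ℝ ∂ν = 0 := by
    rw [integral_const_mul]
    simp_rw [real_inner_comm g]
    rw [integral_inner (f := fun x : E => x) hIx, hmean, inner_zero_right, mul_zero]
  have hZ1 : Z - 1 = ∫ x, (exp (ω * ⟪x, g⟫_ℝ) - 1 - ω * ⟪x, g⟫_ℝ) ∂ν := by
    rw [integral_sub (hIr (by fun_prop)) (hIr (by fun_prop)),
      integral_sub (hIr (by fun_prop)) (hIr (by fun_prop)), hmi]
    simp [hZ]
  have hZ0 : 1 ≤ Z := by
    have : 0 ≤ Z - 1 := by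
      rw [hZ1]
      exact integral_nonneg fun x => by
        simp only [Pi.zero_apply]
        linarith [add_one_le_exp (ω * ⟪x, g⟫_ℝ)]
    linarith
  have hsplit : tiltMean ω ν g - ω • ∫ x, ⟪x, g⟫_ℝ • x ∂ν
      = Z⁻¹ • (∫ x, (exp (ω * ⟪x, g⟫_ℝ) - 1 - ω * ⟪x, g⟫_ℝ) • x ∂ν)
        + (Z⁻¹ - 1) • ∫ x, (ω * ⟪x, g⟫_ℝ) • x ∂ν := by
    simp_rw [sub_smul, one_smul]
    rw [integral_sub (f := fun x => exp (ω * ⟪x, g⟫_ℝ) • x - x) (hI (by fun_prop))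
      (hI (by fun_prop)), integral_sub (hI (by fun_prop)) hIx, hmean, tiltMean]
    have : ω • ∫ x, ⟪x, g⟫_ℝ • x ∂ν = ∫ x, (ω * ⟪x, g⟫_ℝ) • x ∂ν := by
      rw [← integral_smul]
      simp_rw [smul_smul]
    rw [this, ← hZ]
    module
  rw [hsplit]
  refine (enorm_add_le _ _).trans (add_le_add ?_ ?_)
  · rw [enorm_smul]
    have h1 : ‖Z⁻¹‖ₑ ≤ 1 := by
      rw [← ofReal_norm, ← ENNReal.ofReal_one]
      refine ENNReal.ofReal_le_ofReal ?_
      rw [norm_inv, norm_of_nonneg (by linarith)]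
      exact inv_le_one_of_one_le₀ hZ0
    refine (mul_le_mul' h1 (enorm_integral_le_lintegral_enorm _)).trans ?_
    rw [one_mul]
    refine lintegral_mono fun x => ?_
    rw [← ofReal_norm]
    refine ENNReal.ofReal_le_ofReal ?_
    rw [norm_smul, mul_comm, norm_eq_abs, pow_one, sq_abs, Nat.cast_one, one_mul]
    gcongr
    exact abs_exp_sub_one_sub_id_le_mul_exp _
  · rw [enorm_smul, mul_comm]
    refine mul_le_mul' ((enorm_integral_le_lintegral_enorm _).trans (le_of_eq ?_)) ?_
    · refine lintegral_congr fun x => ?_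
      rw [← ofReal_norm, norm_smul, norm_eq_abs]
      simp [mul_comm]
    · have h1 : ‖Z⁻¹ - 1‖ₑ ≤ ‖Z - 1‖ₑ := by
        rw [← ofReal_norm, ← ofReal_norm]
        refine ENNReal.ofReal_le_ofReal ?_
        have h2 : Z⁻¹ - 1 = -(Z⁻¹ * (Z - 1)) := by
          field_simp
          ring
        rw [h2, norm_neg, norm_mul, norm_inv, norm_of_nonneg (by linarith : 0 ≤ Z)]
        exact mul_le_of_le_one_left (norm_nonneg _) (inv_le_one_of_one_le₀ hZ0)
      refine h1.trans ?_
      rw [hZ1]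
      refine (enorm_integral_le_lintegral_enorm _).trans (lintegral_mono fun x => ?_)
      rw [← ofReal_norm]
      refine ENNReal.ofReal_le_ofReal ?_
      rw [norm_eq_abs, pow_zero, one_mul, sq_abs, Nat.cast_one, one_mul]
      exact abs_exp_sub_one_sub_id_le_mul_exp _

end Moments

theorem add_pow_le_two_pow_mul (a b : ℝ≥0∞) (n : ℕ) :
    (a + b) ^ n ≤ 2 ^ n * (a ^ n + b ^ n) := by
  rcases le_total a b with h | h
  · calc (a + b) ^ n ≤ (2 * b) ^ n := by rw [two_mul]; gcongr
      _ = 2 ^ n * b ^ n := mul_pow _ _ _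
      _ ≤ _ := by gcongr; exact le_add_self
  · calc (a + b) ^ n ≤ (2 * a) ^ n := by rw [two_mul]; gcongr
      _ = 2 ^ n * a ^ n := mul_pow _ _ _
      _ ≤ _ := by gcongr; exact le_self_add

theorem sq_add_pow_four_add_le (a b : ℝ≥0∞) :
    (a + b) ^ 2 + (a + b) ^ 4 ≤ 16 * ((a ^ 2 + a ^ 4) + (b ^ 2 + b ^ 4)) := by
  calc _ ≤ 2 ^ 2 * (a ^ 2 + b ^ 2) + 2 ^ 4 * (a ^ 4 + b ^ 4) :=
        add_le_add (add_pow_le_two_pow_mul a b 2) (add_pow_le_two_pow_mul a b 4)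
    _ ≤ 2 ^ 4 * (a ^ 2 + b ^ 2) + 2 ^ 4 * (a ^ 4 + b ^ 4) := by
        gcongr
        · norm_num
        · norm_num
    _ = _ := by ring

section Normalized

variable {E : Type*} [NormedAddCommGroup E] [InnerProductSpace ℝ E] [FiniteDimensional ℝ E]
  [MeasurableSpace E] [BorelSpace E] {ν : Measure E} [IsProbabilityMeasure ν]
  {r c s c₁ ω μ η : ℝ}

/-- Constant in `klDiv_normalized_le`. -/
def normalizedConst : ℝ≥0∞ := mixtureConst + 2 * (40 * 16 ^ 4 * 8) * momentConst

theorem normalizedConst_ne_top : normalizedConst ≠ ⊤ := by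
  unfold normalizedConst
  have := mixtureConst_ne_top
  have := momentConst_ne_top
  finiteness

theorem four_mul_gaussExpMoment_le {m : ℕ} (hm : 4 ^ m * m.factorial ≤ (16 : ℕ).factorial) :
    ENNReal.ofReal (4 ^ m * m.factorial) * gaussExpMoment ≤ momentConst := by
  unfold momentConst
  refine mul_le_mul' (ENNReal.ofReal_le_ofReal ?_) le_rfl
  have : (4 ^ m * m.factorial : ℝ) ≤ (16 : ℕ).factorial := by exact_mod_cast hm
  refine this.trans ?_
  exact le_mul_of_one_le_right (Nat.cast_nonneg _) (one_le_exp (by norm_num))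

theorem lintegral_gauss_part_le :
    ∫⁻ g : E, ((ENNReal.ofReal μ * ‖g‖ₑ) ^ 2 + (ENNReal.ofReal μ * ‖g‖ₑ) ^ 4) ∂(gaussOn E)
      ≤ momentConst * (ENNReal.ofReal μ ^ 2 * (Module.finrank ℝ E : ℝ≥0∞)
        + ENNReal.ofReal μ ^ 4 * (Module.finrank ℝ E : ℝ≥0∞) ^ 2) := by
  have h1 := lintegral_norm_pow_gaussOn_le (E := E) 0
  have h2 := lintegral_norm_pow_gaussOn_le (E := E) 1
  have e1 := four_mul_gaussExpMoment_le (m := 1) (by decide)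
  have e2 := four_mul_gaussExpMoment_le (m := 2) (by decide)
  simp only [zero_add, mul_one, Nat.reduceAdd, Nat.reduceMul, pow_one] at h1 h2 e1
  simp_rw [mul_pow]
  rw [lintegral_add_left (by fun_prop), lintegral_const_mul _ (by fun_prop),
    lintegral_const_mul _ (by fun_prop), mul_add]
  refine add_le_add ?_ ?_
  · calc _ ≤ ENNReal.ofReal μ ^ 2 * (momentConst * (Module.finrank ℝ E : ℝ≥0∞)) := by
          gcongr
          exact h1.trans (mul_le_mul' e1 le_rfl)
      _ = _ := by ring
  · calc _ ≤ ENNReal.ofReal μ ^ 4 * (momentConst * (Module.finrank ℝ E : ℝ≥0∞) ^ 2) := by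
          gcongr
          exact h2.trans (mul_le_mul' e2 le_rfl)
      _ = _ := by ring

theorem lintegral_moment_part_le (hν : ∀ᵐ x ∂ν, ‖x‖ ≤ 1 / 10) (hη : η ≤ 1) :
    ∫⁻ g : E, ((ENNReal.ofReal η * tiltMoment 1 ν 1 1 0 g) ^ 2
        + (ENNReal.ofReal η * tiltMoment 1 ν 1 1 0 g) ^ 4) ∂(gaussOn E)
      ≤ momentConst * (2 * ∫⁻ x, ‖x‖ₑ ^ 6 ∂ν + ENNReal.ofReal η ^ 6) := by
  have h1 := lintegral_tiltMoment_pow_le hν (zero_le_one) le_rfl 1 1 0 1 (by norm_num)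
  have h2 := lintegral_tiltMoment_pow_le_six hν (zero_le_one) le_rfl 1 1 0 3 (by norm_num)
    (by norm_num) (by norm_num)
  simp only [Nat.reduceAdd, Nat.reduceMul] at h1 h2
  have hη' : ENNReal.ofReal η ^ 4 ≤ 1 := by
    refine pow_le_one' ?_ 4
    rw [← ENNReal.ofReal_one]
    exact ENNReal.ofReal_le_ofReal hη
  have h3 : ENNReal.ofReal η ^ 2 * ∫⁻ x, ‖x‖ₑ ^ 4 ∂ν
      ≤ ENNReal.ofReal η ^ 6 + ∫⁻ x, ‖x‖ₑ ^ 6 ∂ν := by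
    rw [← lintegral_const_mul _ (by fun_prop)]
    calc _ ≤ ∫⁻ x, (ENNReal.ofReal η ^ 6 + ‖x‖ₑ ^ 6) ∂ν := by
          refine lintegral_mono fun x => ?_
          rcases le_total (ENNReal.ofReal η) ‖x‖ₑ with h | h
          · calc _ ≤ ‖x‖ₑ ^ 2 * ‖x‖ₑ ^ 4 := by gcongr
              _ = ‖x‖ₑ ^ 6 := by ring
              _ ≤ _ := le_add_self
          · calc _ ≤ ENNReal.ofReal η ^ 2 * ENNReal.ofReal η ^ 4 := by gcongr
              _ = ENNReal.ofReal η ^ 6 := by ring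
              _ ≤ _ := le_self_add
      _ = _ := by rw [lintegral_add_left (by fun_prop)]; simp
  have e1 : ENNReal.ofReal ((2 : ℕ).factorial * exp 4) * gaussExpMoment ≤ momentConst := by
    unfold momentConst
    gcongr
    norm_num
  simp_rw [mul_pow]
  rw [lintegral_add_left (by fun_prop), lintegral_const_mul _ (by fun_prop),
    lintegral_const_mul _ (by fun_prop)]
  calc _ ≤ ENNReal.ofReal η ^ 2 * (momentConst * ∫⁻ x, ‖x‖ₑ ^ 4 ∂ν)
        + 1 * (momentConst * ∫⁻ x, ‖x‖ₑ ^ 6 ∂ν) := by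
        refine add_le_add (mul_le_mul' le_rfl (h1.trans ?_)) (mul_le_mul' hη' h2)
        gcongr
    _ = momentConst * (ENNReal.ofReal η ^ 2 * ∫⁻ x, ‖x‖ₑ ^ 4 ∂ν)
        + momentConst * ∫⁻ x, ‖x‖ₑ ^ 6 ∂ν := by ring
    _ ≤ momentConst * (ENNReal.ofReal η ^ 6 + ∫⁻ x, ‖x‖ₑ ^ 6 ∂ν)
        + momentConst * ∫⁻ x, ‖x‖ₑ ^ 6 ∂ν := by gcongr
    _ = _ := by ring

theorem lintegral_tilt_part_le (hν : ∀ᵐ x ∂ν, ‖x‖ ≤ 1 / 10) (hω0 : 0 ≤ ω) (hω : ω ≤ 1) :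
    ∫⁻ g : E, (tiltMoment ω ν 1 2 1 g ^ 2 + tiltMoment ω ν 1 2 1 g ^ 4) ∂(gaussOn E)
      ≤ momentConst * (2 * ∫⁻ x, ‖x‖ₑ ^ 6 ∂ν) := by
  have h1 := lintegral_tiltMoment_pow_le_six hν hω0 hω 1 2 1 1 (by norm_num) (by norm_num)
    (by norm_num)
  have h2 := lintegral_tiltMoment_pow_le_six hν hω0 hω 1 2 1 3 (by norm_num) (by norm_num)
    (by norm_num)
  rw [lintegral_add_left (by fun_prop)]
  refine (add_le_add h1 h2).trans (le_of_eq (by ring))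

theorem lintegral_prod_part_le (hν : ∀ᵐ x ∂ν, ‖x‖ ≤ 1 / 10) (hω0 : 0 ≤ ω) (hω : ω ≤ 1) :
    ∫⁻ g : E, ((tiltMoment ω ν 1 1 0 g * tiltMoment ω ν 0 2 1 g) ^ 2
        + (tiltMoment ω ν 1 1 0 g * tiltMoment ω ν 0 2 1 g) ^ 4) ∂(gaussOn E)
      ≤ momentConst * (4 * ∫⁻ x, ‖x‖ₑ ^ 6 ∂ν) := by
  have h1 := lintegral_tiltMoment_pow_le_six hν hω0 hω 1 1 0 3 (by norm_num) (by norm_num)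
    (by norm_num)
  have h2 := lintegral_tiltMoment_pow_le_six hν hω0 hω 0 2 1 3 (by norm_num) (by norm_num)
    (by norm_num)
  have h3 := lintegral_tiltMoment_pow_le_six hν hω0 hω 1 1 0 7 (by norm_num) (by norm_num)
    (by norm_num)
  have h4 := lintegral_tiltMoment_pow_le_six hν hω0 hω 0 2 1 7 (by norm_num) (by norm_num)
    (by norm_num)
  calc _ ≤ ∫⁻ g : E, (tiltMoment ω ν 1 1 0 g ^ 4 + tiltMoment ω ν 0 2 1 g ^ 4
        + tiltMoment ω ν 1 1 0 g ^ 8 + tiltMoment ω ν 0 2 1 g ^ 8) ∂(gaussOn E) := by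
        refine lintegral_mono fun g => ?_
        rw [mul_pow, mul_pow, add_assoc]
        refine add_le_add ((mul_le_sq_add_sq _ _).trans (le_of_eq (by ring)))
          ((mul_le_sq_add_sq _ _).trans (le_of_eq (by ring)))
    _ ≤ _ := by
        rw [lintegral_add_left (by fun_prop), lintegral_add_left (by fun_prop),
          lintegral_add_left (by fun_prop)]
        refine (add_le_add (add_le_add (add_le_add h1 h2) h3) h4).trans (le_of_eq (by ring))

/-- Normalized one-step comparison: a centred Gaussian mixture against the scheme driven by the
exact tilted mean, up to coefficient and drift errors. -/
theorem klDiv_normalized_le (hν : ∀ᵐ x ∂ν, ‖x‖ ≤ 1 / 10) (hmean : ∫ x, x ∂ν = 0)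
    (hω0 : 0 ≤ ω) (hω : ω ≤ 1) (hcs : c ^ 2 + s ^ 2 = 1) (hc : 2 / 5 ≤ c) (hs : 2 / 5 ≤ s)
    (hμ : |c₁ - c| ≤ μ) (hωη : |ω - 1 / (2 * c)| ≤ η) (hη : η ≤ 1)
    {e : E → E} (he : Measurable e) (he1 : ∀ g, ‖e g‖ ≤ 1) :
    InformationTheory.klDiv ((ν.prod (gaussOn E)).map fun p => p.1 + p.2)
      (((gaussOn E).prod (gaussOn E)).map
        fun p => c₁ • p.1 + s • p.2 + tiltMean ω ν p.1 + e p.1)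
      ≤ normalizedConst * ((∫⁻ x, ‖x‖ₑ ^ 6 ∂ν)
        + (ENNReal.ofReal μ ^ 2 * (Module.finrank ℝ E : ℝ≥0∞)
          + ENNReal.ofReal μ ^ 4 * (Module.finrank ℝ E : ℝ≥0∞) ^ 2 + ENNReal.ofReal η ^ 6)
        + ∫⁻ g, ‖e g‖ₑ ^ 2 ∂(gaussOn E)) := by
  have hs0 : s ≠ 0 := by linarith
  have hc0 : c ≠ 0 := by linarith
  set k := 1 / (2 * c * s) with hk
  set w : E → E := fun g => s⁻¹ • ((c₁ - c) • g + tiltMean ω ν g + e g) - covMap k ν g with hw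
  have hwm : Measurable w := by fun_prop
  have hcs8 : 1 / 8 ≤ c * s := by nlinarith
  have key := klDiv_add_gaussOn_le hν hmean hcs (k := k)
    (by rw [hk, div_le_iff₀ (by positivity)]; linarith) (by positivity)
    (by rw [hk]; field_simp) hwm
  have hfun : (fun p : E × E => c • p.1 + s • (p.2 + w p.1 + covMap k ν p.1))
      = fun p => c₁ • p.1 + s • p.2 + tiltMean ω ν p.1 + e p.1 := by
    funext p
    simp only [hw]
    have : s • (p.2 + (s⁻¹ • ((c₁ - c) • p.1 + tiltMean ω ν p.1 + e p.1) - covMap k ν p.1)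
        + covMap k ν p.1)
        = s • p.2 + (s * s⁻¹) • ((c₁ - c) • p.1 + tiltMean ω ν p.1 + e p.1) := by
      module
    rw [this, mul_inv_cancel₀ hs0]
    module
  rw [hfun] at key
  refine key.trans ?_
  have hwle : ∀ g, ‖w g‖ₑ ≤ ENNReal.ofReal (5 / 2) * (ENNReal.ofReal μ * ‖g‖ₑ
      + (tiltMoment ω ν 1 2 1 g + (tiltMoment ω ν 1 1 0 g * tiltMoment ω ν 0 2 1 g
        + (ENNReal.ofReal η * tiltMoment 1 ν 1 1 0 g + ‖e g‖ₑ)))) := by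
    intro g
    set M := ∫ x, ⟪x, g⟫_ℝ • x ∂ν with hM
    have hMle : ‖M‖ₑ ≤ tiltMoment 1 ν 1 1 0 g := by
      refine (enorm_integral_le_lintegral_enorm _).trans (le_of_eq ?_)
      refine lintegral_congr fun x => ?_
      rw [← ofReal_norm, norm_smul, norm_eq_abs]
      simp [mul_comm]
    have hsplit : w g = s⁻¹ • ((c₁ - c) • g + ((tiltMean ω ν g - ω • M)
        + ((ω - 1 / (2 * c)) • M + e g))) := by
      have : covMap k ν g = s⁻¹ • ((1 / (2 * c)) • M) := by
        rw [covMap, smul_smul, hk]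
        congr 1
        field_simp
      simp only [hw, this]
      module
    rw [hsplit, enorm_smul]
    refine mul_le_mul' ?_ ?_
    · rw [← ofReal_norm]
      refine ENNReal.ofReal_le_ofReal ?_
      rw [norm_inv, norm_of_nonneg (by linarith), inv_le_comm₀ (by linarith) (by norm_num)]
      linarith
    · rw [← add_assoc (tiltMoment ω ν 1 2 1 g)]
      refine (enorm_add_le _ _).trans (add_le_add ?_ ((enorm_add_le _ _).trans
        (add_le_add (enorm_tiltMean_sub_le hν hmean g) ((enorm_add_le _ _).trans
          (add_le_add ?_ le_rfl)))))
      · rw [enorm_smul, ← ofReal_norm]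
        gcongr
        exact hμ
      · rw [enorm_smul, ← ofReal_norm]
        gcongr
        exact hωη
  have hΦ : ∀ g, ‖w g‖ₑ ^ 2 + ‖w g‖ₑ ^ 4 ≤ 40 * 16 ^ 4 *
      (((ENNReal.ofReal μ * ‖g‖ₑ) ^ 2 + (ENNReal.ofReal μ * ‖g‖ₑ) ^ 4)
      + ((tiltMoment ω ν 1 2 1 g ^ 2 + tiltMoment ω ν 1 2 1 g ^ 4)
      + (((tiltMoment ω ν 1 1 0 g * tiltMoment ω ν 0 2 1 g) ^ 2
        + (tiltMoment ω ν 1 1 0 g * tiltMoment ω ν 0 2 1 g) ^ 4)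
      + (((ENNReal.ofReal η * tiltMoment 1 ν 1 1 0 g) ^ 2
        + (ENNReal.ofReal η * tiltMoment 1 ν 1 1 0 g) ^ 4)
      + 2 * ‖e g‖ₑ ^ 2)))) := by
    intro g
    have he2 : ‖e g‖ₑ ^ 2 + ‖e g‖ₑ ^ 4 ≤ 2 * ‖e g‖ₑ ^ 2 := by
      rw [two_mul]
      refine add_le_add le_rfl ?_
      rw [enorm_norm_pow, enorm_norm_pow]
      exact ENNReal.ofReal_le_ofReal
        (pow_le_pow_of_le_one (norm_nonneg _) (he1 g) (by norm_num))
    have h16 : ∀ x y : ℝ≥0∞, x + 16 * y ≤ 16 * (x + y) := fun x y => by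
      rw [mul_add]
      gcongr
      exact le_mul_of_one_le_left (zero_le) (by norm_num)
    generalize hS1 : ENNReal.ofReal μ * ‖g‖ₑ = S1 at *
    have h := hwle g
    rw [hS1] at h
    generalize tiltMoment ω ν 1 2 1 g = S2 at *
    generalize tiltMoment ω ν 1 1 0 g * tiltMoment ω ν 0 2 1 g = S3 at *
    generalize ENNReal.ofReal η * tiltMoment 1 ν 1 1 0 g = S4 at *
    generalize ‖e g‖ₑ = S5 at *
    generalize hS : S1 + (S2 + (S3 + (S4 + S5))) = S at *
    calc ‖w g‖ₑ ^ 2 + ‖w g‖ₑ ^ 4 ≤ (ENNReal.ofReal (5 / 2) * S) ^ 2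
          + (ENNReal.ofReal (5 / 2) * S) ^ 4 := by gcongr
      _ ≤ 40 * (S ^ 2 + S ^ 4) := by
        rw [mul_pow, mul_pow, ← ENNReal.ofReal_pow (by norm_num),
          ← ENNReal.ofReal_pow (by norm_num), mul_add]
        refine add_le_add (mul_le_mul' ?_ le_rfl) (mul_le_mul' ?_ le_rfl) <;>
        · rw [show (40 : ℝ≥0∞) = ENNReal.ofReal 40 by simp]
          exact ENNReal.ofReal_le_ofReal (by norm_num)
      _ ≤ 40 * (16 * ((S1 ^ 2 + S1 ^ 4) + 16 * ((S2 ^ 2 + S2 ^ 4) + 16 * ((S3 ^ 2 + S3 ^ 4) +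
          16 * ((S4 ^ 2 + S4 ^ 4) + 2 * S5 ^ 2))))) := by
        rw [← hS]
        refine mul_le_mul' le_rfl ((sq_add_pow_four_add_le _ _).trans ?_)
        refine mul_le_mul' le_rfl (add_le_add le_rfl ((sq_add_pow_four_add_le _ _).trans ?_))
        refine mul_le_mul' le_rfl (add_le_add le_rfl ((sq_add_pow_four_add_le _ _).trans ?_))
        refine mul_le_mul' le_rfl (add_le_add le_rfl ((sq_add_pow_four_add_le _ _).trans ?_))
        exact mul_le_mul' le_rfl (add_le_add le_rfl he2)
      _ ≤ 40 * (16 * (16 * (16 * (16 * ((S1 ^ 2 + S1 ^ 4) + ((S2 ^ 2 + S2 ^ 4) +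
          ((S3 ^ 2 + S3 ^ 4) + ((S4 ^ 2 + S4 ^ 4) + 2 * S5 ^ 2)))))))) := by
        have a1 := h16 (S3 ^ 2 + S3 ^ 4) ((S4 ^ 2 + S4 ^ 4) + 2 * S5 ^ 2)
        generalize (S3 ^ 2 + S3 ^ 4) + 16 * ((S4 ^ 2 + S4 ^ 4) + 2 * S5 ^ 2) = Y3 at a1 ⊢
        generalize (S3 ^ 2 + S3 ^ 4) + ((S4 ^ 2 + S4 ^ 4) + 2 * S5 ^ 2) = X3 at a1 ⊢
        refine mul_le_mul' le_rfl (mul_le_mul' le_rfl ?_)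
        calc (S1 ^ 2 + S1 ^ 4) + 16 * ((S2 ^ 2 + S2 ^ 4) + 16 * Y3)
            ≤ (S1 ^ 2 + S1 ^ 4) + 16 * ((S2 ^ 2 + S2 ^ 4) + 16 * (16 * X3)) := by gcongr
          _ ≤ (S1 ^ 2 + S1 ^ 4) + 16 * (16 * ((S2 ^ 2 + S2 ^ 4) + 16 * X3)) := by
              gcongr; exact h16 _ _
          _ ≤ (S1 ^ 2 + S1 ^ 4) + 16 * (16 * (16 * ((S2 ^ 2 + S2 ^ 4) + X3))) := by
              gcongr; exact h16 _ _
          _ ≤ 16 * ((S1 ^ 2 + S1 ^ 4) + 16 * (16 * ((S2 ^ 2 + S2 ^ 4) + X3))) := h16 _ _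
          _ ≤ 16 * (16 * ((S1 ^ 2 + S1 ^ 4) + 16 * ((S2 ^ 2 + S2 ^ 4) + X3))) := by
              gcongr; exact h16 _ _
          _ ≤ _ := by gcongr; exact h16 _ _
      _ = _ := by ring
  have h_int : ∫⁻ g, (‖w g‖ₑ ^ 2 + ‖w g‖ₑ ^ 4) ∂(gaussOn E) ≤ 40 * 16 ^ 4 *
      (momentConst * (8 * ((∫⁻ x, ‖x‖ₑ ^ 6 ∂ν)
        + (ENNReal.ofReal μ ^ 2 * (Module.finrank ℝ E : ℝ≥0∞)
          + ENNReal.ofReal μ ^ 4 * (Module.finrank ℝ E : ℝ≥0∞) ^ 2 + ENNReal.ofReal η ^ 6)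
        + ∫⁻ g, ‖e g‖ₑ ^ 2 ∂(gaussOn E)))) := by
    refine (lintegral_mono hΦ).trans ?_
    rw [lintegral_const_mul _ (by fun_prop)]
    refine mul_le_mul' le_rfl ?_
    have b1 := lintegral_gauss_part_le (E := E) (μ := μ)
    have b2 := lintegral_tilt_part_le hν hω0 hω
    have b3 := lintegral_prod_part_le hν hω0 hω
    have b4 := lintegral_moment_part_le hν hη
    refine (lintegral_add_left (by fun_prop) _).le.trans ?_
    refine (add_le_add b1 ((lintegral_add_left (by fun_prop) _).le.trans
      (add_le_add b2 ((lintegral_add_left (by fun_prop) _).le.trans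
      (add_le_add b3 ((lintegral_add_left (by fun_prop) _).le.trans (add_le_add b4
      ((lintegral_const_mul _ (by fun_prop)).le.trans
      (le_mul_of_one_le_left zero_le one_le_momentConst))))))))).trans ?_
    rw [← mul_add, ← mul_add, ← mul_add, ← mul_add]
    refine mul_le_mul' le_rfl ?_
    generalize (∫⁻ x, ‖x‖ₑ ^ 6 ∂ν) = I
    generalize (∫⁻ g, ‖e g‖ₑ ^ 2 ∂(gaussOn E)) = J
    generalize ENNReal.ofReal μ ^ 2 * (Module.finrank ℝ E : ℝ≥0∞)
          + ENNReal.ofReal μ ^ 4 * (Module.finrank ℝ E : ℝ≥0∞) ^ 2 = m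
    generalize ENNReal.ofReal η ^ 6 = n
    calc m + (2 * I + (4 * I + (2 * I + n + 2 * J)))
        ≤ m + (2 * I + (4 * I + (2 * I + n + 2 * J))) + (7 * m + 7 * n + 6 * J) := le_self_add
      _ = _ := by ring
  have hI : ∀ I A : ℝ≥0∞, I ≤ A → mixtureConst * I
      + 2 * (40 * 16 ^ 4 * (momentConst * (8 * A))) ≤ normalizedConst * A := by
    intro I A hIA
    calc _ ≤ mixtureConst * A + 2 * (40 * 16 ^ 4 * (momentConst * (8 * A))) := by gcongr
      _ = _ := by rw [normalizedConst]; ring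
  refine (add_le_add le_rfl (mul_le_mul' le_rfl h_int)).trans (hI _ _ ?_)
  rw [add_assoc]
  exact le_self_add

end Normalized

section Scalar

variable {x S : ℝ}

theorem abs_exp_sub_cubic_le (hx : |x| ≤ 1) :
    |exp x - (1 + x + x ^ 2 / 2 + x ^ 3 / 6)| ≤ x ^ 4 * (5 / 96) := by
  have h := Real.exp_bound hx (n := 4) (by norm_num)
  have e : |x| ^ 4 = x ^ 4 := by rw [← abs_pow, abs_of_nonneg (by positivity)]
  rw [e] at h
  simp only [Finset.sum_range_succ, Finset.sum_range_zero, Nat.factorial] at h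
  norm_num at h
  convert h using 2

theorem abs_f1_sub_le (h0 : 0 < x) (hx : x ≤ 1 / 2) : |f1 x - x ^ 3 / 3| ≤ x ^ 4 := by
  have h1 := abs_exp_sub_cubic_le (x := x) (by rw [abs_of_pos h0]; linarith)
  have h2 := abs_exp_sub_cubic_le (x := 2 * x) (by rw [abs_of_pos (by linarith)]; linarith)
  rw [abs_le] at *
  unfold f1
  have : 0 < x ^ 4 := by positivity
  constructor <;> nlinarith

theorem abs_f2_sub_le (h0 : 0 < x) (hx : x ≤ 1 / 2) : |f2 x - x| ≤ 2 * x ^ 2 := by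
  have h2 := abs_exp_sub_cubic_le (x := 2 * x) (by rw [abs_of_pos (by linarith)]; linarith)
  rw [abs_le] at *
  unfold f2
  have : 0 < x ^ 2 := by positivity
  have : 0 < x ^ 3 := by positivity
  have : x ^ 3 ≤ x ^ 2 / 2 := by nlinarith
  have : x ^ 4 ≤ x ^ 2 / 4 := by nlinarith
  constructor <;> nlinarith

theorem abs_f3_sub_le (h0 : 0 < x) (hx : x ≤ 1 / 2) : |f3 x - x ^ 2 / 2| ≤ x ^ 3 := by
  have h1 := abs_exp_sub_cubic_le (x := x) (by rw [abs_of_pos h0]; linarith)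
  have h2 := abs_exp_sub_cubic_le (x := 2 * x) (by rw [abs_of_pos (by linarith)]; linarith)
  rw [abs_le] at *
  unfold f3
  have : 0 < x ^ 3 := by positivity
  have : x ^ 4 ≤ x ^ 3 / 2 := by nlinarith
  constructor <;> nlinarith

theorem abs_exp_sub_exp_neg_sub_le (h0 : 0 < x) (hx : x ≤ 1 / 2) :
    |exp x - exp (-x) - 2 * x| ≤ x ^ 3 := by
  have h1 := abs_exp_sub_cubic_le (x := x) (by rw [abs_of_pos h0]; linarith)
  have h2 := abs_exp_sub_cubic_le (x := -x) (by rw [abs_neg, abs_of_pos h0]; linarith)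
  rw [abs_le] at *
  have : 0 < x ^ 3 := by positivity
  have : x ^ 4 ≤ x ^ 3 / 2 := by nlinarith
  constructor <;> nlinarith

/-- Variance of the exact reverse transition given the posterior location. -/
def stepVar (x S : ℝ) : ℝ := 2 * f2 x - (exp x - exp (-x)) ^ 2 / S

/-- Normalized coefficient of the first Gaussian of the sampler. -/
def firstCoeff (x S : ℝ) : ℝ :=
  (zeta2 x - (exp x - exp (-x)) * zeta1 x / S) / √(stepVar x S)

/-- Normalized coefficient of the second Gaussian of the sampler. -/
def secondCoeff (x S : ℝ) : ℝ := zeta3 x / √(stepVar x S)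

/-- Normalized tilting strength seen by the intermediate score evaluation. -/
def tiltCoeff (x S : ℝ) : ℝ := zeta1 x * √(stepVar x S) / (exp x - exp (-x))

theorem stepVar_mem (h0 : 0 < x) (hS : 0 < S) (hS1 : S ≤ 1) (hxS : x ≤ S / 1000) :
    19 / 10 * x ≤ stepVar x S ∧ stepVar x S ≤ 21 / 10 * x := by
  have hx : x ≤ 1 / 1000 := by linarith
  have a2 := abs_f2_sub_le h0 (by linarith)
  have a4 := abs_exp_sub_exp_neg_sub_le h0 (by linarith)
  rw [abs_le] at a2 a4
  unfold stepVar
  set D := exp x - exp (-x)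
  have hx3 : x ^ 3 ≤ x / 100 := by nlinarith [sq_nonneg x]
  have hD : D ^ 2 ≤ 5 * x ^ 2 := by nlinarith
  have hDS : D ^ 2 / S ≤ x / 200 := by
    rw [div_le_iff₀ hS]; nlinarith
  have : 0 ≤ D ^ 2 / S := by positivity
  constructor <;> nlinarith

theorem f1_mem (h0 : 0 < x) (hx : x ≤ 1 / 1000) :
    33 / 100 * x ^ 3 ≤ f1 x ∧ f1 x ≤ 34 / 100 * x ^ 3 := by
  have a := abs_f1_sub_le h0 (by linarith)
  rw [abs_le] at a
  have : 0 < x ^ 3 := by positivity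
  have : x ^ 4 ≤ x ^ 3 / 1000 := by nlinarith
  constructor <;> nlinarith

theorem f3_mem (h0 : 0 < x) (hx : x ≤ 1 / 1000) :
    49 / 100 * x ^ 2 ≤ f3 x ∧ f3 x ≤ 51 / 100 * x ^ 2 := by
  have a := abs_f3_sub_le h0 (by linarith)
  rw [abs_le] at a
  have : 0 < x ^ 2 := by positivity
  have : x ^ 3 ≤ x ^ 2 / 1000 := by nlinarith
  constructor <;> nlinarith

theorem exp_sub_exp_neg_mem (h0 : 0 < x) (hx : x ≤ 1 / 1000) :
    199 / 100 * x ≤ exp x - exp (-x) ∧ exp x - exp (-x) ≤ 201 / 100 * x := by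
  have a := abs_exp_sub_exp_neg_sub_le h0 (by linarith)
  rw [abs_le] at a
  have : x ^ 3 ≤ x / 1000 := by nlinarith [sq_nonneg x]
  constructor <;> nlinarith

theorem abs_sq_sub_eight_f3_le (h0 : 0 < x) (hx : x ≤ 1 / 1000) :
    |(exp x - exp (-x)) ^ 2 - 8 * f3 x| ≤ 9 * x ^ 3 := by
  have a := abs_exp_sub_exp_neg_sub_le h0 (by linarith)
  have b := abs_f3_sub_le h0 (by linarith)
  set D := exp x - exp (-x)
  have hsq : |D ^ 2 - 4 * x ^ 2| ≤ x ^ 3 := by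
    have e : D ^ 2 - 4 * x ^ 2 = (D - 2 * x) * (D - 2 * x + 4 * x) := by ring
    rw [e, abs_mul]
    have h1 : |D - 2 * x + 4 * x| ≤ 1 := by
      have : x ^ 3 ≤ x / 1000 := by nlinarith [sq_nonneg x]
      rw [abs_le] at *
      constructor <;> linarith
    calc _ ≤ x ^ 3 * 1 := mul_le_mul a h1 (abs_nonneg _) (by positivity)
      _ = _ := mul_one _
  rw [abs_le] at *
  constructor <;> linarith

theorem zeta1_sq (h0 : 0 < x) (hx : x ≤ 1 / 1000) :
    zeta1 x ^ 2 = 8 * f1 x / (exp x - exp (-x)) ^ 2 := by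
  have hf := f1_mem h0 hx
  have : 0 ≤ f1 x := le_trans (by positivity) hf.1
  unfold zeta1
  rw [div_pow, mul_pow, mul_pow, sq_sqrt this, sq_sqrt (by norm_num)]
  norm_num

theorem zeta1_mul_zeta2 (h0 : 0 < x) (hx : x ≤ 1 / 1000) :
    zeta1 x * zeta2 x = 4 * f3 x / (exp x - exp (-x)) := by
  have hf := f1_mem h0 hx
  have : 0 < f1 x := lt_of_lt_of_le (by positivity) hf.1
  have hs : √(f1 x) ≠ 0 := (sqrt_pos.2 this).ne'
  have hD := exp_sub_exp_neg_mem h0 hx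
  have hD0 : exp x - exp (-x) ≠ 0 := by linarith
  unfold zeta1 zeta2
  field_simp
  rw [sq_sqrt (by norm_num)]
  ring

theorem zeta2_sq (h0 : 0 < x) (hx : x ≤ 1 / 1000) :
    zeta2 x ^ 2 = 2 * f3 x ^ 2 / f1 x := by
  have hf := f1_mem h0 hx
  have : 0 < f1 x := lt_of_lt_of_le (by positivity) hf.1
  unfold zeta2
  rw [div_pow, mul_pow, sq_sqrt this.le, sq_sqrt (by norm_num)]

theorem zeta1_nonneg (h0 : 0 < x) (hx : x ≤ 1 / 1000) : 0 ≤ zeta1 x := by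
  have hD := exp_sub_exp_neg_mem h0 hx
  unfold zeta1
  exact div_nonneg (by positivity) (by linarith)

theorem zeta1_sq_le (h0 : 0 < x) (hx : x ≤ 1 / 1000) : zeta1 x ^ 2 ≤ x := by
  have hf := f1_mem h0 hx
  have hD := exp_sub_exp_neg_mem h0 hx
  rw [zeta1_sq h0 hx, div_le_iff₀ (by nlinarith)]
  have : 3 * x ^ 2 ≤ (exp x - exp (-x)) ^ 2 := by nlinarith
  nlinarith [pow_pos h0 3]

theorem zeta2_sq_mem (h0 : 0 < x) (hx : x ≤ 1 / 1000) :
    14 / 10 * x ≤ zeta2 x ^ 2 ∧ zeta2 x ^ 2 ≤ 158 / 100 * x := by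
  have hf := f1_mem h0 hx
  have hf0 : 0 < f1 x := lt_of_lt_of_le (by positivity) hf.1
  have h3 := f3_mem h0 hx
  have hx3 := pow_pos h0 3
  rw [zeta2_sq h0 hx, le_div_iff₀ hf0, div_le_iff₀ hf0]
  have l : (49 / 100 * x ^ 2) ^ 2 ≤ f3 x ^ 2 := by gcongr; exact h3.1
  have u : f3 x ^ 2 ≤ (51 / 100 * x ^ 2) ^ 2 := by
    have : 0 ≤ f3 x := le_trans (by positivity) h3.1
    gcongr; exact h3.2
  have e : x * x ^ 3 = x ^ 4 := by ring
  have hx4 := pow_pos h0 4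
  constructor
  · nlinarith [mul_le_mul_of_nonneg_left hf.2 h0.le]
  · nlinarith [mul_le_mul_of_nonneg_left hf.1 h0.le]

theorem zeta3_sq_mem (h0 : 0 < x) (hx : x ≤ 1 / 1000) :
    zeta3 x ^ 2 = 2 * f2 x - zeta2 x ^ 2 ∧
    38 / 100 * x ≤ zeta3 x ^ 2 ∧ zeta3 x ^ 2 ≤ 65 / 100 * x := by
  have a2 := abs_f2_sub_le h0 (by linarith)
  rw [abs_le] at a2
  have hz := zeta2_sq_mem h0 hx
  have hx2 : x ^ 2 ≤ x / 1000 := by nlinarith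
  have e : zeta3 x ^ 2 = 2 * f2 x - zeta2 x ^ 2 := by
    rw [zeta3, ← zeta2_sq h0 hx, sq_sqrt]
    linarith
  refine ⟨e, ?_, ?_⟩ <;> rw [e] <;> linarith

theorem secondCoeff_sq_mem (h0 : 0 < x) (hS : 0 < S) (hS1 : S ≤ 1) (hxS : x ≤ S / 1000) :
    18 / 100 ≤ secondCoeff x S ^ 2 ∧ secondCoeff x S ^ 2 ≤ 35 / 100 := by
  have hv := stepVar_mem h0 hS hS1 hxS
  have hz := zeta3_sq_mem h0 (by linarith)
  have hv0 : 0 < stepVar x S := by linarith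
  rw [secondCoeff, div_pow, sq_sqrt hv0.le, le_div_iff₀ hv0, div_le_iff₀ hv0]
  constructor <;> linarith

theorem two_fifths_le_secondCoeff (h0 : 0 < x) (hS : 0 < S) (hS1 : S ≤ 1)
    (hxS : x ≤ S / 1000) : 2 / 5 ≤ secondCoeff x S := by
  have h := secondCoeff_sq_mem h0 hS hS1 hxS
  have : 0 ≤ secondCoeff x S := div_nonneg (sqrt_nonneg _) (sqrt_nonneg _)
  nlinarith

theorem firstCoeff_sq_add_secondCoeff_sq (h0 : 0 < x) (hS : 0 < S) (hS1 : S ≤ 1)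
    (hxS : x ≤ S / 1000) :
    |firstCoeff x S ^ 2 + secondCoeff x S ^ 2 - 1| ≤ 8 * (x / S) ^ 2 := by
  have hx : x ≤ 1 / 1000 := by linarith
  have hv := stepVar_mem h0 hS hS1 hxS
  have hv0 : 0 < stepVar x S := by linarith
  have hf := f1_mem h0 hx
  have hD := exp_sub_exp_neg_mem h0 hx
  have hd := abs_sq_sub_eight_f3_le h0 hx
  set D := exp x - exp (-x) with hDdef
  have hD0 : D ≠ 0 := by linarith
  have e : firstCoeff x S ^ 2 + secondCoeff x S ^ 2 - 1
      = ((D ^ 2 - 8 * f3 x) / S + 8 * f1 x / S ^ 2) / stepVar x S := by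
    rw [firstCoeff, secondCoeff, div_pow, div_pow, sq_sqrt hv0.le, ← add_div, eq_div_iff hv0.ne',
      sub_mul, div_mul_cancel₀ _ hv0.ne', one_mul, (zeta3_sq_mem h0 hx).1, stepVar, ← hDdef]
    have e1 : (zeta2 x - D * zeta1 x / S) ^ 2
        = zeta2 x ^ 2 - 2 * D * (zeta1 x * zeta2 x) / S + D ^ 2 * zeta1 x ^ 2 / S ^ 2 := by ring
    rw [e1, zeta1_sq h0 hx, zeta1_mul_zeta2 h0 hx, ← hDdef]
    field_simp
    ring
  have hx3 := pow_pos h0 3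
  rw [e, abs_div, abs_of_pos hv0, div_le_iff₀ hv0]
  have b1 : |(D ^ 2 - 8 * f3 x) / S| ≤ 9 * x ^ 3 / S ^ 2 := by
    rw [abs_div, abs_of_pos hS, div_le_div_iff₀ hS (by positivity)]
    calc |D ^ 2 - 8 * f3 x| * S ^ 2 ≤ 9 * x ^ 3 * S ^ 2 := by gcongr
      _ ≤ 9 * x ^ 3 * S := by
        have : S ^ 2 ≤ S := by nlinarith
        gcongr
  have b2 : |8 * f1 x / S ^ 2| ≤ 3 * x ^ 3 / S ^ 2 := by
    rw [abs_of_nonneg (by have : 0 ≤ f1 x := le_trans (by positivity) hf.1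
                          positivity)]
    refine div_le_div_of_nonneg_right ?_ (by positivity)
    linarith
  calc _ ≤ 9 * x ^ 3 / S ^ 2 + 3 * x ^ 3 / S ^ 2 := (abs_add_le _ _).trans (add_le_add b1 b2)
    _ = 8 * (x / S) ^ 2 * (15 / 10 * x) := by ring
    _ ≤ _ := by gcongr; linarith

theorem firstCoeff_nonneg (h0 : 0 < x) (hS : 0 < S) (hS1 : S ≤ 1)
    (hxS : x ≤ S / 1000) : 0 ≤ firstCoeff x S := by
  have hx : x ≤ 1 / 1000 := by linarith
  have hf := f1_mem h0 hx
  have hf0 : 0 < f1 x := lt_of_lt_of_le (by positivity) hf.1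
  have h3 := f3_mem h0 hx
  have hD := exp_sub_exp_neg_mem h0 hx
  set D := exp x - exp (-x) with hDdef
  have hD0 : D ≠ 0 := by linarith
  refine div_nonneg ?_ (sqrt_nonneg _)
  rw [sub_nonneg, zeta1, zeta2, ← hDdef, le_div_iff₀ (sqrt_pos.2 hf0)]
  have e : D * (2 * √2 * √(f1 x) / D) / S * √(f1 x) = √2 * (2 * f1 x / S) := by
    have : f1 x = √(f1 x) * √(f1 x) := (mul_self_sqrt hf0.le).symm
    field_simp
    linarith [this]
  rw [e]
  gcongr
  rw [div_le_iff₀ hS]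
  have hx2 := pow_pos h0 2
  have : x ^ 3 ≤ x ^ 2 * S / 1000 := by nlinarith
  nlinarith

/-- The exact first coefficient completing `secondCoeff` to a unit vector. -/
def exactCoeff (x S : ℝ) : ℝ := √(1 - secondCoeff x S ^ 2)

theorem exactCoeff_sq_add (h0 : 0 < x) (hS : 0 < S) (hS1 : S ≤ 1) (hxS : x ≤ S / 1000) :
    exactCoeff x S ^ 2 + secondCoeff x S ^ 2 = 1 := by
  have h := secondCoeff_sq_mem h0 hS hS1 hxS
  rw [exactCoeff, sq_sqrt (by linarith)]
  ring

theorem exactCoeff_mem (h0 : 0 < x) (hS : 0 < S) (hS1 : S ≤ 1)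
    (hxS : x ≤ S / 1000) : 4 / 5 ≤ exactCoeff x S ∧ exactCoeff x S ≤ 1 := by
  have h := secondCoeff_sq_mem h0 hS hS1 hxS
  have h' := exactCoeff_sq_add h0 hS hS1 hxS
  have : 0 ≤ exactCoeff x S := sqrt_nonneg _
  constructor <;> nlinarith

theorem abs_firstCoeff_sub_exactCoeff_le (h0 : 0 < x) (hS : 0 < S) (hS1 : S ≤ 1)
    (hxS : x ≤ S / 1000) : |firstCoeff x S - exactCoeff x S| ≤ 10 * (x / S) ^ 2 := by
  have h := firstCoeff_sq_add_secondCoeff_sq h0 hS hS1 hxS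
  have h' := exactCoeff_sq_add h0 hS hS1 hxS
  have hc := exactCoeff_mem h0 hS hS1 hxS
  have hf := firstCoeff_nonneg h0 hS hS1 hxS
  have e : firstCoeff x S ^ 2 + secondCoeff x S ^ 2 - 1
      = (firstCoeff x S - exactCoeff x S) * (firstCoeff x S + exactCoeff x S) := by
    linear_combination h'
  rw [e, abs_mul, abs_of_nonneg (add_nonneg hf (by linarith))] at h
  nlinarith [abs_nonneg (firstCoeff x S - exactCoeff x S)]

theorem tiltCoeff_mem (h0 : 0 < x) (hS : 0 < S) (hS1 : S ≤ 1)
    (hxS : x ≤ S / 1000) : 0 ≤ tiltCoeff x S ∧ tiltCoeff x S ≤ 1 := by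
  have hx : x ≤ 1 / 1000 := by linarith
  have hv := stepVar_mem h0 hS hS1 hxS
  have hD := exp_sub_exp_neg_mem h0 hx
  have h1 := zeta1_sq_le h0 hx
  have h1' := zeta1_nonneg h0 hx
  unfold tiltCoeff
  refine ⟨div_nonneg (mul_nonneg h1' (sqrt_nonneg _)) (by linarith), ?_⟩
  rw [div_le_one (by linarith)]
  refine abs_le_of_sq_le_sq' ?_ (by linarith) |>.2
  rw [mul_pow, sq_sqrt (by linarith)]
  calc zeta1 x ^ 2 * stepVar x S ≤ x * (21 / 10 * x) := by
        gcongr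
        · linarith
        · linarith
    _ ≤ (199 / 100 * x) ^ 2 := by nlinarith
    _ ≤ _ := by gcongr; linarith

theorem abs_tiltCoeff_sub_le (h0 : 0 < x) (hS : 0 < S) (hS1 : S ≤ 1)
    (hxS : x ≤ S / 1000) : |tiltCoeff x S - 1 / (2 * exactCoeff x S)| ≤ 10 * (x / S) := by
  have hx : x ≤ 1 / 1000 := by linarith
  have hv := stepVar_mem h0 hS hS1 hxS
  have hv0 : 0 < stepVar x S := by linarith
  have hf := f1_mem h0 hx
  have hD := exp_sub_exp_neg_mem h0 hx
  have hd := abs_sq_sub_eight_f3_le h0 hx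
  have hc := exactCoeff_mem h0 hS hS1 hxS
  have hω := tiltCoeff_mem h0 hS hS1 hxS
  have hμ := abs_firstCoeff_sub_exactCoeff_le h0 hS hS1 hxS
  have hh : x / S ≤ 1 / 1000 := by rw [div_le_iff₀ hS]; linarith
  have hh0 : 0 < x / S := by positivity
  set D := exp x - exp (-x) with hDdef
  have hD0 : D ≠ 0 := by linarith
  have hD2 : 3 * x ^ 2 ≤ D ^ 2 := by nlinarith
  have hx3 := pow_pos h0 3
  have e : 2 * firstCoeff x S * tiltCoeff x S - 1
      = -(((D ^ 2 - 8 * f3 x) + 16 * f1 x / S) / D ^ 2) := by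
    have hs : √(stepVar x S) ≠ 0 := (sqrt_pos.2 hv0).ne'
    have e1 : 2 * firstCoeff x S * tiltCoeff x S
        = 2 * (zeta1 x * zeta2 x) / D - 2 * zeta1 x ^ 2 / S := by
      rw [firstCoeff, tiltCoeff, ← hDdef]
      field_simp
    rw [e1, zeta1_sq h0 hx, zeta1_mul_zeta2 h0 hx, ← hDdef]
    field_simp
    ring
  have b : |2 * firstCoeff x S * tiltCoeff x S - 1| ≤ 6 * (x / S) := by
    rw [e, abs_neg, abs_div, abs_of_nonneg (sq_nonneg D), div_le_iff₀ (by nlinarith)]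
    have b2 : |16 * f1 x / S| ≤ 6 * x ^ 3 / S := by
      rw [abs_of_nonneg (by have : 0 ≤ f1 x := le_trans (by positivity) hf.1
                            positivity)]
      refine div_le_div_of_nonneg_right ?_ hS.le
      linarith
    have b1 : 9 * x ^ 3 ≤ 9 * x ^ 3 / S := by
      rw [le_div_iff₀ hS]; nlinarith
    calc _ ≤ 9 * x ^ 3 / S + 6 * x ^ 3 / S :=
          (abs_add_le _ _).trans (add_le_add (hd.trans b1) b2)
      _ ≤ 6 * (x / S) * (3 * x ^ 2) := by
          have : 9 * x ^ 3 / S + 6 * x ^ 3 / S = 15 * (x / S) * x ^ 2 := by ring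
          rw [this]
          nlinarith [pow_pos h0 2, mul_pos hh0 (pow_pos h0 2)]
      _ ≤ _ := by gcongr
  have e2 : tiltCoeff x S - 1 / (2 * exactCoeff x S) = ((2 * firstCoeff x S * tiltCoeff x S - 1)
      - 2 * tiltCoeff x S * (firstCoeff x S - exactCoeff x S)) / (2 * exactCoeff x S) := by
    have : exactCoeff x S ≠ 0 := by linarith
    field_simp
    ring
  rw [e2, abs_div, abs_of_pos (by linarith : 0 < 2 * exactCoeff x S), div_le_iff₀ (by linarith)]
  have b3 : |2 * tiltCoeff x S * (firstCoeff x S - exactCoeff x S)| ≤ x / S := by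
    rw [abs_mul, abs_of_nonneg (by linarith)]
    calc _ ≤ 2 * 1 * (10 * (x / S) ^ 2) := by gcongr; exact hω.2
      _ ≤ _ := by nlinarith
  have b4 := (abs_sub _ _).trans (add_le_add b b3)
  nlinarith

end Scalar

section Posterior

variable {E : Type*} [NormedAddCommGroup E] [InnerProductSpace ℝ E] [FiniteDimensional ℝ E]
  [MeasurableSpace E] [BorelSpace E] {q : Measure E} [IsProbabilityMeasure q] {l σ r : ℝ}

/-- Log-likelihood of `θ` given the observation `y = l • θ + σ • g`, up to a term depending
on `y` only. -/
def logLik (l σ : ℝ) (y θ : E) : ℝ := l / σ ^ 2 * ⟪y, θ⟫_ℝ - l ^ 2 / (2 * σ ^ 2) * ‖θ‖ ^ 2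

/-- The density of the law of `l • θ + σ • g` with respect to the law of `σ • g`. -/
def evidence (l σ : ℝ) (q : Measure E) (y : E) : ℝ := ∫ θ, exp (logLik l σ y θ) ∂q

@[fun_prop]
theorem continuous_logLik : Continuous fun p : E × E => logLik l σ p.1 p.2 := by
  unfold logLik
  fun_prop

@[fun_prop]
theorem continuous_logLik_right (y : E) : Continuous (logLik l σ y) :=
  continuous_logLik.comp (by fun_prop : Continuous fun θ : E => (y, θ))

@[fun_prop]
theorem measurable_evidence : Measurable (evidence l σ q) := by
  refine StronglyMeasurable.measurable ?_
  refine StronglyMeasurable.integral_prod_right (f := fun y θ => exp (logLik l σ y θ)) ?_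
  exact (by fun_prop : Continuous fun p : E × E => exp (logLik l σ p.1 p.2)).stronglyMeasurable

/-- The posterior law of `θ ~ q` given the observation `y = l • θ + σ • g`. -/
def postKernel (l σ : ℝ) (q : Measure E) [IsProbabilityMeasure q] : Kernel E E where
  toFun y := q.tilted (logLik l σ y)
  measurable' := by
    refine Measure.measurable_of_measurable_coe _ fun s hs => ?_
    simp_rw [tilted_apply' _ _ hs]
    refine Measurable.lintegral_prod_right' (f := fun p : E × E =>
      ENNReal.ofReal (exp (logLik l σ p.1 p.2) / evidence l σ q p.1)) ?_
    refine ENNReal.measurable_ofReal.comp (Measurable.div ?_ ?_)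
    · exact (by fun_prop : Continuous fun p : E × E => exp (logLik l σ p.1 p.2)).measurable
    · exact measurable_evidence.comp measurable_fst

theorem postKernel_apply (y : E) : postKernel l σ q y = q.tilted (logLik l σ y) := rfl

theorem integrable_exp_logLik (hq : ∀ᵐ θ ∂q, ‖θ‖ ≤ r) (y : E) :
    Integrable (fun θ => exp (logLik l σ y θ)) q :=
  integrable_of_continuous_of_ae_norm_le hq (by fun_prop)

theorem evidence_pos (hq : ∀ᵐ θ ∂q, ‖θ‖ ≤ r) (y : E) : 0 < evidence l σ q y :=
  integral_exp_pos (integrable_exp_logLik hq y)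

theorem isMarkovKernel_postKernel (hq : ∀ᵐ θ ∂q, ‖θ‖ ≤ r) : IsMarkovKernel (postKernel l σ q) :=
  ⟨fun y => isProbabilityMeasure_tilted (integrable_exp_logLik hq y)⟩

theorem ae_norm_le_postKernel (hq : ∀ᵐ θ ∂q, ‖θ‖ ≤ r) (y : E) :
    ∀ᵐ θ ∂(postKernel l σ q y), ‖θ‖ ≤ r :=
  tilted_absolutelyContinuous q _ hq

/-- The posterior mean. -/
def postMean (l σ : ℝ) (q : Measure E) [IsProbabilityMeasure q] (y : E) : E :=
  ∫ θ, θ ∂(postKernel l σ q y)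

theorem postMean_eq (y : E) :
    postMean l σ q y = (evidence l σ q y)⁻¹ • ∫ θ, exp (logLik l σ y θ) • θ ∂q := by
  rw [postMean, postKernel_apply, integral_tilted, ← integral_smul]
  refine integral_congr_ae (.of_forall fun θ => ?_)
  simp only [smul_smul, evidence]
  congr 1
  ring

@[fun_prop]
theorem measurable_postMean : Measurable (postMean l σ q) := by
  have : postMean l σ q
      = fun y => (evidence l σ q y)⁻¹ • ∫ θ, exp (logLik l σ y θ) • θ ∂q :=
    funext postMean_eq
  rw [this]
  refine Measurable.smul (by fun_prop) (StronglyMeasurable.measurable ?_)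
  refine StronglyMeasurable.integral_prod_right (f := fun y θ => exp (logLik l σ y θ) • θ) ?_
  exact (by fun_prop : Continuous fun p : E × E => exp (logLik l σ p.1 p.2) • p.2).stronglyMeasurable

theorem postKernel_add (hq : ∀ᵐ θ ∂q, ‖θ‖ ≤ r) (y ξ : E) :
    postKernel l σ q (y + ξ) = (postKernel l σ q y).tilted fun θ => l / σ ^ 2 * ⟪θ, ξ⟫_ℝ := by
  rw [postKernel_apply, postKernel_apply, tilted_tilted (integrable_exp_logLik hq y)]
  congr 1
  funext θ
  simp only [logLik, Pi.add_apply, inner_add_left, real_inner_comm θ ξ]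
  ring

theorem tiltMean_map_smul_sub {P : Measure E} [IsProbabilityMeasure P]
    (hP : ∀ᵐ θ ∂P, ‖θ‖ ≤ r) (ω β : ℝ) (m g : E) :
    tiltMean ω (P.map fun θ => β • (θ - m)) g
      = β • (∫ θ, θ ∂(P.tilted fun θ => ω * β * ⟪θ, g⟫_ℝ) - m) := by
  have hI : Integrable (fun θ => exp (ω * β * ⟪θ, g⟫_ℝ)) P :=
    integrable_of_continuous_of_ae_norm_le hP (by fun_prop)
  have hI' : Integrable (fun θ => exp (ω * β * ⟪θ, g⟫_ℝ) • θ) P :=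
    integrable_of_continuous_of_ae_norm_le hP (by fun_prop)
  set Z := ∫ θ, exp (ω * β * ⟪θ, g⟫_ℝ) ∂P with hZ
  have hZ0 : Z ≠ 0 := (integral_exp_pos hI).ne'
  set A := exp (-(ω * β * ⟪m, g⟫_ℝ)) with hA
  have hA0 : A ≠ 0 := (exp_pos _).ne'
  have he : ∀ θ : E, exp (ω * ⟪β • (θ - m), g⟫_ℝ) = A * exp (ω * β * ⟪θ, g⟫_ℝ) := by
    intro θ
    rw [hA, ← exp_add, real_inner_smul_left, inner_sub_left]
    congr 1
    ring
  rw [tiltMean, integral_map (by fun_prop) (by fun_prop), integral_map (by fun_prop) (by fun_prop)]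
  simp_rw [he]
  rw [integral_const_mul, ← hZ, integral_tilted]
  have h1 : ∀ θ : E, (A * exp (ω * β * ⟪θ, g⟫_ℝ)) • β • (θ - m)
      = (A * β) • (exp (ω * β * ⟪θ, g⟫_ℝ) • θ - exp (ω * β * ⟪θ, g⟫_ℝ) • m) := by
    intro θ; module
  have h2 : ∀ θ : E, (exp (ω * β * ⟪θ, g⟫_ℝ) / ∫ x, exp (ω * β * ⟪x, g⟫_ℝ) ∂P) • θ
      = Z⁻¹ • (exp (ω * β * ⟪θ, g⟫_ℝ) • θ) := by
    intro θ; rw [← hZ, smul_smul]; congr 1; ring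
  simp_rw [h1, h2]
  rw [integral_smul, integral_smul, integral_sub hI' (hI.smul_const m), integral_smul_const, ← hZ]
  have h3 : ∀ J : E, (A * Z)⁻¹ • (A * β) • (J - Z • m)
      = ((A * Z)⁻¹ * (A * β)) • J - ((A * Z)⁻¹ * (A * β) * Z) • m := by intro J; module
  have h4 : ∀ J : E, β • (Z⁻¹ • J - m) = (β * Z⁻¹) • J - β • m := by intro J; module
  rw [h3, h4]
  congr 2
  · field_simp
  · field_simp

theorem tiltMean_postKernel (hq : ∀ᵐ θ ∂q, ‖θ‖ ≤ r) {ω β z : ℝ} (h : ω * β = l / σ ^ 2 * z)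
    (y g : E) :
    tiltMean ω ((postKernel l σ q y).map fun θ => β • (θ - postMean l σ q y)) g
      = β • (postMean l σ q (y + z • g) - postMean l σ q y) := by
  have := isMarkovKernel_postKernel (l := l) (σ := σ) hq
  rw [tiltMean_map_smul_sub (ae_norm_le_postKernel hq y)]
  congr 2
  conv_rhs => rw [postMean, postKernel_add hq]
  congr 2
  funext θ
  rw [h, real_inner_smul_right]
  ring

/-- Bayes' rule for the pair `(θ, l • θ + σ • g)`. -/
theorem lintegral_bayes_gaussOn (hq : ∀ᵐ θ ∂q, ‖θ‖ ≤ r) (hσ : 0 < σ) {G : E × E → ℝ≥0∞}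
    (hG : Measurable G) :
    ∫⁻ θ, ∫⁻ g, G (θ, l • θ + σ • g) ∂(gaussOn E) ∂q
      = ∫⁻ g, ENNReal.ofReal (evidence l σ q (σ • g))
          * ∫⁻ θ, G (θ, σ • g) ∂(postKernel l σ q (σ • g)) ∂(gaussOn E) := by
  have h1 : ∀ θ : E, ∫⁻ g, G (θ, l • θ + σ • g) ∂(gaussOn E)
      = ∫⁻ g, ENNReal.ofReal (exp (logLik l σ (σ • g) θ)) * G (θ, σ • g) ∂(gaussOn E) := by
    intro θ
    have := lintegral_gaussOn_add (E := E) (F := fun g => G (θ, σ • g)) (by fun_prop)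
      ((l / σ) • θ)
    have e1 : ∀ g : E, σ • (g + (l / σ) • θ) = l • θ + σ • g := by
      intro g
      rw [smul_add, smul_smul, mul_div_cancel₀ _ hσ.ne', add_comm]
    simp_rw [e1] at this
    rw [this]
    refine lintegral_congr fun g => ?_
    congr 3
    rw [logLik, real_inner_smul_right, real_inner_smul_left, norm_smul, norm_eq_abs, mul_pow,
      sq_abs]
    field_simp
  simp_rw [h1]
  have hm : Measurable fun p : E × E =>
      ENNReal.ofReal (exp (logLik l σ (σ • p.2) p.1)) * G (p.1, σ • p.2) := by
    refine Measurable.mul (ENNReal.measurable_ofReal.comp ?_) (by fun_prop)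
    exact (continuous_exp.comp (continuous_logLik.comp
      (by fun_prop : Continuous fun p : E × E => (σ • p.2, p.1)))).measurable
  rw [lintegral_lintegral_swap hm.aemeasurable]
  refine lintegral_congr fun g => ?_
  rw [postKernel_apply, lintegral_tilted, ← lintegral_const_mul _ ?_]
  · refine lintegral_congr fun θ => ?_
    rw [← mul_assoc, ← ENNReal.ofReal_mul (evidence_pos hq _).le]
    congr 2
    exact (mul_div_cancel₀ _ (evidence_pos hq _).ne').symm
  · fun_prop

theorem lintegral_bayes (hq : ∀ᵐ θ ∂q, ‖θ‖ ≤ r) (hσ : 0 < σ) {G : E × E → ℝ≥0∞}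
    (hG : Measurable G) :
    ∫⁻ θ, ∫⁻ g, G (θ, l • θ + σ • g) ∂(gaussOn E) ∂q
      = ∫⁻ y, ∫⁻ θ, G (θ, y) ∂(postKernel l σ q y)
          ∂((q.prod (gaussOn E)).map fun p => l • p.1 + σ • p.2) := by
  have := isMarkovKernel_postKernel (l := l) (σ := σ) hq
  have hGm : Measurable fun y => ∫⁻ θ, G (θ, y) ∂(postKernel l σ q y) :=
    Measurable.lintegral_kernel_prod_right' (f := fun p : E × E => G (p.2, p.1)) (by fun_prop)
  rw [lintegral_map hGm (by fun_prop),
    lintegral_prod (fun a : E × E => ∫⁻ θ, G (θ, l • a.1 + σ • a.2)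
      ∂(postKernel l σ q (l • a.1 + σ • a.2)))
      (hGm.comp (g := fun y => ∫⁻ θ, G (θ, y) ∂(postKernel l σ q y)) (by fun_prop)).aemeasurable]
  have h := lintegral_bayes_gaussOn (l := l) (σ := σ) hq hσ
    (G := fun p => ∫⁻ θ, G (θ, p.2) ∂(postKernel l σ q p.2)) (hGm.comp measurable_snd)
  simp only at h
  rw [h, lintegral_bayes_gaussOn hq hσ hG]
  simp

/-- The density of `l • θ + σ • g`. -/
theorem map_smul_add_smul_eq_withDensity (hq : ∀ᵐ θ ∂q, ‖θ‖ ≤ r) (hσ : 0 < σ) :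
    (q.prod (gaussOn E)).map (fun p => l • p.1 + σ • p.2)
      = volume.withDensity fun y => ENNReal.ofReal
        ((σ ^ Module.finrank ℝ E)⁻¹ * gaussDensity (σ⁻¹ • y) * evidence l σ q y) := by
  have := isMarkovKernel_postKernel (l := l) (σ := σ) hq
  refine Measure.ext_of_lintegral _ fun F hF => ?_
  rw [lintegral_map hF (by fun_prop), lintegral_prod _ (by fun_prop)]
  have h := lintegral_bayes_gaussOn (l := l) (σ := σ) hq hσ
    (G := fun p => F p.2) (by fun_prop)
  simp only [lintegral_const, measure_univ, mul_one] at h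
  rw [h, lintegral_gaussOn (by fun_prop),
    lintegral_withDensity_eq_lintegral_mul _ (by fun_prop) hF]
  have e : ∫⁻ x, ENNReal.ofReal (gaussDensity x) *
        (ENNReal.ofReal (evidence l σ q (σ • x)) * F (σ • x))
      = ∫⁻ y, ENNReal.ofReal (gaussDensity (σ⁻¹ • y)) *
        (ENNReal.ofReal (evidence l σ q y) * F y) ∂(volume.map fun x : E => σ • x) := by
    rw [lintegral_map (by fun_prop) (by fun_prop)]
    simp_rw [inv_smul_smul₀ hσ.ne']
  rw [e, Measure.map_addHaar_smul _ hσ.ne', lintegral_smul_measure, smul_eq_mul,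
    ← lintegral_const_mul _ (by fun_prop)]
  refine lintegral_congr fun y => ?_
  rw [abs_of_nonneg (by positivity), Pi.mul_apply,
    ENNReal.ofReal_mul (mul_nonneg (by positivity) (gaussDensity_pos _).le),
    ENNReal.ofReal_mul (by positivity)]
  ring

theorem hasFDerivAt_logLik (y θ : E) :
    HasFDerivAt (fun y => exp (logLik l σ y θ))
      (innerSL ℝ ((l / σ ^ 2 * exp (logLik l σ y θ)) • θ)) y := by
  have h : HasFDerivAt (fun y => logLik l σ y θ) ((l / σ ^ 2) • innerSL ℝ θ) y := by
    unfold logLik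
    have := (innerSL ℝ θ).hasFDerivAt (x := y)
    refine ((this.const_mul (l / σ ^ 2)).sub_const
      (l ^ 2 / (2 * σ ^ 2) * ‖θ‖ ^ 2)).congr_of_eventuallyEq
      (.of_forall fun z => ?_)
    simp [real_inner_comm]
  refine h.exp.congr_fderiv ?_
  rw [map_smul, smul_smul, mul_comm]

theorem hasGradientAt_evidence (hq : ∀ᵐ θ ∂q, ‖θ‖ ≤ r) (y : E) :
    HasGradientAt (evidence l σ q)
      ((l / σ ^ 2) • ∫ θ, exp (logLik l σ y θ) • θ ∂q) y := by
  have : ProperSpace E := FiniteDimensional.proper_real E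
  have hcont : Continuous fun p : E × E => (l / σ ^ 2 * exp (logLik l σ p.1 p.2)) • p.2 := by
    fun_prop
  obtain ⟨C, hC⟩ := ((isCompact_closedBall y 1).prod
    (isCompact_closedBall (0 : E) r)).exists_bound_of_continuousOn hcont.continuousOn
  have key := hasFDerivAt_integral_of_dominated_of_fderiv_le (μ := q) (𝕜 := ℝ)
    (F := fun y θ => exp (logLik l σ y θ))
    (F' := fun y θ => innerSL ℝ ((l / σ ^ 2 * exp (logLik l σ y θ)) • θ)) (bound := fun _ => C)
    (Metric.closedBall_mem_nhds y one_pos)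
    (.of_forall fun z => (by fun_prop : Continuous _).aestronglyMeasurable)
    (integrable_exp_logLik hq y)
    ((by fun_prop : Continuous _).aestronglyMeasurable)
    (hq.mono fun θ hθ z hz => by
      rw [innerSL_apply_norm]
      exact hC (z, θ) ⟨hz, by simpa using hθ⟩)
    (integrable_const _)
    (.of_forall fun θ z _ => hasFDerivAt_logLik z θ)
  rw [hasGradientAt_iff_hasFDerivAt]
  refine key.congr_fderiv ?_
  have h_int : Integrable (fun θ => (l / σ ^ 2 * exp (logLik l σ y θ)) • θ) q :=
    integrable_of_continuous_of_ae_norm_le hq (by fun_prop)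
  rw [ContinuousLinearMap.integral_comp_comm (innerSL ℝ) h_int, ← integral_smul]
  simp_rw [smul_smul]
  rfl

/-- Tweedie's formula. -/
theorem gradient_log_density (hq : ∀ᵐ θ ∂q, ‖θ‖ ≤ r) {c : ℝ} (hc : 0 < c) (y : E) :
    gradient (fun y => log (c * gaussDensity (σ⁻¹ • y) * evidence l σ q y)) y
      = (l / σ ^ 2) • postMean l σ q y - (1 / σ ^ 2) • y := by
  have hG : HasGradientAt (fun y : E => -‖σ⁻¹ • y‖ ^ 2 / 2) (-((1 / σ ^ 2) • y)) y := by
    rw [hasGradientAt_iff_hasFDerivAt]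
    have h1 := (hasStrictFDerivAt_norm_sq y).hasFDerivAt.const_mul (-(σ⁻¹ ^ 2) / 2)
    refine (h1.congr_of_eventuallyEq (.of_forall fun z => ?_)).congr_fderiv ?_
    · simp only [norm_smul, norm_eq_abs, mul_pow, sq_abs]
      ring
    · ext z
      simp
      ring
  have hZ := hasGradientAt_evidence (l := l) (σ := σ) hq y
  rw [hasGradientAt_iff_hasFDerivAt] at hZ hG
  have hlog := hZ.log (evidence_pos hq y).ne'
  have h := (hG.add hlog).const_add (log (c * (2 * π) ^ (-(Module.finrank ℝ E / 2 : ℝ))))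
  refine HasGradientAt.gradient ?_
  rw [hasGradientAt_iff_hasFDerivAt]
  refine (h.congr_of_eventuallyEq (.of_forall fun z => ?_)).congr_fderiv ?_
  · have := evidence_pos (l := l) (σ := σ) hq z
    rw [gaussDensity, ← mul_assoc, log_mul (by positivity) this.ne',
      log_mul (by positivity) (by positivity), log_exp]
    simp [add_assoc]
  · rw [postMean_eq]
    ext z
    simp
    ring

end Posterior

section Reverse

variable {E : Type*} [NormedAddCommGroup E] [InnerProductSpace ℝ E] [FiniteDimensional ℝ E]
  [MeasurableSpace E] [BorelSpace E] {q : Measure E} [IsProbabilityMeasure q] {l σ r : ℝ}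

/-- The law of `l • θ + σ • g` with `θ ~ q` and `g` standard Gaussian. -/
def noised (l σ : ℝ) (q : Measure E) : Measure E :=
  (q.prod (gaussOn E)).map fun p => l • p.1 + σ • p.2

theorem lintegral_noised {F : E → ℝ≥0∞} (hF : Measurable F) :
    ∫⁻ y, F y ∂(noised l σ q) = ∫⁻ θ, ∫⁻ g, F (l • θ + σ • g) ∂(gaussOn E) ∂q := by
  rw [noised, lintegral_map hF (by fun_prop), lintegral_prod _ (by fun_prop)]

/-- The Markov kernel `y ↦ Law(A • y + B • θ + V • g)` where `θ` is drawn from the posterior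
given `y`. -/
def mixKernel (l σ : ℝ) (q : Measure E) [IsProbabilityMeasure q] (A B V : ℝ) : Kernel E E :=
  (Kernel.id ×ₖ (postKernel l σ q ×ₖ Kernel.const E (gaussOn E))).map
    fun p : E × E × E => A • p.1 + B • p.2.1 + V • p.2.2

theorem isMarkovKernel_mixKernel (hq : ∀ᵐ θ ∂q, ‖θ‖ ≤ r) (A B V : ℝ) :
    IsMarkovKernel (mixKernel l σ q A B V) := by
  have := isMarkovKernel_postKernel (l := l) (σ := σ) hq
  exact Kernel.IsMarkovKernel.map _ (by fun_prop)

theorem mixKernel_apply (hq : ∀ᵐ θ ∂q, ‖θ‖ ≤ r) (A B V : ℝ) (y : E) :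
    mixKernel l σ q A B V y = ((postKernel l σ q y).prod (gaussOn E)).map
      fun p => A • y + B • p.1 + V • p.2 := by
  have := isMarkovKernel_postKernel (l := l) (σ := σ) hq
  rw [mixKernel, Kernel.map_apply _ (by fun_prop), Kernel.prod_apply, Kernel.prod_apply,
    Kernel.id_apply, Kernel.const_apply, Measure.dirac_prod, Measure.map_map (by fun_prop)
    (by fun_prop)]
  rfl

theorem lintegral_mixKernel (hq : ∀ᵐ θ ∂q, ‖θ‖ ≤ r) (A B V : ℝ) (y : E) {F : E → ℝ≥0∞}
    (hF : Measurable F) :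
    ∫⁻ x, F x ∂(mixKernel l σ q A B V y)
      = ∫⁻ θ, ∫⁻ g, F (A • y + B • θ + V • g) ∂(gaussOn E) ∂(postKernel l σ q y) := by
  have := isMarkovKernel_postKernel (l := l) (σ := σ) hq
  rw [mixKernel_apply hq, lintegral_map hF (by fun_prop), lintegral_prod _ (by fun_prop)]

/-- Time reversal of one Gaussian autoregressive step. -/
theorem lintegral_noised_reverse (hq : ∀ᵐ θ ∂q, ‖θ‖ ≤ r) {l' σ' a s A B V : ℝ} (hσ : 0 < σ)
    (hl : l = a * l') (hs : σ ^ 2 = (a * σ') ^ 2 + s ^ 2) (hA : A = a * σ' ^ 2 / σ ^ 2)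
    (hB : B = l' - A * l) (hV : V = σ' * s / σ) {F : E × E → ℝ≥0∞} (hF : Measurable F) :
    ∫⁻ x, ∫⁻ g, F (x, a • x + s • g) ∂(gaussOn E) ∂(noised l' σ' q)
      = ∫⁻ y, ∫⁻ x, F (x, y) ∂(mixKernel l σ q A B V y) ∂(noised l σ q) := by
  have hm1 : Measurable fun x => ∫⁻ g, F (x, a • x + s • g) ∂(gaussOn E) :=
    Measurable.lintegral_prod_right' (f := fun p : E × E => F (p.1, a • p.1 + s • p.2))
      (by fun_prop)
  have hm2 : Measurable fun p : E × E => ∫⁻ g, F (A • p.2 + B • p.1 + V • g, p.2) ∂(gaussOn E) :=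
    Measurable.lintegral_prod_right'
      (f := fun p : (E × E) × E => F (A • p.1.2 + B • p.1.1 + V • p.2, p.1.2)) (by fun_prop)
  rw [lintegral_noised hm1]
  have hR : ∀ y, ∫⁻ x, F (x, y) ∂(mixKernel l σ q A B V y)
      = ∫⁻ θ, ∫⁻ g, F (A • y + B • θ + V • g, y) ∂(gaussOn E) ∂(postKernel l σ q y) :=
    fun y => lintegral_mixKernel hq A B V y (F := fun x => F (x, y)) (by fun_prop)
  simp_rw [hR]
  have hb := lintegral_bayes (l := l) (σ := σ) hq hσ hm2
  simp only at hb
  rw [noised, ← hb]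
  refine lintegral_congr fun θ => ?_
  have hc : (a * σ' / σ) ^ 2 + (s / σ) ^ 2 = 1 := by
    rw [div_pow, div_pow, ← add_div, ← hs, div_self (by positivity)]
  have hr := lintegral_reflect_gaussOn (E := E) hc
    (F := fun p => F (l' • θ + σ' • ((a * σ' / σ) • p.1 + (s / σ) • p.2), l • θ + σ • p.1))
    (by fun_prop)
  rw [lintegral_prod _ (by fun_prop), lintegral_prod _ (by fun_prop)] at hr
  simp only at hr
  calc _ = _ := lintegral_congr fun g' => lintegral_congr fun g => ?_
    _ = _ := hr
    _ = _ := lintegral_congr fun g' => lintegral_congr fun g => ?_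
  · have h0 : (a * σ' / σ) • ((a * σ' / σ) • g' + (s / σ) • g)
          + (s / σ) • ((s / σ) • g' - (a * σ' / σ) • g)
          = ((a * σ' / σ) ^ 2 + (s / σ) ^ 2) • g' := by module
    have h1 : σ • ((a * σ' / σ) • g' + (s / σ) • g)
          = (σ * (a * σ' / σ)) • g' + (σ * (s / σ)) • g := by module
    have h2 : a • (l' • θ + σ' • g') + s • g = (a * l') • θ + ((a * σ') • g' + s • g) := by module
    rw [h0, hc, one_smul, h1, mul_div_cancel₀ _ hσ.ne', mul_div_cancel₀ _ hσ.ne', hl, h2]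
  · have h1 : A • (l • θ + σ • g') + B • θ + V • g
        = (A * l + B) • θ + (A * σ) • g' + V • g := by module
    have h2 : A * l + B = l' := by rw [hB]; ring
    have h3 : A * σ = σ' * (a * σ' / σ) := by rw [hA]; field_simp
    have h4 : l' • θ + σ' • ((a * σ' / σ) • g' + (s / σ) • g)
        = l' • θ + (σ' * (a * σ' / σ)) • g' + (σ' * (s / σ)) • g := by module
    rw [h1, h2, h3, hV, mul_div_assoc σ' s σ, h4]

/-- The divergence between the exact reverse transition and one step of the sampler. -/
theorem klDiv_mixKernel_le (hq : ∀ᵐ θ ∂q, ‖θ‖ ≤ r) (hσ : 0 < σ) (hσ1 : σ ^ 2 ≤ 1) {x : ℝ}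
    (h0 : 0 < x) (hx : x ≤ σ ^ 2 / 1000) {D V β : ℝ} (hD : D = exp x - exp (-x))
    (hV : V = √(stepVar x (σ ^ 2))) (hβ : β = D * l / σ ^ 2 / V)
    (hl : 0 < l) (hβr : β * (2 * r) ≤ 1 / 10)
    {err : E → E} (herr : Measurable err) (herr1 : ∀ y, σ ^ 2 / l * ‖err y‖ ≤ 2 * r)
    (y : E) :
    InformationTheory.klDiv (mixKernel l σ q (exp x - D / σ ^ 2) (D * l / σ ^ 2) V y)
      (((gaussOn E).prod (gaussOn E)).map fun g =>
        exp x • y + D • ((l / σ ^ 2) • postMean l σ q (y + zeta1 x • g.1)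
          - (1 / σ ^ 2) • (y + zeta1 x • g.1) + err (y + zeta1 x • g.1))
          + zeta2 x • g.1 + zeta3 x • g.2)
      ≤ normalizedConst * ((∫⁻ θ, ‖β • (θ - postMean l σ q y)‖ₑ ^ 6 ∂(postKernel l σ q y))
        + (ENNReal.ofReal (10 * (x / σ ^ 2) ^ 2) ^ 2 * (Module.finrank ℝ E : ℝ≥0∞)
          + ENNReal.ofReal (10 * (x / σ ^ 2) ^ 2) ^ 4 * (Module.finrank ℝ E : ℝ≥0∞) ^ 2
          + ENNReal.ofReal (10 * (x / σ ^ 2)) ^ 6)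
        + ∫⁻ g, ‖(D / V) • err (y + zeta1 x • g)‖ₑ ^ 2 ∂(gaussOn E)) := by
  have hpost := isMarkovKernel_postKernel (l := l) (σ := σ) hq
  have hS : 0 < σ ^ 2 := by positivity
  have hx' : x ≤ 1 / 1000 := by linarith
  have hDm := exp_sub_exp_neg_mem h0 hx'
  rw [← hD] at hDm
  have hD0 : 0 < D := by linarith
  have hvm := stepVar_mem h0 hS hσ1 hx
  have hV0 : 0 < V := by rw [hV]; exact sqrt_pos.2 (by linarith)
  have hβ0 : 0 ≤ β := by rw [hβ]; positivity
  set m := postMean l σ q y with hm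
  have hpb := ae_norm_le_postKernel (l := l) (σ := σ) hq y
  have hmr : ‖m‖ ≤ r := by
    have := norm_integral_le_of_norm_le_const hpb
    simpa [hm, postMean] using this
  set ν := (postKernel l σ q y).map fun θ => β • (θ - m) with hν
  have : IsProbabilityMeasure ν := Measure.isProbabilityMeasure_map (by fun_prop)
  have hνb : ∀ᵐ x ∂ν, ‖x‖ ≤ 1 / 10 := by
    rw [hν, ae_map_iff (by fun_prop) (measurableSet_le (by fun_prop) (by fun_prop))]
    filter_upwards [hpb] with θ hθ
    rw [norm_smul, norm_of_nonneg hβ0]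
    refine le_trans ?_ hβr
    gcongr
    exact (norm_sub_le _ _).trans (by linarith)
  have hid : Integrable (fun θ : E => θ) (postKernel l σ q y) :=
    integrable_of_continuous_of_ae_norm_le hpb continuous_id
  have hmean : ∫ x, x ∂ν = 0 := by
    rw [hν, integral_map (by fun_prop) (by fun_prop), integral_smul,
      integral_sub hid (integrable_const _), integral_const]
    simp [hm, postMean]
  set e : E → E := fun g => (D / V) • err (y + zeta1 x • g) with he
  have hem : Measurable e := by fun_prop
  have he1 : ∀ g, ‖e g‖ ≤ 1 := by
    intro g
    have h1 := herr1 (y + zeta1 x • g)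
    rw [he, norm_smul, norm_of_nonneg (by positivity)]
    have : D / V * ‖err (y + zeta1 x • g)‖
        = β * (σ ^ 2 / l * ‖err (y + zeta1 x • g)‖) := by
      rw [hβ]; field_simp
    rw [this]
    linarith [mul_le_mul_of_nonneg_left h1 hβ0]
  have hη : 10 * (x / σ ^ 2) ≤ 1 := by
    have : x / σ ^ 2 ≤ 1 / 1000 := by rw [div_le_iff₀ hS]; linarith
    linarith
  have key := klDiv_normalized_le hνb hmean (tiltCoeff_mem h0 hS hσ1 hx).1
    (tiltCoeff_mem h0 hS hσ1 hx).2 (exactCoeff_sq_add h0 hS hσ1 hx)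
    ((by norm_num : (2 / 5 : ℝ) ≤ 4 / 5).trans (exactCoeff_mem h0 hS hσ1 hx).1)
    (two_fifths_le_secondCoeff h0 hS hσ1 hx) (abs_firstCoeff_sub_exactCoeff_le h0 hS hσ1 hx)
    (abs_tiltCoeff_sub_le h0 hS hσ1 hx) hη hem he1
  have hsix : ∫⁻ x, ‖x‖ₑ ^ 6 ∂ν = ∫⁻ θ, ‖β • (θ - m)‖ₑ ^ 6 ∂(postKernel l σ q y) := by
    rw [hν, lintegral_map (by fun_prop) (by fun_prop)]
  rw [hsix] at key
  refine le_trans (le_of_eq_of_le ?_ (InformationTheory.klDiv_map_le _ _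
    (g := fun z : E => ((exp x - D / σ ^ 2) • y + (D * l / σ ^ 2) • m) + V • z)
    (by fun_prop))) key
  have e1 : D * l / σ ^ 2 = V * β := by rw [hβ]; field_simp
  congr 1
  · have hprod : ν.prod (gaussOn E) = ((postKernel l σ q y).prod (gaussOn E)).map
        (Prod.map (fun θ => β • (θ - m)) id) := by
      rw [← Measure.map_prod_map _ _ (by fun_prop) measurable_id, Measure.map_id]
    rw [mixKernel_apply hq, Measure.map_map (by fun_prop) (by fun_prop), hprod,
      Measure.map_map (by fun_prop) (by fun_prop)]
    congr 1
    funext p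
    simp only [Function.comp_apply, Prod.map_fst, Prod.map_snd, id_eq, e1]
    module
  · have hω : tiltCoeff x (σ ^ 2) * β = l / σ ^ 2 * zeta1 x := by
      rw [tiltCoeff, hβ, ← hV, ← hD]
      field_simp
    rw [Measure.map_map (by fun_prop) (by fun_prop)]
    congr 1
    funext g
    simp only [Function.comp_apply, he]
    rw [hν, tiltMean_postKernel hq hω, firstCoeff, secondCoeff, ← hV, ← hD, ← hm]
    set m' := postMean l σ q (y + zeta1 x • g.1)
    have e2 : V * ((zeta2 x - D * zeta1 x / σ ^ 2) / V) = zeta2 x - D * zeta1 x / σ ^ 2 := by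
      field_simp
    have e3 : V * (zeta3 x / V) = zeta3 x := by field_simp
    have e4 : V * (D / V) = D := by field_simp
    simp only [smul_add, smul_smul, e2, e3, e4, ← e1]
    module

end Reverse

section Chain

theorem Measurable.finSnoc {Ω X : Type*} [MeasurableSpace Ω] [MeasurableSpace X] {n : ℕ}
    {f : Ω → Fin n → X} {g : Ω → X} (hf : Measurable f) (hg : Measurable g) :
    Measurable fun ω => (Fin.snoc (f ω) (g ω) : Fin (n + 1) → X) := by
  refine measurable_pi_iff.2 fun i => ?_
  refine Fin.lastCases ?_ (fun j => ?_) i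
  · simpa using hg
  · simpa using measurable_pi_iff.1 hf j

theorem Measurable.finCons {Ω X : Type*} [MeasurableSpace Ω] [MeasurableSpace X] {n : ℕ}
    {f : Ω → Fin n → X} {g : Ω → X} (hf : Measurable f) (hg : Measurable g) :
    Measurable fun ω => (Fin.cons (g ω) (f ω) : Fin (n + 1) → X) := by
  refine measurable_pi_iff.2 fun i => ?_
  refine Fin.cases ?_ (fun j => ?_) i
  · simpa using hg
  · simpa using measurable_pi_iff.1 hf j

variable {d : ℕ} {N : Type*} [MeasurableSpace N] {ν : Measure N} [IsProbabilityMeasure ν]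
  {α β : Measure (Vec d)} [IsProbabilityMeasure α] [IsProbabilityMeasure β]
  {step : ℕ → Vec d → N → Vec d}

theorem isProbabilityMeasure_jointChain
    (hstep : ∀ n, Measurable fun p : Vec d × N => step n p.1 p.2) (n : ℕ) :
    IsProbabilityMeasure (jointChain ν α step n) := by
  induction n with
  | zero => exact Measure.isProbabilityMeasure_map (by fun_prop)
  | succ n ih =>
    refine Measure.isProbabilityMeasure_map (Measurable.aemeasurable ?_)
    exact measurable_fst.finSnoc ((hstep n).comp
      (f := fun p : (Fin (n + 1) → Vec d) × N => (p.1 (Fin.last n), p.2)) (by fun_prop))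

theorem lintegral_jointChain_zero {F : (Fin 1 → Vec d) → ℝ≥0∞} (hF : Measurable F) :
    ∫⁻ v, F v ∂(jointChain ν α step 0) = ∫⁻ x, F (fun _ => x) ∂α := by
  rw [jointChain, lintegral_map hF (by fun_prop)]

theorem lintegral_jointChain_succ
    (hstep : ∀ n, Measurable fun p : Vec d × N => step n p.1 p.2) (n : ℕ)
    {F : (Fin (n + 2) → Vec d) → ℝ≥0∞} (hF : Measurable F) :
    ∫⁻ v, F v ∂(jointChain ν α step (n + 1))
      = ∫⁻ v, ∫⁻ g, F (Fin.snoc v (step n (v (Fin.last n)) g)) ∂ν ∂(jointChain ν α step n) := by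
  have := isProbabilityMeasure_jointChain (ν := ν) (α := α) hstep n
  have hm : Measurable fun p : (Fin (n + 1) → Vec d) × N =>
      (Fin.snoc p.1 (step n (p.1 (Fin.last n)) p.2) : Fin (n + 2) → Vec d) :=
    measurable_fst.finSnoc ((hstep n).comp
      (f := fun p : (Fin (n + 1) → Vec d) × N => (p.1 (Fin.last n), p.2)) (by fun_prop))
  rw [jointChain, lintegral_map hF hm]
  exact lintegral_prod _ (hF.comp hm).aemeasurable

theorem lintegral_jointChain_head
    (hstep : ∀ n, Measurable fun p : Vec d × N => step n p.1 p.2) (n : ℕ)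
    {F : Vec d → ℝ≥0∞} (hF : Measurable F) :
    ∫⁻ v, F (v 0) ∂(jointChain ν α step n) = ∫⁻ x, F x ∂α := by
  induction n with
  | zero => rw [lintegral_jointChain_zero (by fun_prop)]
  | succ n ih =>
    rw [lintegral_jointChain_succ hstep n (F := fun v => F (v 0)) (by fun_prop), ← ih]
    refine lintegral_congr fun v => ?_
    have h0 : ∀ w : Vec d, (Fin.snoc v w : Fin (n + 2) → Vec d) 0 = v 0 := fun w => by
      rw [← Fin.castSucc_zero, Fin.snoc_castSucc]
    simp [h0]

/-- If the first step of a chain can be reversed through the kernel `P`, then the chain can be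
generated by running its remaining steps and then prepending a draw from `P`. -/
theorem lintegral_jointChain_succ_cons
    (hstep : ∀ n, Measurable fun p : Vec d × N => step n p.1 p.2)
    {P : Kernel (Vec d) (Vec d)} [IsMarkovKernel P]
    (hP : ∀ F : Vec d × Vec d → ℝ≥0∞, Measurable F →
      ∫⁻ x, ∫⁻ g, F (x, step 0 x g) ∂ν ∂α = ∫⁻ y, ∫⁻ x, F (x, y) ∂(P y) ∂β) (n : ℕ)
    {F : (Fin (n + 2) → Vec d) → ℝ≥0∞} (hF : Measurable F) :
    ∫⁻ v, F v ∂(jointChain ν α step (n + 1))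
      = ∫⁻ v, ∫⁻ x, F (Fin.cons x v) ∂(P (v 0))
          ∂(jointChain ν β (fun j => step (j + 1)) n) := by
  have hker : ∀ m (G : (Fin (m + 2) → Vec d) → ℝ≥0∞), Measurable G →
      Measurable fun v : Fin (m + 1) → Vec d => ∫⁻ x, G (Fin.cons x v) ∂(P (v 0)) := by
    intro m G hG
    have : Measurable fun p : (Fin (m + 1) → Vec d) × Vec d => G (Fin.cons p.2 p.1) :=
      hG.comp (measurable_fst.finCons measurable_snd)
    exact Measurable.lintegral_kernel_prod_right'
      (κ := P.comap (fun v : Fin (m + 1) → Vec d => v 0) (by fun_prop)) this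
  induction n with
  | zero =>
    have hm : Measurable fun p : Vec d × Vec d =>
        F (Fin.snoc (fun _ : Fin 1 => p.1) p.2) :=
      hF.comp (Measurable.finSnoc (by fun_prop) (by fun_prop))
    have hm' : Measurable fun v : Fin 1 → Vec d =>
        ∫⁻ g, F (Fin.snoc v (step 0 (v (Fin.last 0)) g)) ∂ν := by
      refine Measurable.lintegral_prod_right'
        (f := fun p : (Fin 1 → Vec d) × N => F (Fin.snoc p.1 (step 0 (p.1 (Fin.last 0)) p.2))) ?_
      exact hF.comp (measurable_fst.finSnoc ((hstep 0).comp
        (f := fun p : (Fin 1 → Vec d) × N => (p.1 (Fin.last 0), p.2)) (by fun_prop)))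
    rw [lintegral_jointChain_succ hstep 0 hF, lintegral_jointChain_zero hm',
      lintegral_jointChain_zero (hker 0 F hF)]
    refine (hP _ hm).trans (lintegral_congr fun y => lintegral_congr fun x => ?_)
    congr 1
    funext i
    fin_cases i <;> rfl
  | succ n ih =>
    have hsnoc : Measurable fun p : (Fin (n + 2) → Vec d) × N =>
        F (Fin.snoc p.1 (step (n + 1) (p.1 (Fin.last (n + 1))) p.2)) :=
      hF.comp (measurable_fst.finSnoc ((hstep (n + 1)).comp
        (f := fun p : (Fin (n + 2) → Vec d) × N => (p.1 (Fin.last (n + 1)), p.2)) (by fun_prop)))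
    rw [lintegral_jointChain_succ hstep (n + 1) hF,
      ih (F := fun v => ∫⁻ g, F (Fin.snoc v (step (n + 1) (v (Fin.last (n + 1))) g)) ∂ν)
        (Measurable.lintegral_prod_right' hsnoc),
      lintegral_jointChain_succ (fun j => hstep (j + 1)) n (hker (n + 1) F hF)]
    refine lintegral_congr fun v => ?_
    have h0 : ∀ w : Vec d, (Fin.snoc v w : Fin (n + 2) → Vec d) 0 = v 0 := fun w => by
      rw [← Fin.castSucc_zero, Fin.snoc_castSucc]
    have hl : ∀ x : Vec d, (Fin.cons x v : Fin (n + 2) → Vec d) (Fin.last (n + 1))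
        = v (Fin.last n) := fun x => by
      rw [← Fin.succ_last, Fin.cons_succ]
    simp only [h0, hl]
    rw [lintegral_lintegral_swap]
    · refine lintegral_congr fun g => lintegral_congr fun x => ?_
      rw [Fin.cons_snoc_eq_snoc_cons]
    · refine (hsnoc.comp (f := fun p : Vec d × N => ((Fin.cons p.1 v : Fin (n + 2) → Vec d), p.2))
        ?_).aemeasurable.congr ?_
      · exact (Measurable.finCons measurable_const measurable_fst).prodMk measurable_snd
      · exact Filter.Eventually.of_forall fun p => by
          simp only [Function.comp_apply, hl, Function.uncurry]

end Chain

section ChainKL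

variable {d : ℕ}

/-- The transition kernel `y ↦ Law(step y ξ)` with `ξ ~ ν`. -/
def stepKernel {N : Type*} [MeasurableSpace N] (ν : Measure N) (step : Vec d → N → Vec d) :
    Kernel (Vec d) (Vec d) :=
  (Kernel.id ×ₖ Kernel.const (Vec d) ν).map fun p => step p.1 p.2

theorem isMarkovKernel_stepKernel {N : Type*} [MeasurableSpace N] {ν : Measure N}
    [IsProbabilityMeasure ν] {step : Vec d → N → Vec d}
    (hstep : Measurable fun p : Vec d × N => step p.1 p.2) :
    IsMarkovKernel (stepKernel ν step) := Kernel.IsMarkovKernel.map _ hstep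

theorem stepKernel_apply {N : Type*} [MeasurableSpace N] {ν : Measure N}
    [IsProbabilityMeasure ν] {step : Vec d → N → Vec d}
    (hstep : Measurable fun p : Vec d × N => step p.1 p.2) (y : Vec d) :
    stepKernel ν step y = ν.map (step y) := by
  rw [stepKernel, Kernel.map_apply _ hstep, Kernel.prod_apply, Kernel.id_apply,
    Kernel.const_apply, Measure.dirac_prod, Measure.map_map hstep (by fun_prop)]
  rfl

theorem measurable_stepKernel_section {N : Type*} [MeasurableSpace N]
    {step : Vec d → N → Vec d} (hstep : Measurable fun p : Vec d × N => step p.1 p.2) (y : Vec d) :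
    Measurable (step y) := hstep.comp measurable_prodMk_left

instance : IsProbabilityMeasure (_root_.stdGaussian d) := by
  rw [stdGaussian_eq_gaussOn]; infer_instance

instance (q0 : Measure (Vec d)) [IsProbabilityMeasure q0] (u : ℝ) :
    IsProbabilityMeasure (forwardLaw q0 u) :=
  Measure.isProbabilityMeasure_map (by fun_prop)

theorem measurable_ouStep (a : ℝ) : Measurable fun p : Vec d × Vec d => ouStep a p.1 p.2 := by
  unfold ouStep; fun_prop

theorem measurable_rkStep (x : ℝ) {s : Vec d → Vec d} (hs : Measurable s) :
    Measurable fun p : Vec d × (Vec d × Vec d) => rkStep x s p.1 p.2 := by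
  unfold rkStep; fun_prop

variable {q0 : Measure (Vec d)} [IsProbabilityMeasure q0] {T : ℝ} {t : ℕ → ℝ}

theorem measurable_reverse (n : ℕ) :
    Measurable fun (v : Fin (n + 1) → Vec d) (k : Fin (n + 1)) => v (Fin.rev k) := by
  fun_prop

instance isProbabilityMeasure_Qdis (n : ℕ) : IsProbabilityMeasure (Qdis q0 T n t) := by
  have := isProbabilityMeasure_jointChain (ν := _root_.stdGaussian d)
    (α := forwardLaw q0 (T - t n)) (step := fun j x g => ouStep (t (n - j) - t (n - j - 1)) x g)
    (fun j => measurable_ouStep _) n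
  exact Measure.isProbabilityMeasure_map (measurable_reverse n).aemeasurable

theorem isProbabilityMeasure_QhatDis {sHat : ℕ → Vec d → Vec d} (hs : ∀ k, Measurable (sHat k))
    (n : ℕ) : IsProbabilityMeasure (QhatDis q0 T n t sHat) :=
  isProbabilityMeasure_jointChain (fun _ => measurable_rkStep _ (hs _)) n

/-- The last coordinate of the time-reversed chain has the law of the forward process. -/
theorem lintegral_Qdis_last (n : ℕ) {F : Vec d → ℝ≥0∞} (hF : Measurable F) :
    ∫⁻ v, F (v (Fin.last n)) ∂(Qdis q0 T n t) = ∫⁻ x, F x ∂(forwardLaw q0 (T - t n)) := by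
  rw [Qdis, lintegral_map (f := fun v : Fin (n + 1) → Vec d => F (v (Fin.last n))) (by fun_prop)
    (measurable_reverse n)]
  simp only [Fin.rev_last]
  exact lintegral_jointChain_head (fun j => measurable_ouStep _) n hF

/-- The time-reversed chain is Markov, with transitions given by the reversed forward steps. -/
theorem Qdis_succ (n : ℕ) {P : Kernel (Vec d) (Vec d)} [IsMarkovKernel P]
    (hP : ∀ F : Vec d × Vec d → ℝ≥0∞, Measurable F →
      ∫⁻ x, ∫⁻ g, F (x, ouStep (t (n + 1) - t n) x g) ∂(_root_.stdGaussian d)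
          ∂(forwardLaw q0 (T - t (n + 1)))
        = ∫⁻ y, ∫⁻ x, F (x, y) ∂(P y) ∂(forwardLaw q0 (T - t n))) :
    Qdis q0 T (n + 1) t = (Qdis q0 T n t ⊗ₘ P.comap (fun v => v (Fin.last n))
      (measurable_pi_apply _)).map fun p => (Fin.snoc p.1 p.2 : Fin (n + 2) → Vec d) := by
  have hsn : Measurable fun p : (Fin (n + 1) → Vec d) × Vec d =>
      (Fin.snoc p.1 p.2 : Fin (n + 2) → Vec d) := measurable_fst.finSnoc measurable_snd
  refine Measure.ext_of_lintegral _ fun F hF => ?_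
  have hFs : Measurable fun p : (Fin (n + 1) → Vec d) × Vec d => F (Fin.snoc p.1 p.2) :=
    hF.comp hsn
  rw [Qdis, lintegral_map hF (measurable_reverse _), lintegral_map hF hsn,
    Measure.lintegral_compProd hFs]
  have hk : Measurable fun v : Fin (n + 1) → Vec d => ∫⁻ x, F (Fin.snoc v x)
      ∂(P.comap (fun v : Fin (n + 1) → Vec d => v (Fin.last n)) (measurable_pi_apply _) v) :=
    Measurable.lintegral_kernel_prod_right' hFs
  rw [Qdis, lintegral_map hk (measurable_reverse _),
    lintegral_jointChain_succ_cons (β := forwardLaw q0 (T - t n)) (P := P)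
      (fun j => measurable_ouStep _) (by simpa using hP) n
      (F := fun v => F fun k => v (Fin.rev k)) (by fun_prop)]
  simp only [Nat.add_sub_add_right, Kernel.comap_apply, Fin.rev_last]
  refine lintegral_congr fun v => lintegral_congr fun x => ?_
  congr 1
  funext k
  exact Fin.cons_rev x v k

theorem QhatDis_succ {sHat : ℕ → Vec d → Vec d} (hs : ∀ k, Measurable (sHat k)) (n : ℕ) :
    QhatDis q0 T (n + 1) t sHat = (QhatDis q0 T n t sHat ⊗ₘ
      (stepKernel ((_root_.stdGaussian d).prod (_root_.stdGaussian d))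
        (rkStep (t (n + 1) - t n) (sHat n))).comap (fun v => v (Fin.last n))
      (measurable_pi_apply _)).map fun p => (Fin.snoc p.1 p.2 : Fin (n + 2) → Vec d) := by
  have hsn : Measurable fun p : (Fin (n + 1) → Vec d) × Vec d =>
      (Fin.snoc p.1 p.2 : Fin (n + 2) → Vec d) := measurable_fst.finSnoc measurable_snd
  have hst := measurable_rkStep (t (n + 1) - t n) (hs n)
  have := isMarkovKernel_stepKernel
    (ν := (_root_.stdGaussian d).prod (_root_.stdGaussian d)) hst
  have := isProbabilityMeasure_QhatDis (q0 := q0) (T := T) (t := t) hs n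
  refine Measure.ext_of_lintegral _ fun F hF => ?_
  have hFs : Measurable fun p : (Fin (n + 1) → Vec d) × Vec d => F (Fin.snoc p.1 p.2) :=
    hF.comp hsn
  rw [lintegral_map hF hsn, Measure.lintegral_compProd hFs, QhatDis,
    lintegral_jointChain_succ (fun _ => measurable_rkStep _ (hs _)) n hF]
  refine lintegral_congr fun v => ?_
  rw [Kernel.comap_apply, stepKernel_apply hst, lintegral_map
    (f := fun x => F (Fin.snoc v x)) (hFs.comp measurable_prodMk_left) (measurable_stepKernel_section hst _)]

/-- The divergence between the two chains is at most the sum of the averaged one-step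
divergences. -/
theorem klDiv_Qdis_le {sHat : ℕ → Vec d → Vec d} (hs : ∀ k, Measurable (sHat k)) (ht : t 0 = 0)
    {b : ℕ → ℝ≥0∞} (n : ℕ)
    (h : ∀ k < n, ∃ P : Kernel (Vec d) (Vec d), IsMarkovKernel P ∧
      (∀ F : Vec d × Vec d → ℝ≥0∞, Measurable F →
        ∫⁻ x, ∫⁻ g, F (x, ouStep (t (k + 1) - t k) x g) ∂(_root_.stdGaussian d)
            ∂(forwardLaw q0 (T - t (k + 1)))
          = ∫⁻ y, ∫⁻ x, F (x, y) ∂(P y) ∂(forwardLaw q0 (T - t k))) ∧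
      ∃ B : Vec d → ℝ≥0∞, Measurable B ∧
        (∀ y, InformationTheory.klDiv (P y)
          (((_root_.stdGaussian d).prod (_root_.stdGaussian d)).map
            (rkStep (t (k + 1) - t k) (sHat k) y)) ≤ B y) ∧
        ∫⁻ y, B y ∂(forwardLaw q0 (T - t k)) ≤ b k) :
    InformationTheory.klDiv (Qdis q0 T n t) (QhatDis q0 T n t sHat)
      ≤ ∑ k ∈ Finset.range n, b k := by
  induction n with
  | zero =>
    have : Qdis q0 T 0 t = QhatDis q0 T 0 t sHat := by
      refine Measure.ext_of_lintegral _ fun F hF => ?_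
      rw [Qdis, lintegral_map hF (measurable_reverse _), QhatDis,
        lintegral_jointChain_zero hF, lintegral_jointChain_zero (by fun_prop), ht, sub_zero]
    have hp := isProbabilityMeasure_QhatDis (q0 := q0) (T := T) (t := t) hs 0
    rw [this, InformationTheory.klDiv_self]
    simp
  | succ n ih =>
    obtain ⟨P, hPm, hP, B, hBm, hB, hb⟩ := h n n.lt_succ_self
    have hst := measurable_rkStep (t (n + 1) - t n) (hs n)
    have := isMarkovKernel_stepKernel
      (ν := (_root_.stdGaussian d).prod (_root_.stdGaussian d)) hst
    have := isProbabilityMeasure_QhatDis (q0 := q0) (T := T) (t := t) hs n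
    rw [Qdis_succ n hP, QhatDis_succ hs n, Finset.sum_range_succ]
    refine (InformationTheory.klDiv_map_le _ _ (measurable_fst.finSnoc measurable_snd)).trans ?_
    rw [InformationTheory.klDiv_compProd_eq_add]
    refine add_le_add (ih fun k hk => h k (by omega)) ?_
    refine (klDiv_compProd_right_le (B := fun v : Fin (n + 1) → Vec d => B (v (Fin.last n)))
      (by fun_prop) fun v => ?_).trans ?_
    · rw [Kernel.comap_apply, Kernel.comap_apply, stepKernel_apply hst]
      exact hB _
    · rw [lintegral_Qdis_last n hBm]
      exact hb

end ChainKL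

section Averages

variable {E : Type*} [NormedAddCommGroup E] [InnerProductSpace ℝ E] [FiniteDimensional ℝ E]
  [MeasurableSpace E] [BorelSpace E] {q : Measure E} [IsProbabilityMeasure q] {l σ r : ℝ}

/-- The posterior spread is controlled by the noise level. -/
theorem lintegral_posterior_pow_six_le (hq : ∀ᵐ θ ∂q, ‖θ‖ ≤ r) (hσ : 0 < σ) (hl : 0 < l) (β : ℝ) :
    ∫⁻ y, ∫⁻ θ, ‖β • (θ - postMean l σ q y)‖ₑ ^ 6 ∂(postKernel l σ q y) ∂(noised l σ q)
      ≤ 2 ^ 7 * ENNReal.ofReal (384 * (β * (σ / l)) ^ 6) * gaussExpMoment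
        * (Module.finrank ℝ E : ℝ≥0∞) ^ 3 := by
  have hpost := isMarkovKernel_postKernel (l := l) (σ := σ) hq
  have hy : ∀ y, ∫⁻ θ, ‖β • (θ - postMean l σ q y)‖ₑ ^ 6 ∂(postKernel l σ q y)
      ≤ 2 ^ 7 * ∫⁻ θ, ‖β • (θ - l⁻¹ • y)‖ₑ ^ 6 ∂(postKernel l σ q y) := by
    intro y
    have hid : Integrable (fun θ : E => θ) (postKernel l σ q y) :=
      integrable_of_continuous_of_ae_norm_le (ae_norm_le_postKernel hq y) continuous_id
    have hm : β • (postMean l σ q y - l⁻¹ • y)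
        = ∫ θ, β • (θ - l⁻¹ • y) ∂(postKernel l σ q y) := by
      rw [integral_smul, integral_sub hid (integrable_const _), integral_const]
      simp [postMean]
    have hJ : ‖β • (postMean l σ q y - l⁻¹ • y)‖ₑ ^ 6
        ≤ ∫⁻ θ, ‖β • (θ - l⁻¹ • y)‖ₑ ^ 6 ∂(postKernel l σ q y) := by
      rw [hm]
      exact enorm_integral_pow_le (by fun_prop) 5
    calc ∫⁻ θ, ‖β • (θ - postMean l σ q y)‖ₑ ^ 6 ∂(postKernel l σ q y)
        ≤ ∫⁻ θ, 2 ^ 6 * (‖β • (θ - l⁻¹ • y)‖ₑ ^ 6 + ‖β • (postMean l σ q y - l⁻¹ • y)‖ₑ ^ 6)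
            ∂(postKernel l σ q y) := by
          refine lintegral_mono fun θ => le_trans ?_ (add_pow_le_two_pow_mul _ _ 6)
          have : β • (θ - postMean l σ q y)
              = β • (θ - l⁻¹ • y) - β • (postMean l σ q y - l⁻¹ • y) := by module
          rw [this]
          gcongr
          exact enorm_sub_le
      _ = 2 ^ 6 * ((∫⁻ θ, ‖β • (θ - l⁻¹ • y)‖ₑ ^ 6 ∂(postKernel l σ q y))
            + ‖β • (postMean l σ q y - l⁻¹ • y)‖ₑ ^ 6) := by
          rw [lintegral_const_mul _ (by fun_prop), lintegral_add_right _ (by fun_prop),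
            lintegral_const, measure_univ, mul_one]
      _ ≤ 2 ^ 6 * ((∫⁻ θ, ‖β • (θ - l⁻¹ • y)‖ₑ ^ 6 ∂(postKernel l σ q y))
            + ∫⁻ θ, ‖β • (θ - l⁻¹ • y)‖ₑ ^ 6 ∂(postKernel l σ q y)) := by gcongr
      _ = _ := by ring
  have hb := lintegral_bayes (l := l) (σ := σ) hq hσ
    (G := fun p => ‖β • (p.1 - l⁻¹ • p.2)‖ₑ ^ 6) (by fun_prop)
  have hg : ∀ θ g : E, ‖β • (θ - l⁻¹ • (l • θ + σ • g))‖ₑ ^ 6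
      = ENNReal.ofReal ((β * (σ / l)) ^ 6) * ‖g‖ₑ ^ 6 := by
    intro θ g
    have : β • (θ - l⁻¹ • (l • θ + σ • g)) = (-(β * (σ / l))) • g := by
      rw [smul_add, smul_smul l⁻¹ l, inv_mul_cancel₀ hl.ne', smul_smul]
      match_scalars <;> field_simp; ring
    rw [this, enorm_smul, mul_pow, enorm_norm_pow, norm_neg, norm_eq_abs]
    congr 2
    rw [show (6 : ℕ) = 2 * 3 from rfl, pow_mul, sq_abs, ← pow_mul]
  simp only [hg] at hb
  calc _ ≤ ∫⁻ y, 2 ^ 7 * ∫⁻ θ, ‖β • (θ - l⁻¹ • y)‖ₑ ^ 6 ∂(postKernel l σ q y)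
        ∂(noised l σ q) := lintegral_mono hy
    _ = 2 ^ 7 * ∫⁻ y, ∫⁻ θ, ‖β • (θ - l⁻¹ • y)‖ₑ ^ 6 ∂(postKernel l σ q y)
        ∂(noised l σ q) := by
        refine lintegral_const_mul _ (Measurable.lintegral_kernel_prod_right'
          (f := fun p : E × E => ‖β • (p.2 - l⁻¹ • p.1)‖ₑ ^ 6) (by fun_prop))
    _ = 2 ^ 7 * (ENNReal.ofReal ((β * (σ / l)) ^ 6) * ∫⁻ g : E, ‖g‖ₑ ^ 6 ∂(gaussOn E)) := by
        rw [noised, ← hb, lintegral_const, measure_univ, mul_one,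
          lintegral_const_mul _ (by fun_prop)]
    _ ≤ 2 ^ 7 * (ENNReal.ofReal ((β * (σ / l)) ^ 6) * (ENNReal.ofReal 384 * gaussExpMoment
          * (Module.finrank ℝ E : ℝ≥0∞) ^ 3)) := by
        have h := lintegral_norm_pow_gaussOn_le (E := E) 2
        norm_num [Nat.factorial] at h ⊢
        gcongr
    _ = _ := by
        rw [ENNReal.ofReal_mul (by norm_num)]
        ring

/-- A noised observation perturbed by further Gaussian noise, seen from an earlier time. -/
theorem lintegral_noised_add (hq : ∀ᵐ θ ∂q, ‖θ‖ ≤ r) {l' σ' a s z : ℝ} (hσ : 0 < σ)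
    (hl : l = a * l') (hs : σ ^ 2 = (a * σ') ^ 2 + s ^ 2) {F : E → ℝ≥0∞} (hF : Measurable F) :
    ∫⁻ y, ∫⁻ g, F (y + z • g) ∂(gaussOn E) ∂(noised l σ q)
      = ∫⁻ x, ∫⁻ g, F (a • x + √(s ^ 2 + z ^ 2) • g) ∂(gaussOn E) ∂(noised l' σ' q) := by
  have hG : Measurable fun y => ∫⁻ g, F (y + z • g) ∂(gaussOn E) :=
    Measurable.lintegral_prod_right' (f := fun p : E × E => F (p.1 + z • p.2)) (by fun_prop)
  have h := lintegral_noised_reverse hq hσ hl hs rfl rfl rfl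
    (F := fun p => ∫⁻ g, F (p.2 + z • g) ∂(gaussOn E)) (by fun_prop)
  have hmk := isMarkovKernel_mixKernel (l := l) (σ := σ) hq (a * σ' ^ 2 / σ ^ 2)
    (l' - a * σ' ^ 2 / σ ^ 2 * l) (σ' * s / σ)
  simp only [lintegral_const, measure_univ, mul_one] at h
  rw [← h]
  refine lintegral_congr fun x => ?_
  rw [← lintegral_smul_add_smul_gaussOn s z (F := fun w => F (a • x + w)) (by fun_prop)]
  simp only [add_assoc]

end Averages

section Forward

variable {d : ℕ} {q0 : Measure (Vec d)} [IsProbabilityMeasure q0] {r : ℝ}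

theorem forwardLaw_eq_noised (u : ℝ) :
    forwardLaw q0 u = noised (exp (-u)) (√(1 - exp (-2 * u))) q0 := by
  rw [forwardLaw, noised, stdGaussian_eq_gaussOn]

theorem one_sub_exp_pos {u : ℝ} (hu : 0 < u) : 0 < 1 - exp (-2 * u) := by
  have : exp (-2 * u) < 1 := exp_lt_one_iff.2 (by linarith)
  linarith

/-- Tweedie's formula for the score. -/
theorem score_eq (hq : ∀ᵐ θ ∂q0, ‖θ‖ ≤ r) {ρ : ℝ → Vec d → ℝ} {T s : ℝ} (hs : s < T)
    (hρ : forwardLaw q0 (T - s) = volume.withDensity fun x => ENNReal.ofReal (ρ (T - s) x))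
    (hpos : ∀ x, 0 < ρ (T - s) x) (hcont : Continuous (ρ (T - s))) {l σ : ℝ}
    (hl : l = exp (-(T - s))) (hσ : σ = √(1 - exp (-2 * (T - s)))) (y : Vec d) :
    score ρ T s y = (l / σ ^ 2) • postMean l σ q0 y - (1 / σ ^ 2) • y := by
  have hσ0 : 0 < σ := hσ ▸ sqrt_pos.2 (one_sub_exp_pos (by linarith))
  have hev : Continuous (evidence l σ q0) :=
    continuous_iff_continuousAt.2 fun y => (hasGradientAt_evidence hq y).continuousAt
  have hdens : Continuous fun y : Vec d => (σ ^ Module.finrank ℝ (Vec d))⁻¹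
      * gaussDensity (σ⁻¹ • y) * evidence l σ q0 y := by fun_prop
  have heq := hρ.symm.trans (forwardLaw_eq_noised (q0 := q0) (T - s))
  rw [← hl, ← hσ, noised, map_smul_add_smul_eq_withDensity hq hσ0,
    withDensity_eq_iff_of_sigmaFinite (by fun_prop) (by fun_prop)] at heq
  replace heq := (Continuous.ae_eq_iff_eq _ (ENNReal.continuous_ofReal.comp hcont)
    (ENNReal.continuous_ofReal.comp hdens)).1 heq
  have heq' : ρ (T - s) = fun y => (σ ^ Module.finrank ℝ (Vec d))⁻¹
      * gaussDensity (σ⁻¹ • y) * evidence l σ q0 y := by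
    funext y
    have h := congrFun heq y
    have h2 := gaussDensity_pos (σ⁻¹ • y)
    have h3 := evidence_pos (l := l) (σ := σ) hq y
    exact (ENNReal.ofReal_eq_ofReal_iff (hpos y).le (by positivity)).1 h
  rw [score, heq']
  exact gradient_log_density hq (by positivity) y

theorem stepVar_eq {u x : ℝ} (hu : 0 < u) :
    stepVar x (1 - exp (-2 * u))
      = (1 - exp (-2 * (u - x))) * (1 - exp (-2 * x)) / (1 - exp (-2 * u)) := by
  have hS := (one_sub_exp_pos hu).ne'
  have e1 : exp (-2 * (u - x)) = exp (-2 * u) * exp x ^ 2 := by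
    rw [← exp_nat_mul, ← exp_add]; congr 1; push_cast; ring
  have e2 : exp (-2 * x) = (exp x ^ 2)⁻¹ := by
    rw [← exp_nat_mul, ← exp_neg]; congr 1; push_cast; ring
  have e3 : exp (2 * x) = exp x ^ 2 := by
    rw [← exp_nat_mul]; congr 1
  have hz := (exp_pos x).ne'
  rw [stepVar, f2, e1, e2, e3, exp_neg x]
  generalize exp (-2 * u) = w at hS ⊢
  field_simp
  ring

theorem noise_composition {u x : ℝ} (hx : 0 < x) (hxu : x < u) :
    √(1 - exp (-2 * u)) ^ 2
      = (exp (-x) * √(1 - exp (-2 * (u - x)))) ^ 2 + √(1 - exp (-2 * x)) ^ 2 := by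
  rw [mul_pow, sq_sqrt (one_sub_exp_pos (by linarith)).le, sq_sqrt (one_sub_exp_pos hx).le,
    sq_sqrt (one_sub_exp_pos (by linarith)).le, ← exp_nat_mul, mul_sub, ← exp_add]
  have : ((2 : ℕ) : ℝ) * -x + -2 * (u - x) = -2 * u := by push_cast; ring
  have h2 : ((2 : ℕ) : ℝ) * -x = -2 * x := by push_cast; ring
  rw [this, h2]
  ring

theorem exp_composition (u x : ℝ) : exp (-u) = exp (-x) * exp (-(u - x)) := by
  rw [← exp_add]; congr 1; ring

/-- The forward step from time `u - x` to time `u` is reversed by an explicit kernel. -/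
theorem lintegral_forwardLaw_reverse (hq : ∀ᵐ θ ∂q0, ‖θ‖ ≤ r) {u x l σ D V : ℝ} (hx : 0 < x)
    (hxu : x < u) (hl : l = exp (-u)) (hσ : σ = √(1 - exp (-2 * u)))
    (hD : D = exp x - exp (-x)) (hV : V = √(stepVar x (σ ^ 2)))
    {F : Vec d × Vec d → ℝ≥0∞} (hF : Measurable F) :
    ∫⁻ y, ∫⁻ g, F (y, ouStep x y g) ∂(_root_.stdGaussian d) ∂(forwardLaw q0 (u - x))
      = ∫⁻ y, ∫⁻ z, F (z, y) ∂(mixKernel l σ q0 (exp x - D / σ ^ 2) (D * l / σ ^ 2) V y)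
          ∂(forwardLaw q0 u) := by
  have hu : 0 < u := by linarith
  have hS := one_sub_exp_pos hu
  have hσ0 : 0 < σ := hσ ▸ sqrt_pos.2 hS
  have hσ2 : σ ^ 2 = 1 - exp (-2 * u) := by rw [hσ, sq_sqrt hS.le]
  have hS' := one_sub_exp_pos (sub_pos.2 hxu)
  have hA : exp x - D / σ ^ 2 = exp (-x) * √(1 - exp (-2 * (u - x))) ^ 2 / σ ^ 2 := by
    have e1 : exp (-2 * (u - x)) = exp (-2 * u) * exp x ^ 2 := by
      rw [← exp_nat_mul, ← exp_add]; congr 1; push_cast; ring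
    rw [sq_sqrt hS'.le, hσ2, hD, e1, exp_neg x]
    have hz := (exp_pos x).ne'
    have hS0 := hS.ne'
    generalize exp (-2 * u) = w at hS0 ⊢
    field_simp
    ring
  rw [forwardLaw_eq_noised, forwardLaw_eq_noised, stdGaussian_eq_gaussOn, ← hl, ← hσ]
  unfold ouStep
  refine lintegral_noised_reverse hq hσ0 (hl ▸ exp_composition u x)
    (hσ ▸ noise_composition hx hxu) hA ?_ ?_ hF
  · have : exp (-(u - x)) = exp x * l := by rw [hl, ← exp_add]; congr 1; ring
    rw [this]
    field_simp
    ring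
  · rw [hV, hσ2, stepVar_eq hu, sqrt_div (mul_nonneg hS'.le (one_sub_exp_pos hx).le),
      sqrt_mul hS'.le, hσ]

end Forward

section StepSizes

theorem two_thirds_min_le {u : ℝ} (hu : 0 < u) : 2 / 3 * min 1 u ≤ 1 - exp (-2 * u) := by
  have h1 : 1 + 2 * u ≤ exp (2 * u) := by linarith [add_one_le_exp (2 * u)]
  have h2 : exp (-2 * u) ≤ (1 + 2 * u)⁻¹ := by
    rw [neg_mul, exp_neg]; exact inv_anti₀ (by linarith) h1
  have h3 : 2 / 3 * min 1 u ≤ 1 - (1 + 2 * u)⁻¹ := by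
    have : 1 - (1 + 2 * u)⁻¹ = 2 * u / (1 + 2 * u) := by field_simp; ring
    rw [this, le_div_iff₀ (by linarith)]
    rcases le_total u 1 with h | h
    · rw [min_eq_right h]; nlinarith
    · rw [min_eq_left h]; nlinarith
  linarith

theorem step_le_sq {u x κ S : ℝ} (hx : 0 < x) (hxu : x < u) (hκ : 0 < κ)
    (hstep : x ≤ κ * min 1 ((u - x) ^ 2)) (hS : S = 1 - exp (-2 * u)) :
    x ≤ 9 / 4 * κ * S ^ 2 := by
  have h1 := two_thirds_min_le (u := u) (by linarith)
  rw [← hS] at h1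
  have h0 : 0 ≤ min 1 u := le_min (by norm_num) (by linarith)
  have h2 : min 1 ((u - x) ^ 2) ≤ (min 1 u) ^ 2 := by
    rcases le_total u 1 with h | h
    · rw [min_eq_right h]
      exact (min_le_right _ _).trans (by gcongr; linarith)
    · rw [min_eq_left h]; simp
  have h3 : (min 1 u) ^ 2 ≤ 9 / 4 * S ^ 2 := by nlinarith
  calc x ≤ κ * min 1 ((u - x) ^ 2) := hstep
    _ ≤ κ * (9 / 4 * S ^ 2) := by gcongr; exact h2.trans h3
    _ = _ := by ring

variable {x κ S n D v l : ℝ}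

theorem step_le_div (hS : 0 < S) (hS1 : S ≤ 1) (hκ : κ ≤ 1 / 10000)
    (hx : x ≤ 9 / 4 * κ * S ^ 2) : x ≤ S / 1000 := by
  nlinarith [sq_nonneg S]

theorem sq_div_stepVar_le (h0 : 0 < x) (hD0 : 0 ≤ D) (hD : D ≤ 201 / 100 * x)
    (hv : 19 / 10 * x ≤ v) : D ^ 2 / v ≤ 11 / 5 * x := by
  rw [div_le_iff₀ (by linarith)]
  nlinarith

theorem cube_le (hx0 : 0 < x) (hS : 0 < S) (hS1 : S ≤ 1) (hκ : 0 < κ)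
    (hx : x ≤ 9 / 4 * κ * S ^ 2) : (x / S) ^ 3 ≤ 6 * (κ ^ 2 * x) := by
  have h1 : x ^ 2 ≤ (9 / 4 * κ * S ^ 2) ^ 2 := by gcongr
  rw [div_pow, div_le_iff₀ (by positivity)]
  have h2 : S ^ 4 ≤ S ^ 3 := pow_le_pow_of_le_one hS.le hS1 (by norm_num)
  calc x ^ 3 = x * x ^ 2 := by ring
    _ ≤ x * (9 / 4 * κ * S ^ 2) ^ 2 := by gcongr
    _ = 81 / 16 * (x * κ ^ 2) * S ^ 4 := by ring
    _ ≤ 6 * (x * κ ^ 2) * S ^ 3 := by gcongr; norm_num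
    _ = _ := by ring

theorem residual_le (hh0 : 0 < x) (hh : x ≤ 1 / 1000) (hn : 1 ≤ n) :
    (10 * x ^ 2) ^ 2 * n + (10 * x ^ 2) ^ 4 * n ^ 2 + (10 * x) ^ 6 ≤ 102 * (x ^ 3 * n ^ 3) := by
  have hx3 : x ^ 3 ≤ (1 / 1000) ^ 3 := by gcongr
  have hx5 : x ^ 5 ≤ (1 / 1000) ^ 5 := by gcongr
  have hn1 : n ≤ n ^ 3 := le_self_pow₀ hn (by norm_num)
  have hn2 : n ^ 2 ≤ n ^ 3 := pow_le_pow_right₀ hn (by norm_num)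
  have hn3 : 1 ≤ n ^ 3 := one_le_pow₀ hn
  have e1 : (10 * x ^ 2) ^ 2 * n ≤ 100 * (x ^ 3 * n ^ 3) := by
    calc (10 * x ^ 2) ^ 2 * n = 100 * (x ^ 3 * (x * n)) := by ring
      _ ≤ 100 * (x ^ 3 * (1 * n ^ 3)) := by gcongr; linarith
      _ = _ := by ring
  have e2 : (10 * x ^ 2) ^ 4 * n ^ 2 ≤ x ^ 3 * n ^ 3 := by
    calc (10 * x ^ 2) ^ 4 * n ^ 2 = x ^ 3 * ((10000 * x ^ 5) * n ^ 2) := by ring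
      _ ≤ x ^ 3 * (1 * n ^ 3) := by gcongr; linarith
      _ = _ := by ring
  have e3 : (10 * x) ^ 6 ≤ x ^ 3 * n ^ 3 := by
    calc (10 * x) ^ 6 = x ^ 3 * (1000000 * x ^ 3) := by ring
      _ ≤ x ^ 3 * 1 := by gcongr; linarith
      _ ≤ _ := by gcongr
  linarith

theorem tilt_radius_le {β V : ℝ} (hS : 0 < S) (hl : 0 < l) (hl1 : l ≤ 1) (hn : 1 ≤ n)
    (hκn : n ^ 2 * κ ≤ 1 / 10000) (hκ : 0 < κ)
    (hx : x ≤ 9 / 4 * κ * S ^ 2) (hV : 0 < V)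
    (hDV : D ^ 2 / V ^ 2 ≤ 11 / 5 * x) (hβ : β = D * l / S / V) : β * (2 * √n) ≤ 1 / 10 := by
  refine abs_le_of_sq_le_sq' ?_ (by norm_num) |>.2
  have hs : √n ^ 2 = n := sq_sqrt (by linarith)
  have h1 : β ^ 2 = D ^ 2 / V ^ 2 * l ^ 2 / S ^ 2 := by rw [hβ]; field_simp
  have h2 : β ^ 2 ≤ 11 / 5 * (9 / 4 * κ) := by
    rw [h1, div_le_iff₀ (by positivity)]
    have hl2 : l ^ 2 ≤ 1 := pow_le_one₀ hl.le hl1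
    calc D ^ 2 / V ^ 2 * l ^ 2 ≤ D ^ 2 / V ^ 2 * 1 := by gcongr
      _ ≤ 11 / 5 * x := by linarith
      _ ≤ 11 / 5 * (9 / 4 * κ) * S ^ 2 := by linarith
  have h3 : n * κ ≤ 1 / 10000 := by nlinarith
  calc (β * (2 * √n)) ^ 2 = β ^ 2 * (4 * √n ^ 2) := by ring
    _ ≤ 11 / 5 * (9 / 4 * κ) * (4 * n) := by rw [hs]; gcongr
    _ ≤ (1 / 10) ^ 2 := by nlinarith

theorem error_weight_le {M : ℝ} (hS : 0 < S) (hl : 0 < l) (hl1 : l ≤ 1) (hn : 1 ≤ n) (hκ : 0 < κ)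
    (hκ1 : κ ≤ 1) (hx : x ≤ 9 / 4 * κ * S ^ 2) (hM : M = 2 * √n * l / S) :
    x * (M * √M) ≤ 9 * (√κ * √S * n / √l) := by
  have hsn : 1 ≤ √n := one_le_sqrt.2 hn
  have hnn : √n * √n = n := mul_self_sqrt (by linarith)
  have hSS : √S * √S = S := mul_self_sqrt hS.le
  have hll : √l * √l = l := mul_self_sqrt hl.le
  have hκκ : √κ * √κ = κ := mul_self_sqrt hκ.le
  have hS' : 0 < √S := sqrt_pos.2 hS
  have hl' : 0 < √l := sqrt_pos.2 hl
  have hκ' : √κ ≤ 1 := sqrt_le_one.2 hκ1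
  have h1 : √M ≤ 2 * √n * √l / √S := by
    rw [hM, sqrt_div (by positivity), sqrt_mul (by positivity)]
    gcongr
    exact (sqrt_le_left (by positivity)).2 (by nlinarith)
  rw [mul_div_assoc', le_div_iff₀ hl']
  calc x * (M * √M) * √l ≤ 9 / 4 * κ * S ^ 2 * (2 * √n * l / S * (2 * √n * √l / √S)) * √l := by
        rw [← hM]
        have : 0 ≤ M := by rw [hM]; positivity
        gcongr
    _ = 9 * (√κ * √κ) * (√n * √n) * (l * (√l * √l)) * (S / √S) := by
        rw [hκκ]; field_simp; ring
    _ = 9 * (√κ * √S * n) * (√κ * l ^ 2) := by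
        have : S / √S = √S := by rw [div_eq_iff hS'.ne', hSS]
        rw [this, hnn, hll]; ring
    _ ≤ 9 * (√κ * √S * n) * (1 * 1) := by
        gcongr
        exact pow_le_one₀ hl.le hl1
    _ = _ := by ring

theorem le_mul_sqrt_mul_sqrt {A M ε : ℝ} (hA : 0 ≤ A) (hM : 0 ≤ M) (hε : 0 ≤ ε)
    (h1 : A ≤ M ^ 2) (h2 : A ≤ ε ^ 2) : A ≤ M * √M * √ε := by
  have hA1 : √A ≤ M := (sqrt_le_left hM).2 h1
  have hA2 : √A ≤ ε := (sqrt_le_left hε).2 h2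
  calc A = √A * √A := (mul_self_sqrt hA).symm
    _ = √A * (√(√A) * √(√A)) := by rw [mul_self_sqrt (sqrt_nonneg A)]
    _ ≤ M * (√M * √ε) := by gcongr
    _ = _ := by ring

end StepSizes

section OneStep

variable {d : ℕ} {q0 : Measure (Vec d)} [IsProbabilityMeasure q0]

/-- The mean squared error of a bounded score estimate at the randomized evaluation point. -/
theorem lintegral_error_le (hq : ∀ᵐ θ ∂q0, ‖θ‖ ≤ √d) {u x κ ε M : ℝ} (hx0 : 0 < x) (hxu : x < u)
    (hx1 : x ≤ 1 / 1000) (hxκ : x ≤ κ) (hε : 0 ≤ ε) {err : Vec d → Vec d} (herr : Measurable err)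
    (hM : ∀ y, ‖err y‖ ≤ M)
    (hmse : ∀ a ∈ Set.Icc (1 - 3.1 * √(x * κ)) (1 + 3.1 * √(x * κ)),
      ∀ b ∈ Set.Icc (0 : ℝ) (3.5 * √x),
      ∫ p : Vec d × Vec d, ‖err (a • p.1 + b • p.2)‖ ^ 2
        ∂((forwardLaw q0 (u - x)).prod (_root_.stdGaussian d)) ≤ ε ^ 2) :
    ∫⁻ y, ∫⁻ g, ‖err (y + zeta1 x • g)‖ₑ ^ 2 ∂(gaussOn (Vec d)) ∂(forwardLaw q0 u)
      ≤ ENNReal.ofReal (M * √M * √ε) := by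
  have hu : 0 < u := by linarith
  have hS := one_sub_exp_pos hu
  set b := √(√(1 - exp (-2 * x)) ^ 2 + zeta1 x ^ 2) with hb
  have ha : exp (-x) ∈ Set.Icc (1 - 3.1 * √(x * κ)) (1 + 3.1 * √(x * κ)) := by
    have h1 : x ≤ √(x * κ) := le_sqrt_of_sq_le (by nlinarith)
    have h2 := add_one_le_exp (-x)
    have h3 : exp (-x) ≤ 1 := exp_le_one_iff.2 (by linarith)
    constructor <;> linarith
  have hbm : b ∈ Set.Icc (0 : ℝ) (3.5 * √x) := by
    refine ⟨sqrt_nonneg _, ?_⟩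
    have h1 := zeta1_sq_le hx0 hx1
    have h2 := add_one_le_exp (-2 * x)
    rw [hb, sqrt_le_left (by positivity), sq_sqrt (one_sub_exp_pos hx0).le, mul_pow,
      sq_sqrt hx0.le]
    linarith
  have hmse' := hmse _ ha _ hbm
  rw [forwardLaw_eq_noised, lintegral_noised_add hq (sqrt_pos.2 hS) (exp_composition u x)
    (noise_composition hx0 hxu) (F := fun z => ‖err z‖ₑ ^ 2) (by fun_prop), ← hb,
    ← forwardLaw_eq_noised, ← stdGaussian_eq_gaussOn]
  have hmeas : Measurable fun p : Vec d × Vec d => ‖err (exp (-x) • p.1 + b • p.2)‖ ^ 2 := by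
    fun_prop
  have hMsq : ∀ p : Vec d × Vec d, ‖‖err (exp (-x) • p.1 + b • p.2)‖ ^ 2‖ ≤ M ^ 2 := by
    intro p
    rw [norm_of_nonneg (by positivity)]
    exact pow_le_pow_left₀ (norm_nonneg _) (hM _) 2
  have hM0 : 0 ≤ M := (norm_nonneg _).trans (hM 0)
  have h_int : Integrable (fun p : Vec d × Vec d => ‖err (exp (-x) • p.1 + b • p.2)‖ ^ 2)
      ((forwardLaw q0 (u - x)).prod (_root_.stdGaussian d)) :=
    Integrable.of_bound hmeas.aestronglyMeasurable _ (.of_forall hMsq)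
  have heq : ∫⁻ y, ∫⁻ g, ‖err (exp (-x) • y + b • g)‖ₑ ^ 2 ∂(_root_.stdGaussian d)
        ∂(forwardLaw q0 (u - x))
      = ENNReal.ofReal (∫ p : Vec d × Vec d, ‖err (exp (-x) • p.1 + b • p.2)‖ ^ 2
        ∂((forwardLaw q0 (u - x)).prod (_root_.stdGaussian d))) := by
    rw [ofReal_integral_eq_lintegral_ofReal h_int (.of_forall fun p => by positivity),
      lintegral_prod _ (by fun_prop)]
    simp only [enorm_norm_pow]
  rw [heq]
  refine ENNReal.ofReal_le_ofReal (le_mul_sqrt_mul_sqrt (integral_nonneg fun p => by positivity)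
    hM0 hε ?_ hmse')
  have := norm_integral_le_of_norm_le_const
    (μ := (forwardLaw q0 (u - x)).prod (_root_.stdGaussian d)) (.of_forall hMsq)
  rw [norm_of_nonneg (integral_nonneg fun p => by positivity)] at this
  simpa using this

/-- The universal constant of the averaged one-step bound. -/
def stepConst : ℝ≥0∞ := normalizedConst * (2 ^ 7 * 384 * 66 * gaussExpMoment + 612 + 20)

theorem stepConst_ne_top : stepConst ≠ ∞ := by
  have := normalizedConst_ne_top
  have := gaussExpMoment_ne_top
  unfold stepConst
  finiteness

/-- The averaged divergence between the reverse transition and one step of the sampler. -/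
theorem exists_klDiv_step_le (hd : 1 ≤ d) (hq : ∀ᵐ θ ∂q0, ‖θ‖ ≤ √d) {u x κ ε l σ D V : ℝ}
    (hx0 : 0 < x) (hxu : x < u) (hκ : 0 < κ) (hstep : x ≤ κ * min 1 ((u - x) ^ 2))
    (hκd : (d : ℝ) ^ 2 * κ ≤ 1 / 10000) (hl : l = exp (-u)) (hσ : σ = √(1 - exp (-2 * u)))
    (hD : D = exp x - exp (-x)) (hV : V = √(stepVar x (σ ^ 2))) (hε : 0 ≤ ε)
    {err : Vec d → Vec d} (herr : Measurable err) (herr1 : ∀ y, σ ^ 2 / l * ‖err y‖ ≤ 2 * √d)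
    (hmse : ∀ a ∈ Set.Icc (1 - 3.1 * √(x * κ)) (1 + 3.1 * √(x * κ)),
      ∀ b ∈ Set.Icc (0 : ℝ) (3.5 * √x),
      ∫ p : Vec d × Vec d, ‖err (a • p.1 + b • p.2)‖ ^ 2
        ∂((forwardLaw q0 (u - x)).prod (_root_.stdGaussian d)) ≤ ε ^ 2) :
    ∃ B : Vec d → ℝ≥0∞, Measurable B ∧
      (∀ y, InformationTheory.klDiv (mixKernel l σ q0 (exp x - D / σ ^ 2) (D * l / σ ^ 2) V y)
        (((gaussOn (Vec d)).prod (gaussOn (Vec d))).map fun g =>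
          exp x • y + D • ((l / σ ^ 2) • postMean l σ q0 (y + zeta1 x • g.1)
            - (1 / σ ^ 2) • (y + zeta1 x • g.1) + err (y + zeta1 x • g.1))
            + zeta2 x • g.1 + zeta3 x • g.2) ≤ B y) ∧
      ∫⁻ y, B y ∂(forwardLaw q0 u) ≤ stepConst * ENNReal.ofReal
        ((d : ℝ) ^ 3 * κ ^ 2 * x + √ε * √κ * σ * d / √l) := by
  have hu : 0 < u := by linarith
  have hS := one_sub_exp_pos hu
  have hσ0 : 0 < σ := hσ ▸ sqrt_pos.2 hS
  have hσ2 : σ ^ 2 = 1 - exp (-2 * u) := by rw [hσ, sq_sqrt hS.le]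
  have hS0 : 0 < σ ^ 2 := by positivity
  have hS1 : σ ^ 2 ≤ 1 := by rw [hσ2]; linarith [exp_pos (-2 * u)]
  have hl0 : 0 < l := hl ▸ exp_pos _
  have hl1 : l ≤ 1 := hl ▸ exp_le_one_iff.2 (by linarith)
  have hn : (1 : ℝ) ≤ d := by exact_mod_cast hd
  have hκ1 : κ ≤ 1 / 10000 := by nlinarith [one_le_pow₀ hn (n := 2)]
  have hxS := step_le_sq hx0 hxu hκ hstep hσ2
  have hx := step_le_div hS0 hS1 hκ1 hxS
  have hx1 : x ≤ 1 / 1000 := by linarith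
  have hxκ : x ≤ κ := hstep.trans (mul_le_of_le_one_right hκ.le (min_le_left _ _))
  have hDm := exp_sub_exp_neg_mem hx0 hx1
  rw [← hD] at hDm
  have hD0 : 0 < D := by linarith
  have hvm := stepVar_mem hx0 hS0 hS1 hx
  have hv0 : 0 < stepVar x (σ ^ 2) := by linarith
  have hV0 : 0 < V := hV ▸ sqrt_pos.2 hv0
  have hV2 : V ^ 2 = stepVar x (σ ^ 2) := by rw [hV, sq_sqrt hv0.le]
  have hDV : D ^ 2 / V ^ 2 ≤ 11 / 5 * x := by
    rw [hV2]; exact sq_div_stepVar_le hx0 hD0.le hDm.2 hvm.1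
  set β := D * l / σ ^ 2 / V with hβ
  have hβ0 : 0 ≤ β := by positivity
  set M := 2 * √d * l / σ ^ 2 with hM
  have hM0 : 0 ≤ M := by positivity
  have herrM : ∀ y, ‖err y‖ ≤ M := by
    intro y
    rw [hM, le_div_iff₀ hS0]
    have := herr1 y
    rw [div_mul_eq_mul_div, div_le_iff₀ hl0] at this
    linarith
  have hh0 : 0 < x / σ ^ 2 := by positivity
  have hh1 : x / σ ^ 2 ≤ 1 / 1000 := by rw [div_le_iff₀ hS0]; linarith
  have hcube := cube_le hx0 hS0 hS1 hκ hxS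
  have hpost := isMarkovKernel_postKernel (l := l) (σ := σ) hq
  set X := (d : ℝ) ^ 3 * κ ^ 2 * x with hX
  set Y := √ε * √κ * σ * d / √l with hY
  have hX0 : 0 ≤ X := by positivity
  have hY0 : 0 ≤ Y := by positivity
  have hm1 : Measurable fun y => ∫⁻ θ, ‖β • (θ - postMean l σ q0 y)‖ₑ ^ 6
      ∂(postKernel l σ q0 y) :=
    Measurable.lintegral_kernel_prod_right'
      (f := fun p : Vec d × Vec d => ‖β • (p.2 - postMean l σ q0 p.1)‖ₑ ^ 6) (by fun_prop)
  have hm2 : Measurable fun y => ∫⁻ g, ‖(D / V) • err (y + zeta1 x • g)‖ₑ ^ 2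
      ∂(gaussOn (Vec d)) :=
    Measurable.lintegral_prod_right'
      (f := fun p : Vec d × Vec d => ‖(D / V) • err (p.1 + zeta1 x • p.2)‖ₑ ^ 2) (by fun_prop)
  refine ⟨_, ?_, fun y => klDiv_mixKernel_le hq hσ0 hS1 hx0 hx hD hV hβ hl0
    (tilt_radius_le hS0 hl0 hl1 hn hκd hκ hxS hV0 hDV hβ) herr herr1 y, ?_⟩
  · fun_prop
  have hI1 : ∫⁻ y, ∫⁻ θ, ‖β • (θ - postMean l σ q0 y)‖ₑ ^ 6 ∂(postKernel l σ q0 y)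
      ∂(forwardLaw q0 u) ≤ 2 ^ 7 * 384 * 66 * gaussExpMoment * ENNReal.ofReal X := by
    rw [forwardLaw_eq_noised, ← hl, ← hσ]
    refine (lintegral_posterior_pow_six_le hq hσ0 hl0 β).trans ?_
    rw [finrank_euclideanSpace_fin]
    have hβσ : (β * (σ / l)) ^ 2 ≤ 11 / 5 * (x / σ ^ 2) := by
      have : (β * (σ / l)) ^ 2 = D ^ 2 / V ^ 2 / σ ^ 2 := by rw [hβ]; field_simp
      rw [this, ← mul_div_assoc]
      gcongr
    have h6 : 384 * (β * (σ / l)) ^ 6 * (d : ℝ) ^ 3 ≤ 384 * 66 * X := by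
      calc 384 * (β * (σ / l)) ^ 6 * (d : ℝ) ^ 3
          = 384 * ((β * (σ / l)) ^ 2) ^ 3 * (d : ℝ) ^ 3 := by ring
        _ ≤ 384 * (11 / 5 * (x / σ ^ 2)) ^ 3 * (d : ℝ) ^ 3 := by gcongr
        _ = 384 * (11 / 5) ^ 3 * (x / σ ^ 2) ^ 3 * (d : ℝ) ^ 3 := by ring
        _ ≤ 384 * 11 * (6 * (κ ^ 2 * x)) * (d : ℝ) ^ 3 := by gcongr; norm_num
        _ = 384 * 66 * X := by rw [hX]; ring
    calc 2 ^ 7 * ENNReal.ofReal (384 * (β * (σ / l)) ^ 6) * gaussExpMoment * (d : ℝ≥0∞) ^ 3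
        = 2 ^ 7 * gaussExpMoment
          * ENNReal.ofReal (384 * (β * (σ / l)) ^ 6 * (d : ℝ) ^ 3) := by
          rw [ENNReal.ofReal_mul (q := (d : ℝ) ^ 3) (by positivity),
            ENNReal.ofReal_pow (p := (d : ℝ)) (by positivity), ENNReal.ofReal_natCast]
          ring
      _ ≤ 2 ^ 7 * gaussExpMoment * ENNReal.ofReal (384 * 66 * X) := by gcongr
      _ = _ := by
          rw [ENNReal.ofReal_mul (by norm_num), ENNReal.ofReal_mul (by norm_num)]
          simp only [ENNReal.ofReal_ofNat]
          ring
  have hI2 : ENNReal.ofReal (10 * (x / σ ^ 2) ^ 2) ^ 2 * (Module.finrank ℝ (Vec d) : ℝ≥0∞)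
      + ENNReal.ofReal (10 * (x / σ ^ 2) ^ 2) ^ 4 * (Module.finrank ℝ (Vec d) : ℝ≥0∞) ^ 2
      + ENNReal.ofReal (10 * (x / σ ^ 2)) ^ 6 ≤ 612 * ENNReal.ofReal X := by
    rw [finrank_euclideanSpace_fin, ← ENNReal.ofReal_natCast, ← ENNReal.ofReal_pow (by positivity),
      ← ENNReal.ofReal_pow (by positivity), ← ENNReal.ofReal_pow (by positivity),
      ← ENNReal.ofReal_pow (by positivity), ← ENNReal.ofReal_mul (by positivity),
      ← ENNReal.ofReal_mul (by positivity), ← ENNReal.ofReal_add (by positivity) (by positivity),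
      ← ENNReal.ofReal_add (by positivity) (by positivity), ← ENNReal.ofReal_ofNat 612,
      ← ENNReal.ofReal_mul (by norm_num)]
    refine ENNReal.ofReal_le_ofReal ((residual_le hh0 hh1 hn).trans ?_)
    calc 102 * ((x / σ ^ 2) ^ 3 * (d : ℝ) ^ 3) ≤ 102 * (6 * (κ ^ 2 * x) * (d : ℝ) ^ 3) := by gcongr
      _ = 612 * X := by rw [hX]; ring
  have hI3 : ∫⁻ y, ∫⁻ g, ‖(D / V) • err (y + zeta1 x • g)‖ₑ ^ 2 ∂(gaussOn (Vec d))
      ∂(forwardLaw q0 u) ≤ 20 * ENNReal.ofReal Y := by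
    have hpull : ∀ y, ∫⁻ g, ‖(D / V) • err (y + zeta1 x • g)‖ₑ ^ 2 ∂(gaussOn (Vec d))
        = ENNReal.ofReal (D ^ 2 / V ^ 2)
          * ∫⁻ g, ‖err (y + zeta1 x • g)‖ₑ ^ 2 ∂(gaussOn (Vec d)) := by
      intro y
      rw [← lintegral_const_mul _ (by fun_prop)]
      refine lintegral_congr fun g => ?_
      rw [enorm_smul, mul_pow, enorm_norm_pow, norm_eq_abs, sq_abs, div_pow]
    simp_rw [hpull]
    rw [lintegral_const_mul _ (Measurable.lintegral_prod_right'
      (f := fun p : Vec d × Vec d => ‖err (p.1 + zeta1 x • p.2)‖ₑ ^ 2) (by fun_prop))]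
    refine (mul_le_mul' le_rfl
      (lintegral_error_le hq hx0 hxu hx1 hxκ hε herr herrM hmse)).trans ?_
    rw [← ENNReal.ofReal_mul (by positivity), ← ENNReal.ofReal_ofNat 20,
      ← ENNReal.ofReal_mul (by norm_num)]
    refine ENNReal.ofReal_le_ofReal ?_
    have hw := error_weight_le hS0 hl0 hl1 hn hκ (by linarith) hxS hM
    rw [sqrt_sq hσ0.le] at hw
    calc D ^ 2 / V ^ 2 * (M * √M * √ε) ≤ 11 / 5 * x * (M * √M * √ε) := by gcongr
      _ = 11 / 5 * (x * (M * √M)) * √ε := by ring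
      _ ≤ 11 / 5 * (9 * (√κ * σ * d / √l)) * √ε := by gcongr
      _ = 99 / 5 * Y := by rw [hY]; ring
      _ ≤ 20 * Y := by gcongr; norm_num
  rw [lintegral_const_mul _ (by fun_prop), lintegral_add_left (by fun_prop),
    lintegral_add_left (by fun_prop), lintegral_const, measure_univ, mul_one, stepConst,
    mul_assoc normalizedConst]
  refine mul_le_mul' le_rfl ((add_le_add (add_le_add hI1 hI2) hI3).trans ?_)
  rw [add_mul, add_mul]
  have hXY : ENNReal.ofReal X ≤ ENNReal.ofReal (X + Y) := ENNReal.ofReal_le_ofReal (by linarith)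
  have hYX : ENNReal.ofReal Y ≤ ENNReal.ofReal (X + Y) := ENNReal.ofReal_le_ofReal (by linarith)
  gcongr

end OneStep

theorem klDiv'_le_of_klDiv_le {α : Type*} [MeasurableSpace α] {μ ν : Measure α}
    [IsProbabilityMeasure μ] [IsProbabilityMeasure ν] {b : ℝ≥0∞} (hb : b ≠ ⊤)
    (h : InformationTheory.klDiv μ ν ≤ b) : klDiv' μ ν ≤ b.toReal := by
  have hac := (InformationTheory.klDiv_ne_top_iff.1 (ne_top_of_le_ne_top hb h)).1
  have heq := InformationTheory.toReal_klDiv_of_measure_eq hac (by simp)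
  refine (le_of_eq ?_).trans (ENNReal.toReal_mono hb h)
  rw [heq]
  rfl

/-- **Lemma (KL bound between the discretized reverse process and the sampler chain).**
Under the bounded-support, step-size and score-estimation assumptions,
`KL(Q^dis ‖ Q̂^dis) ≤ C (d³κ²T + d⁷κ³(δ⁻¹ + T) + Σ_k √ε_k √κ σ_{T-t_k} d λ_{T-t_k}^{-1/2})`. -/
theorem kl_discretized_chains :
    ∃ c₀ > (0:ℝ), ∃ C > (0:ℝ),
    ∀ (d : ℕ), 1 ≤ d →
    ∀ (q0 : Measure (Vec d)), IsProbabilityMeasure q0 →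
    (∀ᵐ y ∂q0, ‖y‖ ≤ Real.sqrt d) →
    ∀ (ρ : ℝ → Vec d → ℝ),
    (∀ u, 0 < u → forwardLaw q0 u = volume.withDensity fun x => ENNReal.ofReal (ρ u x)) →
    (∀ u, 0 < u → ∀ x, 0 < ρ u x) →
    (∀ u, 0 < u → ContDiff ℝ (⊤ : ℕ∞) (ρ u)) →
    ∀ (T : ℝ), 0 < T →
    ∀ (K : ℕ) (t : ℕ → ℝ),
    t 0 = 0 → (∀ k < K, t k < t (k+1)) → t K < T →
    ∀ (κ : ℝ), 0 < κ → κ < 1/4 →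
    (∀ k < K, t (k+1) - t k ≤ κ * min 1 ((T - t (k+1))^2)) →
    ((d:ℝ)^2 * κ ≤ c₀) →
    (∀ k < K,
      1.3 * (t (k+1) - t k)
        + (53 * (t (k+1) - t k) + 10 * (t (k+1) - t k)^2)
          * ((1 - Real.exp (-2*(T - t k)))⁻¹
              + Real.exp (-(T - t k))^2 * ((1 - Real.exp (-2*(T - t k)))^2)⁻¹) * d ≤ 1/2) →
    ∀ (sHat : ℕ → Vec d → Vec d), (∀ k, Measurable (sHat k)) →
    ∀ (εk : ℕ → ℝ), (∀ k, 0 ≤ εk k) →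
    (∀ k < K, ∀ a ∈ Set.Icc (1 - 3.1 * Real.sqrt ((t (k+1) - t k) * κ))
                            (1 + 3.1 * Real.sqrt ((t (k+1) - t k) * κ)),
      ∀ b ∈ Set.Icc (0:ℝ) (3.5 * Real.sqrt (t (k+1) - t k)),
      ∫ p : Vec d × Vec d,
          ‖sHat k (a • p.1 + b • p.2) - score ρ T (t k) (a • p.1 + b • p.2)‖^2
        ∂((forwardLaw q0 (T - t (k+1))).prod (stdGaussian d)) ≤ (εk k)^2) →
    (∀ k < K, ∀ y : Vec d,
      (1 - Real.exp (-2*(T - t k))) / Real.exp (-(T - t k)) * ‖sHat k y - score ρ T (t k) y‖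
        ≤ 2 * Real.sqrt d) →
    klDiv' (Qdis q0 T K t) (QhatDis q0 T K t sHat)
      ≤ C * ((d:ℝ)^3 * κ^2 * T + (d:ℝ)^7 * κ^3 * ((T - t K)⁻¹ + T)
          + ∑ k ∈ Finset.range K,
              Real.sqrt (εk k) * Real.sqrt κ * Real.sqrt (1 - Real.exp (-2*(T - t k))) * d
                / Real.sqrt (Real.exp (-(T - t k)))) := by
  refine ⟨1 / 10000, by norm_num, stepConst.toReal + 1, by positivity, ?_⟩
  intro d hd q0 hq0 hq ρ hρ hpos hsmooth T hT K t ht0 htlt htK κ hκ _ hstep hκd _ sHat hs εk hε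
    hmse hsup
  have hmono : MonotoneOn t (Set.Iic K) := by
    refine monotoneOn_of_le_succ Set.ordConnected_Iic fun k _ _ hk => ?_
    rw [Order.succ_eq_add_one] at hk ⊢
    exact (htlt k (Nat.lt_of_succ_le hk)).le
  have hlt : ∀ k ≤ K, t k < T := fun k hk => (hmono hk (Set.mem_Iic.2 le_rfl) hk).trans_lt htK
  have hb : ∀ k < K, 0 ≤ (d : ℝ) ^ 3 * κ ^ 2 * (t (k + 1) - t k) := fun k hk => by
    have := htlt k hk
    have : 0 ≤ t (k + 1) - t k := by linarith
    positivity
  set w : ℕ → ℝ := fun k => √(εk k) * √κ * √(1 - exp (-2 * (T - t k))) * d / √(exp (-(T - t k)))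
    with hw
  have hw0 : ∀ k, 0 ≤ w k := fun k => by positivity
  have hkl := klDiv_Qdis_le (q0 := q0) (T := T) (t := t) hs ht0
    (b := fun k => stepConst * ENNReal.ofReal ((d : ℝ) ^ 3 * κ ^ 2 * (t (k + 1) - t k) + w k)) K
    (by
      intro k hk
      have hx0 : 0 < t (k + 1) - t k := sub_pos.2 (htlt k hk)
      have hxu : t (k + 1) - t k < T - t k := by linarith [hlt (k + 1) hk]
      have hu : 0 < T - t k := hx0.trans hxu
      have hux : T - t k - (t (k + 1) - t k) = T - t (k + 1) := by ring
      have hσsq : √(1 - exp (-2 * (T - t k))) ^ 2 = 1 - exp (-2 * (T - t k)) :=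
        sq_sqrt (one_sub_exp_pos hu).le
      have hsc := score_eq hq (hlt k hk.le) (hρ _ hu) (hpos _ hu) (hsmooth _ hu).continuous rfl rfl
      have hrev := fun F (hF : Measurable F) =>
        lintegral_forwardLaw_reverse (F := F) hq hx0 hxu rfl rfl rfl rfl hF
      rw [hux] at hrev
      refine ⟨_, isMarkovKernel_mixKernel hq _ _ _, hrev, ?_⟩
      obtain ⟨B, hB, hBle, hBint⟩ := exists_klDiv_step_le hd hq hx0 hxu hκ
        (by rw [hux]; exact hstep k hk) hκd rfl rfl rfl rfl (hε k)
        (err := fun z => sHat k z - ((exp (-(T - t k)) / √(1 - exp (-2 * (T - t k))) ^ 2)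
          • postMean (exp (-(T - t k))) (√(1 - exp (-2 * (T - t k)))) q0 z
          - (1 / √(1 - exp (-2 * (T - t k))) ^ 2) • z))
        (by have := hs k; fun_prop)
        (fun y => by rw [← hsc, hσsq]; exact hsup k hk y)
        (fun a ha b hb => by
          rw [hux]
          simp only [← hsc]
          exact hmse k hk a ha b hb)
      refine ⟨B, hB, fun y => ?_, hBint⟩
      refine le_of_eq_of_le ?_ (hBle y)
      simp only [add_sub_cancel, ← stdGaussian_eq_gaussOn]
      rfl)
  have := isProbabilityMeasure_QhatDis (q0 := q0) (T := T) (t := t) hs K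
  have hfin : stepConst * ENNReal.ofReal
      (∑ k ∈ Finset.range K, ((d : ℝ) ^ 3 * κ ^ 2 * (t (k + 1) - t k) + w k)) ≠ ⊤ :=
    ENNReal.mul_ne_top stepConst_ne_top ENNReal.ofReal_ne_top
  have hnonneg : ∀ k ∈ Finset.range K,
      0 ≤ (d : ℝ) ^ 3 * κ ^ 2 * (t (k + 1) - t k) + w k := fun k hk =>
    add_nonneg (hb k (Finset.mem_range.1 hk)) (hw0 k)
  rw [← Finset.mul_sum, ← ENNReal.ofReal_sum_of_nonneg hnonneg] at hkl
  refine (klDiv'_le_of_klDiv_le hfin hkl).trans ?_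
  rw [ENNReal.toReal_mul, ENNReal.toReal_ofReal (Finset.sum_nonneg hnonneg)]
  have hδ : 0 < T - t K := sub_pos.2 htK
  have hextra : 0 ≤ (d : ℝ) ^ 7 * κ ^ 3 * ((T - t K)⁻¹ + T) := by positivity
  have hsum : ∑ k ∈ Finset.range K, ((d : ℝ) ^ 3 * κ ^ 2 * (t (k + 1) - t k) + w k)
      ≤ (d : ℝ) ^ 3 * κ ^ 2 * T + (d : ℝ) ^ 7 * κ ^ 3 * ((T - t K)⁻¹ + T)
        + ∑ k ∈ Finset.range K, w k := by
    rw [Finset.sum_add_distrib, ← Finset.mul_sum, Finset.sum_range_sub, ht0, sub_zero]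
    have : (d : ℝ) ^ 3 * κ ^ 2 * t K ≤ (d : ℝ) ^ 3 * κ ^ 2 * T := by gcongr
    linarith
  exact mul_le_mul (by linarith) hsum (Finset.sum_nonneg hnonneg) (by positivity)

end
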